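/- arXiv:2603.29011 — 2 statements merged into one kernel-verified Lean document; each statement's English description precedes it below -/
import Mathlib

section
/- Let X be a 1-separated metric space (distinct points are at distance at least 1), and equip the lamplighter space La(X) with the metric d_La = TSP + ρ. Then the following are equivalent: (i) X is TSP-efficient, i.e. K-TSP-efficient for some K < ∞; (ii) La(X) admits a weak biLipschitz embedding into an ℓ∞-product of finitely many ℝ-trees; (iii) La(X) has finite Nagata dimension; (iv) La(X) has Markov type 2; (v) there is no constant D < ∞ such that every Hamming cube H_M (M ∈ ℕ) admits a biLipschitz embedding into La(X) with distortion at most D. -/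
open Metric Set
open scoped Classical ENNReal NNReal

noncomputable section

/-- The underlying set of the lamplighter space over `X`: a lamp configuration
(a finite set of lit lamps) together with the position of the lamplighter. -/
abbrev Lamp (X : Type*) := Finset X × X

namespace Lamplighter

variable {X Y Z : Type*}

/-- The length of the path visiting the points of a list in order,
with respect to the distance function `d`. -/
def pathLength (d : X → X → ℝ) : List X → ℝ
  | [] => 0
  | [_] => 0
  | x :: y :: l => d x y + pathLength d (y :: l)

/-- The symmetric difference of the lamp configurations of `p` and `q`, as a set. -/
def sd (p q : Lamp X) : Set X :=
  ((p.1 : Set X) \ (q.1 : Set X)) ∪ ((q.1 : Set X) \ (p.1 : Set X))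

/-- The traveling salesman semimetric on the lamplighter space:
the infimum of lengths of finite paths starting at `p.2`, ending at `q.2`, and
visiting every point of the symmetric difference of the configurations. -/
def TSP (d : X → X → ℝ) (p q : Lamp X) : ℝ :=
  sInf { s : ℝ | ∃ l : List X, l.head? = some p.2 ∧ l.getLast? = some q.2 ∧
    (∀ a ∈ sd p q, a ∈ l) ∧ s = pathLength d l }

/-- The diameter (in `ℝ≥0∞`) of a set with respect to a distance function `d`. -/
def ediamD (d : X → X → ℝ) (A : Set X) : ℝ≥0∞ :=
  ⨆ x ∈ A, ⨆ y ∈ A, ENNReal.ofReal (d x y)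

/-- The traveling salesman shortcut semimetric:
`TSCP((A,x),(B,y)) = diam({x,y} ∪ (A Δ B))`. -/
def TSCP (d : X → X → ℝ) (p q : Lamp X) : ℝ :=
  (ediamD d ({p.2, q.2} ∪ sd p q)).toReal

/-- `ρ((A,x),(B,y))` is `0` if `A = B` and `1` otherwise. -/
def rho (p q : Lamp X) : ℝ := if p.1 = q.1 then 0 else 1

/-- The lamplighter metric `d_La = TSP + ρ`. -/
def dLa (d : X → X → ℝ) (p q : Lamp X) : ℝ := TSP d p q + rho p q

/-- `X` is `K`-TSP-efficient if `TSP ≤ K • TSCP` on `La(X)²`. -/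
def TSPEfficient (d : X → X → ℝ) (K : ℝ) : Prop :=
  ∀ p q : Lamp X, TSP d p q ≤ K * TSCP d p q

/-- A weak `C`-biLipschitz embedding between spaces with distance functions `dY`, `dZ`:
a family of maps `φ t : Y → Z` (for `t > 0`) such that each `φ t` is `σ t`-Lipschitz
and `dY x y ≥ C*t` implies `dZ (φ t x) (φ t y) ≥ t * σ t`. -/
def WeakBiLip (dY : Y → Y → ℝ) (dZ : Z → Z → ℝ) (C : ℝ) : Prop :=
  ∃ φ : ℝ → Y → Z, ∀ t : ℝ, 0 < t → ∃ σ : ℝ, 0 < σ ∧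
    (∀ x y : Y, dZ (φ t x) (φ t y) ≤ σ * dY x y) ∧
    (∀ x y : Y, C * t ≤ dY x y → t * σ ≤ dZ (φ t x) (φ t y))

/-- `f` is a `C`-biLipschitz embedding (an injective map of biLipschitz
distortion at most `C`, allowing an overall scaling factor `s`). -/
def BiLipWith (dY : Y → Y → ℝ) (dZ : Z → Z → ℝ) (C : ℝ) (f : Y → Z) : Prop :=
  Function.Injective f ∧ ∃ s : ℝ, 0 < s ∧
    ∀ x y : Y, s * dY x y ≤ dZ (f x) (f y) ∧ dZ (f x) (f y) ≤ C * s * dY x y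

/-- Nagata dimension at most `n` with constant at most `γ`: for every scale `s > 0`
there is a covering by sets of diameter at most `γ s` such that every set of diameter
less than `s` meets at most `n + 1` members of the covering. -/
def NagataDimD (d : Y → Y → ℝ) (n : ℕ) (γ : ℝ) : Prop :=
  ∀ s : ℝ, 0 < s → ∃ B : Set (Set Y),
    (∀ y : Y, ∃ b ∈ B, y ∈ b) ∧
    (∀ b ∈ B, ediamD d b ≤ ENNReal.ofReal (γ * s)) ∧
    (∀ A : Set Y, ediamD d A < ENNReal.ofReal s →
      {b | b ∈ B ∧ (b ∩ A).Nonempty}.encard ≤ ((n : ℕ∞) + 1))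

/-- Markov type 2 with constant `M`, for the distance function `d`: for every stationary
reversible Markov chain on a finite state space (given by a stationary distribution `μ`
and a reversible stochastic transition matrix `P`), every map `f` into the space, and
every time `t`, `E[d(f(Z_t),f(Z_0))²] ≤ M² t E[d(f(Z_1),f(Z_0))²]`. -/
def HasMarkovType2 (d : Y → Y → ℝ) (M : ℝ) : Prop :=
  ∀ (n : ℕ) (μ : Fin n → ℝ) (P : Matrix (Fin n) (Fin n) ℝ),
    (∀ i, 0 ≤ μ i) → (∑ i, μ i) = 1 →
    (∀ i j, 0 ≤ P i j) → (∀ i, (∑ j, P i j) = 1) →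
    (∀ i j, μ i * P i j = μ j * P j i) →
    ∀ (f : Fin n → Y) (t : ℕ),
      (∑ i, ∑ j, μ i * (P ^ t) i j * d (f i) (f j) ^ 2) ≤
        M ^ 2 * t * ∑ i, ∑ j, μ i * P i j * d (f i) (f j) ^ 2

/-- `D`-doubling: every ball of radius `r` can be covered by `D` balls of radius `r/2`. -/
def Doubling (d : Y → Y → ℝ) (D : ℕ) : Prop :=
  ∀ r : ℝ, 0 < r → ∀ x : Y, ∃ c : Fin D → Y,
    ∀ y : Y, d x y ≤ r → ∃ i, d (c i) y ≤ r / 2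

/-- `A` is an arc from `x` to `y`: the image of an injective continuous map of `[0,1]`
sending the endpoints to `x` and `y`. -/
def IsArc {T : Type*} [MetricSpace T] (x y : T) (A : Set T) : Prop :=
  ∃ γ : ℝ → T, ContinuousOn γ (Icc 0 1) ∧ InjOn γ (Icc 0 1) ∧
    γ 0 = x ∧ γ 1 = y ∧ γ '' (Icc 0 1) = A

/-- `A` is a geodesic segment from `x` to `y`: the image of an isometric embedding
of `[0, dist x y]` sending the endpoints to `x` and `y`. -/
def IsGeodesicSeg {T : Type*} [MetricSpace T] (x y : T) (A : Set T) : Prop :=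
  ∃ γ : ℝ → T, γ 0 = x ∧ γ (dist x y) = y ∧
    (∀ s ∈ Icc (0 : ℝ) (dist x y), ∀ t ∈ Icc (0 : ℝ) (dist x y),
      dist (γ s) (γ t) = |s - t|) ∧
    γ '' (Icc 0 (dist x y)) = A

/-- `T` is an ℝ-tree: any two (distinct) points are joined by a unique arc,
and this arc is a geodesic. -/
def IsRTree (T : Type*) [MetricSpace T] : Prop :=
  ∀ x y : T, x ≠ y →
    (∃ A : Set T, IsArc x y A) ∧
    (∀ A A' : Set T, IsArc x y A → IsArc x y A' → A = A') ∧
    (∀ A : Set T, IsArc x y A → IsGeodesicSeg x y A)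

/-- The sup (ℓ∞-product) distance on a finite product of metric spaces. -/
def piSupDist {n : ℕ} {T : Fin n → Type*} (I : ∀ i, MetricSpace (T i)) :
    (∀ i, T i) → (∀ i, T i) → ℝ :=
  letI := I
  fun f g => dist f g

/-- The ℓ1-product distance on a finite product of metric spaces. -/
def piL1Dist {n : ℕ} {T : Fin n → Type*} (I : ∀ i, MetricSpace (T i)) :
    (∀ i, T i) → (∀ i, T i) → ℝ :=
  letI := I
  fun f g => ∑ i, dist (f i) (g i)

/-- The ℓ1 distance on `ℝ^m`. -/
def l1Dist (m : ℕ) (x y : Fin m → ℝ) : ℝ := ∑ i, |x i - y i|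

/-- The ℓp distance on `ℝ^m`. -/
def lpDist (m : ℕ) (p : ℝ) (x y : Fin m → ℝ) : ℝ :=
  (∑ i, |x i - y i| ^ p) ^ (1 / p)

/-- The (pseudo)distance of the ℝ-star over the index type `ι`: the wedge sum of
copies of `[0,∞)` indexed by `ι`, glued at `0`. -/
def starDist {ι : Type*} (p q : ι × ℝ≥0) : ℝ :=
  if p.1 = q.1 then |(p.2 : ℝ) - (q.2 : ℝ)| else (p.2 : ℝ) + (q.2 : ℝ)

/-- The sup (ℓ∞-product) of finitely many distance functions. -/
def supD {n : ℕ} {T : Fin n → Type*} (d : ∀ i, T i → T i → ℝ) (f g : ∀ i, T i) : ℝ :=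
  ((Finset.univ.sup fun i => (d i (f i) (g i)).toNNReal : ℝ≥0) : ℝ)

/-- The infimum of distortions of biLipschitz embeddings of `(Y, dY)` into `(Z, dZ)`
(`∞` if there is no such embedding). -/
def cEmb (dY : Y → Y → ℝ) (dZ : Z → Z → ℝ) : ℝ≥0∞ :=
  sInf { D : ℝ≥0∞ | ∃ C : ℝ, 0 < C ∧ D = ENNReal.ofReal C ∧
    ∃ f : Y → Z, BiLipWith dY dZ C f }

/-- `c_1^{m,dom}(X,d)`: the infimum of all `D > 0` such that there exist injective
`1`-Lipschitz maps `φ i : X → ℝ` and weights `α i ≥ 0` summing to `1` with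
`∑ i, α i * |φ i x - φ i y| ≥ d x y / D` for all `x y` (`∞` if there is none). -/
def c1dom (d : X → X → ℝ) (m : ℕ) : ℝ≥0∞ :=
  sInf { D : ℝ≥0∞ | ∃ C : ℝ, 0 < C ∧ D = ENNReal.ofReal C ∧
    ∃ (φ : Fin m → X → ℝ) (α : Fin m → ℝ),
      (∀ i, Function.Injective (φ i)) ∧
      (∀ i, ∀ x y : X, |φ i x - φ i y| ≤ d x y) ∧
      (∀ i, 0 ≤ α i) ∧ (∑ i, α i) = 1 ∧
      ∀ x y : X, d x y / C ≤ ∑ i, α i * |φ i x - φ i y| }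

/-- The Hamming distance on the Hamming cube `{0,1}^M`, as a real number. -/
def hamDist {M : ℕ} (x y : Fin M → Bool) : ℝ :=
  ((Finset.univ.filter fun i => x i ≠ y i).card : ℝ)

/-- The star graph `St_{n,k}`: the one-point coalescence of `n` paths of length `k`,
realized inside `ℤ^n` as the multiples `α eᵢ` with `0 ≤ α ≤ k`. -/
def St (n k : ℕ) : Type :=
  {x : Fin n → ℤ // ∃ i : Fin n, (∀ j : Fin n, j ≠ i → x j = 0) ∧ 0 ≤ x i ∧ x i ≤ (k : ℤ)}

/-- The ℓ1 metric on the star graph `St_{n,k}`. -/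
def stDist {n k : ℕ} (x y : St n k) : ℝ := ∑ j, |(x.1 j : ℝ) - (y.1 j : ℝ)|

/-- The endpoint `k eᵢ` of the `i`-th branch of the star graph. -/
def St.endpoint {n k : ℕ} (i : Fin n) : St n k :=
  ⟨fun j => if j = i then (k : ℤ) else 0, i, fun j hj => if_neg hj, by simp, by simp⟩

/-- The cycle metric on `ℤ/nℤ`. -/
def cycDist {n : ℕ} (a b : ZMod n) : ℝ := ((min ((a - b).val) ((b - a).val) : ℕ) : ℝ)

/-- The rectangular grid `G_{k,n} = ([0,k] ∩ ℤ) × ([0,n] ∩ ℤ)`. -/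
def Grid2 (k n : ℕ) : Type :=
  {p : ℤ × ℤ // 0 ≤ p.1 ∧ p.1 ≤ (k : ℤ) ∧ 0 ≤ p.2 ∧ p.2 ≤ (n : ℤ)}

/-- The ℓ1 metric on the grid `G_{k,n}`. -/
def grid2Dist {k n : ℕ} (x y : Grid2 k n) : ℝ :=
  |(x.1.1 : ℝ) - (y.1.1 : ℝ)| + |(x.1.2 : ℝ) - (y.1.2 : ℝ)|

/-- The `m`-dimensional grid `G^m({n_i}) = ∏ i, ([0, n_i] ∩ ℤ)`. -/
def GridM (m : ℕ) (n : Fin m → ℕ) : Type :=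
  {p : Fin m → ℤ // ∀ i, 0 ≤ p i ∧ p i ≤ (n i : ℤ)}

/-- The ℓ1 metric on the `m`-dimensional grid. -/
def gridMDist {m : ℕ} {n : Fin m → ℕ} (x y : GridM m n) : ℝ :=
  ∑ i, |(x.1 i : ℝ) - (y.1 i : ℝ)|

section PathLength

variable [MetricSpace X]

/-- `l` is an itinerary from `p` to `q`: it starts and ends at the respective positions and
visits every lamp that has to be switched. -/
def IsTour (p q : Lamp X) (l : List X) : Prop :=
  l.head? = some p.2 ∧ l.getLast? = some q.2 ∧ ∀ a ∈ sd p q, a ∈ l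

lemma pathLength_cons_cons (x y : X) (l : List X) :
    pathLength dist (x :: y :: l) = dist x y + pathLength dist (y :: l) := rfl

lemma pathLength_nonneg (l : List X) : 0 ≤ pathLength dist l := by
  induction l with
  | nil => simp [pathLength]
  | cons x l ih =>
    cases l with
    | nil => simp [pathLength]
    | cons y l => rw [pathLength_cons_cons]; positivity

lemma pathLength_cons_le (x y : X) (l : List X) :
    pathLength dist (x :: l) ≤ dist x y + pathLength dist (y :: l) := by
  cases l with
  | nil => simp [pathLength]
  | cons z l =>
    simp only [pathLength_cons_cons]
    linarith [dist_triangle x y z]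

lemma pathLength_le_cons (x : X) (l : List X) :
    pathLength dist l ≤ pathLength dist (x :: l) := by
  cases l with
  | nil => simp [pathLength]
  | cons z l => rw [pathLength_cons_cons]; linarith [dist_nonneg (x := x) (y := z)]

lemma pathLength_cons_le_of_sublist {l₁ l₂ : List X} (h : l₁.Sublist l₂) (a : X) :
    pathLength dist (a :: l₁) ≤ pathLength dist (a :: l₂) := by
  induction h generalizing a with
  | slnil => rfl
  | cons b _ ih =>
    rw [pathLength_cons_cons]
    exact (pathLength_cons_le a b _).trans (by gcongr; exact ih b)
  | cons_cons b _ ih =>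
    rw [pathLength_cons_cons, pathLength_cons_cons]
    gcongr
    exact ih b

lemma pathLength_le_of_sublist {l₁ l₂ : List X} (h : l₁.Sublist l₂) :
    pathLength dist l₁ ≤ pathLength dist l₂ := by
  induction h with
  | slnil => rfl
  | cons b _ ih => exact ih.trans (pathLength_le_cons _ _)
  | cons_cons b h _ => exact pathLength_cons_le_of_sublist h b

lemma pathLength_append (l₁ : List X) (z : X) (l₂ : List X) :
    pathLength dist (l₁ ++ z :: l₂) = pathLength dist (l₁ ++ [z]) + pathLength dist (z :: l₂) := by
  induction l₁ with
  | nil => simp [pathLength]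
  | cons a l ih =>
    cases l with
    | nil => simp [pathLength]
    | cons b l =>
      simp only [List.cons_append, pathLength_cons_cons] at ih ⊢
      rw [ih]; ring

lemma pathLength_reverse (l : List X) : pathLength dist l.reverse = pathLength dist l := by
  induction l with
  | nil => rfl
  | cons a l ih =>
    cases l with
    | nil => rfl
    | cons b l =>
      have h : (a :: b :: l).reverse = l.reverse ++ b :: [a] := by simp
      rw [h, pathLength_append, pathLength_cons_cons a, ← ih]
      simp [pathLength, dist_comm, add_comm]

lemma dist_le_pathLength_cons {x y : X} {l : List X} (hy : (x :: l).getLast? = some y) :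
    dist x y ≤ pathLength dist (x :: l) := by
  induction l generalizing x with
  | nil => simp at hy; simp [hy, pathLength]
  | cons z l ih =>
    rw [pathLength_cons_cons]
    rw [List.getLast?_cons_cons] at hy
    linarith [ih hy, dist_triangle x z y]

lemma dist_add_dist_le_pathLength {x y a : X} {l : List X} (hx : l.head? = some x)
    (hy : l.getLast? = some y) (ha : a ∈ l) : dist x a + dist a y ≤ pathLength dist l := by
  induction l generalizing x with
  | nil => simp at ha
  | cons z l ih =>
    simp only [List.head?_cons, Option.some.injEq] at hx
    subst hx
    rcases List.mem_cons.1 ha with rfl | ha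
    · simpa using dist_le_pathLength_cons hy
    · cases l with
      | nil => simp at ha
      | cons w l =>
        rw [List.getLast?_cons_cons] at hy
        have := ih rfl hy ha
        rw [pathLength_cons_cons]
        linarith [dist_triangle z w a]

/-- A path visiting a `t`-separated set of `n` points has length at least `(n - 1) t`. -/
lemma le_pathLength_of_separated {t : ℝ} (S : Finset X)
    (hS : ∀ a ∈ S, ∀ b ∈ S, a ≠ b → t ≤ dist a b) {l : List X} (hl : ∀ a ∈ S, a ∈ l) :
    ((S.card : ℝ) - 1) * t ≤ pathLength dist l ∨ S = ∅ := by
  have key : ∀ l' : List X, l'.Nodup → (∀ a ∈ l', a ∈ S) →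
      ((l'.length : ℝ) - 1) * t ≤ pathLength dist l' ∨ l' = [] := by
    intro l' hn hm
    induction l' with
    | nil => exact Or.inr rfl
    | cons a l' ih =>
      left
      cases l' with
      | nil => simp [pathLength]
      | cons b l' =>
        rw [pathLength_cons_cons]
        have h1 := (ih (List.nodup_cons.1 hn).2 fun c hc => hm c (List.mem_cons_of_mem _ hc)).resolve_right
          (by simp)
        have h2 : t ≤ dist a b := hS a (hm a (by simp)) b (hm b (by simp)) (by
          rintro rfl; simp at hn)
        simp only [List.length_cons] at h1 ⊢
        push_cast at h1 ⊢
        linarith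
  set l' := (l.filter (· ∈ S)).dedup with hl'
  have hmem : ∀ a, a ∈ l' ↔ a ∈ S := by
    intro a
    simp only [hl', List.mem_dedup, List.mem_filter, decide_eq_true_eq]
    exact ⟨fun h => h.2, fun h => ⟨hl a h, h⟩⟩
  have hnd : l'.Nodup := List.nodup_dedup _
  have hcard : l'.length = S.card := by
    rw [← List.toFinset_card_of_nodup hnd]
    congr 1
    ext a
    simp [hmem]
  have hsub : l'.Sublist l := (List.dedup_sublist _).trans List.filter_sublist
  rcases key l' hnd (fun a ha => (hmem a).1 ha) with h | h
  · left
    rw [← hcard]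
    exact h.trans (pathLength_le_of_sublist hsub)
  · right
    rw [← Finset.card_eq_zero, ← hcard, h]
    rfl

end PathLength

section TSP

lemma sd_comm (p q : Lamp X) : sd p q = sd q p := by
  simp only [sd, Set.union_comm]

lemma sd_subset_union (p q r : Lamp X) : sd p r ⊆ sd p q ∪ sd q r := by
  intro a
  simp only [sd, Set.mem_union, Set.mem_sdiff]
  tauto

lemma sd_finite (p q : Lamp X) : (sd p q).Finite :=
  (p.1.finite_toSet.sdiff).union (q.1.finite_toSet.sdiff)

lemma exists_isTour (p q : Lamp X) : ∃ l, IsTour p q l := by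
  refine ⟨p.2 :: ((sd_finite p q).toFinset.toList ++ [q.2]), rfl, ?_, ?_⟩
  · rw [← List.cons_append, List.getLast?_append]; simp
  · intro a ha
    simp [ha]

lemma rho_nonneg (p q : Lamp X) : 0 ≤ rho p q := by unfold rho; split_ifs <;> norm_num

lemma rho_le_one (p q : Lamp X) : rho p q ≤ 1 := by unfold rho; split_ifs <;> norm_num

lemma rho_triangle (p q r : Lamp X) : rho p r ≤ rho p q + rho q r := by
  by_cases h : p.1 = q.1
  · simp [rho, h]
  · linarith [rho_le_one p r, rho_nonneg q r, show rho p q = 1 from if_neg h]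

lemma le_ediamD {d : Y → Y → ℝ} {A : Set Y} {x y : Y} (hx : x ∈ A) (hy : y ∈ A) :
    ENNReal.ofReal (d x y) ≤ ediamD d A :=
  le_iSup₂_of_le x hx (le_iSup₂_of_le y hy le_rfl)

lemma ediamD_le {d : Y → Y → ℝ} {A : Set Y} {R : ℝ} (h : ∀ x ∈ A, ∀ y ∈ A, d x y ≤ R) :
    ediamD d A ≤ ENNReal.ofReal R :=
  iSup₂_le fun x hx => iSup₂_le fun y hy => ENNReal.ofReal_le_ofReal (h x hx y hy)

variable [MetricSpace X]

lemma TSP_le {p q : Lamp X} {l : List X} (h : IsTour p q l) : TSP dist p q ≤ pathLength dist l :=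
  csInf_le ⟨0, by rintro _ ⟨l, -, -, -, rfl⟩; exact pathLength_nonneg l⟩
    ⟨l, h.1, h.2.1, h.2.2, rfl⟩

lemma le_TSP {p q : Lamp X} {c : ℝ} (h : ∀ l, IsTour p q l → c ≤ pathLength dist l) :
    c ≤ TSP dist p q := by
  obtain ⟨l, hl⟩ := exists_isTour p q
  refine le_csInf ⟨_, l, hl.1, hl.2.1, hl.2.2, rfl⟩ ?_
  rintro _ ⟨l, h1, h2, h3, rfl⟩
  exact h l ⟨h1, h2, h3⟩

lemma exists_isTour_lt {p q : Lamp X} {c : ℝ} (h : TSP dist p q < c) :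
    ∃ l, IsTour p q l ∧ pathLength dist l < c := by
  by_contra! H
  exact absurd h (not_lt.2 (le_TSP H))

lemma TSP_nonneg (p q : Lamp X) : 0 ≤ TSP dist p q := le_TSP fun l _ => pathLength_nonneg l

lemma dist_le_TSP (p q : Lamp X) : dist p.2 q.2 ≤ TSP dist p q := by
  refine le_TSP fun l hl => ?_
  have := dist_add_dist_le_pathLength hl.1 hl.2.1 (List.mem_of_mem_head? (by rw [hl.1]; rfl))
  simpa using this

lemma dist_add_dist_le_TSP {p q : Lamp X} {a : X} (ha : a ∈ sd p q) :
    dist p.2 a + dist a q.2 ≤ TSP dist p q :=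
  le_TSP fun _ hl => dist_add_dist_le_pathLength hl.1 hl.2.1 (hl.2.2 a ha)

lemma TSP_comm_le (p q : Lamp X) : TSP dist p q ≤ TSP dist q p := by
  refine le_TSP fun l hl => ?_
  rw [← pathLength_reverse]
  refine TSP_le ⟨by rw [List.head?_reverse, hl.2.1], by rw [List.getLast?_reverse, hl.1], ?_⟩
  intro a ha
  rw [List.mem_reverse]
  exact hl.2.2 a (sd_comm p q ▸ ha)

lemma TSP_comm (p q : Lamp X) : TSP dist p q = TSP dist q p :=
  (TSP_comm_le p q).antisymm (TSP_comm_le q p)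

lemma TSP_le_add_of_subset {p q r p' r' : Lamp X} (hp : p'.2 = p.2) (hr : r'.2 = r.2)
    (h : sd p' r' ⊆ sd p q ∪ sd q r) : TSP dist p' r' ≤ TSP dist p q + TSP dist q r := by
  have key : ∀ l₁, IsTour p q l₁ → ∀ l₂, IsTour q r l₂ →
      TSP dist p' r' ≤ pathLength dist l₁ + pathLength dist l₂ := by
    intro l₁ h₁ l₂ h₂
    obtain ⟨l₁', rfl⟩ : ∃ l, l₁ = l ++ [q.2] := List.getLast?_eq_some_iff.1 h₁.2.1
    obtain ⟨l₂', rfl⟩ : ∃ l, l₂ = q.2 :: l := List.head?_eq_some_iff.1 h₂.1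
    rw [← pathLength_append]
    refine TSP_le ⟨?_, ?_, ?_⟩
    · have := h₁.1
      rw [hp, ← this]
      cases l₁' <;> simp
    · have := h₂.2.1
      rw [hr, ← this, List.getLast?_append, List.getLast?_cons]
      rfl
    · intro a ha
      rcases h ha with ha | ha
      · have := h₁.2.2 a ha
        simp only [List.mem_append, List.mem_cons, List.not_mem_nil, or_false] at this ⊢
        tauto
      · exact List.mem_append_right _ (h₂.2.2 a ha)
  have h1 : ∀ l₂, IsTour q r l₂ → TSP dist p' r' - pathLength dist l₂ ≤ TSP dist p q :=
    fun l₂ h₂ => le_TSP fun l₁ h₁ => by linarith [key l₁ h₁ l₂ h₂]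
  have h2 : TSP dist p' r' - TSP dist p q ≤ TSP dist q r :=
    le_TSP fun l₂ h₂ => by linarith [h1 l₂ h₂]
  linarith

lemma TSP_triangle (p q r : Lamp X) : TSP dist p r ≤ TSP dist p q + TSP dist q r :=
  TSP_le_add_of_subset rfl rfl (sd_subset_union p q r)

lemma TSP_congr {p q p' q' : Lamp X} (hp : p.2 = p'.2) (hq : q.2 = q'.2)
    (h : sd p q = sd p' q') : TSP dist p q = TSP dist p' q' := by
  simp only [TSP, hp, hq, h]

lemma TSP_self_config (A : Finset X) (x y : X) : TSP dist ((A, x) : Lamp X) (A, y) ≤ dist x y := by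
  have h : IsTour ((A, x) : Lamp X) (A, y) [x, y] := by
    refine ⟨rfl, rfl, ?_⟩
    simp [sd]
  exact (TSP_le h).trans_eq (by simp [pathLength])

lemma TSP_self (p : Lamp X) : TSP dist p p = 0 :=
  le_antisymm (by simpa using TSP_self_config p.1 p.2 p.2) (TSP_nonneg p p)

/-- The lamplighter space as a pseudometric space. -/
abbrev lampPseudoMetric (X : Type*) [MetricSpace X] : PseudoMetricSpace (Lamp X) where
  dist := dLa dist
  dist_self p := by simp [dLa, rho, TSP_self]
  dist_comm p q := by simp only [dLa, rho, TSP_comm p q, eq_comm]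
  dist_triangle p q r := by
    simp only [dLa]
    linarith [TSP_triangle p q r, rho_triangle p q r]

lemma TSP_le_dLa (p q : Lamp X) : TSP dist p q ≤ dLa dist p q := by
  simp only [dLa]; linarith [rho_nonneg p q]

lemma dLa_le_TSP_add_one (p q : Lamp X) : dLa dist p q ≤ TSP dist p q + 1 := by
  simp only [dLa]; linarith [rho_le_one p q]

lemma dLa_nonneg (p q : Lamp X) : 0 ≤ dLa dist p q :=
  (TSP_nonneg p q).trans (TSP_le_dLa p q)

lemma one_le_dLa (hsep : ∀ x y : X, x ≠ y → 1 ≤ dist x y) {p q : Lamp X} (h : p ≠ q) :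
    1 ≤ dLa dist p q := by
  by_cases h1 : p.1 = q.1
  · have h2 : p.2 ≠ q.2 := fun h2 => h (Prod.ext h1 h2)
    exact (hsep _ _ h2).trans ((dist_le_TSP p q).trans (TSP_le_dLa p q))
  · have : rho p q = 1 := if_neg h1
    simp only [dLa]
    linarith [TSP_nonneg p q]

lemma TSCP_nonneg (p q : Lamp X) : 0 ≤ TSCP dist p q := ENNReal.toReal_nonneg

lemma TSCP_le {p q : Lamp X} {R : ℝ} (hR : 0 ≤ R)
    (h : ∀ a ∈ ({p.2, q.2} : Set X) ∪ sd p q, ∀ b ∈ ({p.2, q.2} : Set X) ∪ sd p q, dist a b ≤ R) :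
    TSCP dist p q ≤ R :=
  ENNReal.toReal_le_of_le_ofReal hR (ediamD_le h)

lemma dist_le_TSCP {p q : Lamp X} {a b : X} (ha : a ∈ ({p.2, q.2} : Set X) ∪ sd p q)
    (hb : b ∈ ({p.2, q.2} : Set X) ∪ sd p q) : dist a b ≤ TSCP dist p q := by
  have hfin : (({p.2, q.2} : Set X) ∪ sd p q).Finite := (Set.toFinite _).union (sd_finite p q)
  have hlt : ediamD dist (({p.2, q.2} : Set X) ∪ sd p q) < ⊤ := by
    refine lt_of_le_of_lt (ediamD_le (R := Metric.diam (({p.2, q.2} : Set X) ∪ sd p q)) ?_)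
      ENNReal.ofReal_lt_top
    intro x hx y hy
    exact Metric.dist_le_diam_of_mem hfin.isBounded hx hy
  exact (ENNReal.ofReal_le_iff_le_toReal hlt.ne).1 (le_ediamD ha hb)

end TSP

section RTree

lemma isPreconnected_preimage_of_injOn {T : Type*} [TopologicalSpace T] [T2Space T] {γ : ℝ → T}
    (hc : ContinuousOn γ (Icc 0 1)) (hi : InjOn γ (Icc 0 1)) {S : Set T} (hS : IsPreconnected S)
    (hsub : S ⊆ γ '' Icc 0 1) : IsPreconnected (Icc 0 1 ∩ γ ⁻¹' S) := by
  set e : Icc (0 : ℝ) 1 → T := (Icc (0 : ℝ) 1).domRestrict γ with he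
  have hec : Continuous e := continuousOn_iff_continuous_domRestrict.1 hc
  have hei : Function.Injective e := injOn_iff_injective.1 hi
  have hemb := (hec.isClosedEmbedding hei).isInducing
  have himg : e '' (e ⁻¹' S) = S := by
    rw [Set.image_preimage_eq_iff]
    rwa [he, Set.range_domRestrict]
  have h1 : IsPreconnected (e ⁻¹' S) := by
    rw [← hemb.isPreconnected_image, himg]
    exact hS
  have h2 := h1.image _ continuous_subtype_val.continuousOn
  convert h2 using 1
  ext x
  simp [he, and_comm]

/-- A metric space in which any two points are joined by a geodesic, every point of which is
contained in every path joining the two points, is an `ℝ`-tree. -/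
lemma isRTree_of_geodesic {T : Type*} [MetricSpace T]
    (hG : ∀ x y : T, ∃ γ : ℝ → T, γ 0 = x ∧ γ (dist x y) = y ∧
      ∀ s ∈ Icc (0 : ℝ) (dist x y), ∀ t ∈ Icc (0 : ℝ) (dist x y), dist (γ s) (γ t) = |s - t|)
    (hP : ∀ γ : ℝ → T, ContinuousOn γ (Icc 0 1) → ∀ p : T,
      dist (γ 0) p + dist p (γ 1) = dist (γ 0) (γ 1) → p ∈ γ '' Icc 0 1) : IsRTree T := by
  intro x y hxy
  obtain ⟨g, g0, g1, hg⟩ := hG x y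
  set L := dist x y with hL
  have hLpos : 0 < L := dist_pos.2 hxy
  have hgc : ContinuousOn g (Icc 0 L) := by
    have : LipschitzOnWith 1 g (Icc 0 L) := LipschitzOnWith.of_dist_le_mul fun s hs t ht => by
      rw [hg s hs t ht, Real.dist_eq]; simp
    exact this.continuousOn
  have hseg : ∀ A, IsArc x y A → A = g '' Icc 0 L := by
    rintro A ⟨γ, hc, hi, h0, h1, rfl⟩
    have hsub : g '' Icc 0 L ⊆ γ '' Icc 0 1 := by
      rintro _ ⟨s, hs, rfl⟩
      apply hP γ hc
      rw [h0, h1, ← hL]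
      have e1 := hg 0 ⟨le_rfl, hLpos.le⟩ s hs
      have e2 := hg s hs L ⟨hLpos.le, le_rfl⟩
      rw [g0] at e1
      rw [g1] at e2
      rw [e1, e2, abs_of_nonpos (by linarith [hs.1]), abs_of_nonpos (by linarith [hs.2])]
      ring
    refine Subset.antisymm ?_ hsub
    have hpre := isPreconnected_preimage_of_injOn hc hi (isPreconnected_Icc.image g hgc) hsub
    have hord := hpre.ordConnected
    have m0 : (0 : ℝ) ∈ Icc (0 : ℝ) 1 ∩ γ ⁻¹' (g '' Icc 0 L) :=
      ⟨by simp, 0, ⟨le_rfl, hLpos.le⟩, by rw [g0, h0]⟩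
    have m1 : (1 : ℝ) ∈ Icc (0 : ℝ) 1 ∩ γ ⁻¹' (g '' Icc 0 L) :=
      ⟨by simp, L, ⟨hLpos.le, le_rfl⟩, by rw [g1, h1]⟩
    rintro _ ⟨t, ht, rfl⟩
    exact (hord.out m0 m1 ht).2
  have hgeo : IsGeodesicSeg x y (g '' Icc 0 L) := ⟨g, g0, g1, hg, rfl⟩
  refine ⟨⟨g '' Icc 0 L, fun t => g (L * t), ?_, ?_, ?_, ?_, ?_⟩, ?_, ?_⟩
  · refine hgc.comp (by fun_prop) fun t ht => ⟨?_, ?_⟩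
    · exact mul_nonneg hLpos.le ht.1
    · nlinarith [ht.2]
  · intro s hs t ht hst
    have h := hg (L * s) ⟨mul_nonneg hLpos.le hs.1, by nlinarith [hs.2]⟩ (L * t)
      ⟨mul_nonneg hLpos.le ht.1, by nlinarith [ht.2]⟩
    simp only at hst
    rw [hst, dist_self, ← mul_sub] at h
    have := abs_eq_zero.1 h.symm
    rcases mul_eq_zero.1 this with h | h <;> linarith
  · simpa using g0
  · simpa using g1
  · have : (fun t => g (L * t)) = g ∘ (fun t => L * t) := rfl
    rw [this, Set.image_comp, Set.image_mul_left_Icc hLpos.le (by norm_num)]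
    simp
  · intro A A' hA hA'
    rw [hseg A hA, hseg A' hA']
  · intro A hA
    rw [hseg A hA]
    exact hgeo

end RTree

section StarTree

/-- The star with one ray for each element of `ι`: its points are given by a label and a
distance to the centre, where the centre is labelled by `i₀`. -/
@[ext] structure StarTree {ι : Type*} (i₀ : ι) where
  /-- The ray containing the point. -/
  label : ι
  /-- The distance to the centre. -/
  height : ℝ
  height_nonneg : 0 ≤ height
  label_eq_of_height_eq_zero : height = 0 → label = i₀

namespace StarTree

variable {ι : Type*} {i₀ : ι}

lemma eq_of_height_eq_zero {p q : StarTree i₀} (h1 : p.height = 0) (h2 : q.height = 0) : p = q :=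
  StarTree.ext (by rw [p.label_eq_of_height_eq_zero h1, q.label_eq_of_height_eq_zero h2]) (by rw [h1, h2])

/-- The coordinate that is the distance to the centre on the ray `k` and its negative on all
other rays. -/
def signedHeight (k : ι) (p : StarTree i₀) : ℝ := if p.label = k then p.height else -p.height

instance : MetricSpace (StarTree i₀) where
  dist p q := if p.label = q.label then |p.height - q.height| else p.height + q.height
  dist_self p := by simp
  dist_comm p q := by
    simp only [eq_comm (a := p.label), abs_sub_comm p.height, add_comm p.height]
  dist_triangle p q r := by
    have hp := p.height_nonneg
    have hq := q.height_nonneg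
    have hr := r.height_nonneg
    by_cases h1 : p.label = q.label
    · by_cases h2 : q.label = r.label
      · simp only [h1, h2, if_true]
        exact abs_sub_le _ _ _
      · simp only [h1, h2, if_true, if_false]
        linarith [le_abs_self (p.height - q.height)]
    · by_cases h2 : q.label = r.label
      · rw [h2] at h1
        simp only [h1, h2, if_true, if_false]
        linarith [neg_abs_le (q.height - r.height)]
      · by_cases h3 : p.label = r.label
        · simp only [h2, h3, if_true, if_false]
          split_ifs
          · exact absurd ‹_› (by rw [← h3]; exact h1)
          · exact abs_le.2 ⟨by linarith, by linarith⟩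
        · simp only [h1, h2, h3, if_false]
          linarith
  eq_of_dist_eq_zero {p q} h := by
    have hp := p.height_nonneg
    have hq := q.height_nonneg
    by_cases h1 : p.label = q.label
    · simp only [h1, if_true] at h
      exact StarTree.ext h1 (by linarith [abs_eq_zero.1 h])
    · simp only [h1, if_false] at h
      exact eq_of_height_eq_zero (by linarith) (by linarith)

lemma dist_def (p q : StarTree i₀) :
    dist p q = if p.label = q.label then |p.height - q.height| else p.height + q.height := rfl

lemma abs_signedHeight_sub_le (k : ι) (p q : StarTree i₀) :
    |signedHeight k p - signedHeight k q| ≤ dist p q := by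
  have hp := p.height_nonneg
  have hq := q.height_nonneg
  rw [dist_def, signedHeight, signedHeight]
  split_ifs with h1 h2 h3 h3 h4 h4
  · exact le_rfl
  · exact absurd (h1.trans h2.symm) h3
  · exact absurd (h3.symm.trans h1) h2
  · exact abs_le.2 ⟨by linarith, by linarith⟩
  · exact absurd (h4.trans ‹_›) h1
  · exact abs_le.2 ⟨by linarith, by linarith⟩
  · rw [neg_sub_neg, abs_sub_comm]
  · exact abs_le.2 ⟨by linarith, by linarith⟩

lemma continuous_signedHeight (k : ι) : Continuous (signedHeight (i₀ := i₀) k) := by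
  refine (LipschitzWith.of_dist_le_mul (K := 1) fun p q => ?_).continuous
  simpa [Real.dist_eq] using abs_signedHeight_sub_le k p q

lemma eq_of_signedHeight_eq {k : ι} {p q : StarTree i₀}
    (h : signedHeight k q = p.height) (hk : p.height = 0 ∨ p.label = k) : q = p := by
  have hp := p.height_nonneg
  have hq := q.height_nonneg
  unfold signedHeight at h
  split_ifs at h with h1
  · rcases hk with hk | hk
    · exact eq_of_height_eq_zero (by linarith) hk
    · exact StarTree.ext (h1.trans hk.symm) h
  · exact eq_of_height_eq_zero (by linarith) (by linarith)

/-- The point on the ray `i` at distance `r` from the centre (the centre itself if `r ≤ 0`). -/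
def point (i₀ i : ι) (r : ℝ) : StarTree i₀ :=
  if h : 0 < r then ⟨i, r, h.le, fun h' => absurd h' h.ne'⟩ else ⟨i₀, 0, le_rfl, fun _ => rfl⟩

lemma height_point (i : ι) (r : ℝ) : (point i₀ i r).height = max r 0 := by
  unfold point
  split_ifs with h
  · exact (max_eq_left h.le).symm
  · exact (max_eq_right (not_lt.1 h)).symm

lemma label_point {i : ι} {r : ℝ} (h : 0 < r) : (point i₀ i r).label = i := by
  unfold point
  rw [dif_pos h]

lemma point_label_height (p : StarTree i₀) : point i₀ p.label p.height = p := by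
  rcases p.height_nonneg.lt_or_eq with h | h
  · exact StarTree.ext (label_point h) (by rw [height_point, max_eq_left h.le])
  · exact eq_of_height_eq_zero (by rw [height_point, ← h]; simp) h.symm

lemma dist_point {i j : ι} {r s : ℝ} (hr : 0 ≤ r) (hs : 0 ≤ s) :
    dist (point i₀ i r) (point i₀ j s) = if i = j then |r - s| else r + s := by
  rw [dist_def, height_point, height_point, max_eq_left hr, max_eq_left hs]
  rcases hr.lt_or_eq with hr | rfl
  · rcases hs.lt_or_eq with hs | rfl
    · rw [label_point hr, label_point hs]
    · simp [abs_of_pos hr]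
  · simp [abs_of_nonneg hs]

lemma exists_geodesic (x y : StarTree i₀) : ∃ γ : ℝ → StarTree i₀, γ 0 = x ∧ γ (dist x y) = y ∧
    ∀ s ∈ Icc (0 : ℝ) (dist x y), ∀ t ∈ Icc (0 : ℝ) (dist x y), dist (γ s) (γ t) = |s - t| := by
  have hx := x.height_nonneg
  have hy := y.height_nonneg
  by_cases h : x.label = y.label
  · rcases le_total x.height y.height with hle | hle
    · have hd : dist x y = y.height - x.height := by
        rw [dist_def, if_pos h, abs_of_nonpos (by linarith)]; ring
      refine ⟨fun t => point i₀ x.label (x.height + t), ?_, ?_, ?_⟩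
      · simp [point_label_height]
      · simp only [hd, h, add_sub_cancel, point_label_height]
      · intro s hs t ht
        rw [dist_point (by linarith [hs.1]) (by linarith [ht.1]), if_pos rfl]
        congr 1; ring
    · have hd : dist x y = x.height - y.height := by
        rw [dist_def, if_pos h, abs_of_nonneg (by linarith)]
      refine ⟨fun t => point i₀ x.label (x.height - t), ?_, ?_, ?_⟩
      · simp [point_label_height]
      · simp only [hd, h, sub_sub_cancel, point_label_height]
      · intro s hs t ht
        rw [hd] at hs ht
        rw [dist_point (by linarith [hs.2]) (by linarith [ht.2]), if_pos rfl, abs_sub_comm]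
        congr 1; ring
  · have hd : dist x y = x.height + y.height := by rw [dist_def, if_neg h]
    have hpoint : ∀ s t : ℝ, 0 ≤ s → s ≤ x.height → x.height < t →
        dist (point i₀ x.label (x.height - s)) (point i₀ y.label (t - x.height)) = |s - t| := by
      intro s t hs hs' ht
      rw [dist_point (by linarith) (by linarith), if_neg h, abs_of_nonpos (by linarith)]
      ring
    refine ⟨fun t => if t ≤ x.height then point i₀ x.label (x.height - t)
      else point i₀ y.label (t - x.height), ?_, ?_, ?_⟩
    · simp [hx, point_label_height]
    · simp only [hd]
      split_ifs with h'
      · have h0 : y.height = 0 := by linarith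
        exact eq_of_height_eq_zero (by rw [height_point, h0]; simp) h0
      · rw [add_sub_cancel_left, point_label_height]
    · intro s hs t ht
      simp only
      split_ifs with h1 h2 h2
      · rw [dist_point (by linarith) (by linarith), if_pos rfl, abs_sub_comm]
        congr 1; ring
      · exact hpoint s t hs.1 h1 (not_le.1 h2)
      · rw [dist_comm, abs_sub_comm]
        exact hpoint t s ht.1 h2 (not_le.1 h1)
      · rw [dist_point (by linarith) (by linarith), if_pos rfl]
        congr 1; ring

lemma mem_image_of_dist_add_dist {γ : ℝ → StarTree i₀} (hc : ContinuousOn γ (Icc 0 1))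
    {p : StarTree i₀} (hp : dist (γ 0) p + dist p (γ 1) = dist (γ 0) (γ 1)) :
    p ∈ γ '' Icc 0 1 := by
  have key : ∀ k : ι, (p.height = 0 ∨ p.label = k) →
      p.height ∈ uIcc (signedHeight k (γ 0)) (signedHeight k (γ 1)) → p ∈ γ '' Icc 0 1 := by
    intro k hk hmem
    have hcont : ContinuousOn (fun t => signedHeight k (γ t)) (uIcc 0 1) := by
      rw [uIcc_of_le zero_le_one]
      exact (continuous_signedHeight k).comp_continuousOn hc
    obtain ⟨t, ht, hval⟩ := intermediate_value_uIcc hcont hmem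
    rw [uIcc_of_le zero_le_one] at ht
    exact ⟨t, ht, eq_of_signedHeight_eq hval hk⟩
  generalize hx : γ 0 = x at *
  generalize hy : γ 1 = y at *
  have hx0 := x.height_nonneg
  have hy0 := y.height_nonneg
  have hp0 := p.height_nonneg
  have hpx : p = x → p ∈ γ '' Icc 0 1 := fun h => ⟨0, by simp, by rw [hx, h]⟩
  have hpy : p = y → p ∈ γ '' Icc 0 1 := fun h => ⟨1, by simp, by rw [hy, h]⟩
  simp only [dist_def] at hp
  have k1 := key x.label
  have k2 := key y.label
  simp only [signedHeight, if_true] at k1 k2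
  by_cases h1 : x.label = p.label
  · by_cases h2 : p.label = y.label
    · simp only [h1, h2, if_true] at hp k1
      apply k1 (Or.inr trivial)
      rw [mem_uIcc]
      rcases le_total x.height p.height with a | a <;> rcases le_total p.height y.height with b | b
      · exact Or.inl ⟨a, b⟩
      · rw [abs_of_nonpos (by linarith), abs_of_nonneg (by linarith)] at hp
        rcases le_total x.height y.height with c | c
        · rw [abs_of_nonpos (by linarith)] at hp; left; constructor <;> linarith
        · rw [abs_of_nonneg (by linarith)] at hp; right; constructor <;> linarith
      · rw [abs_of_nonneg (by linarith), abs_of_nonpos (by linarith)] at hp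
        rcases le_total x.height y.height with c | c
        · rw [abs_of_nonpos (by linarith)] at hp; left; constructor <;> linarith
        · rw [abs_of_nonneg (by linarith)] at hp; right; constructor <;> linarith
      · exact Or.inr ⟨b, a⟩
    · have h2' : ¬ y.label = p.label := fun h => h2 h.symm
      simp only [h1, h2, h2', if_true, if_false] at hp k1
      apply k1 (Or.inr trivial)
      rw [mem_uIcc]
      right
      constructor
      · linarith
      · linarith [neg_abs_le (x.height - p.height)]
  · by_cases h2 : p.label = y.label
    · have h1' : ¬ x.label = y.label := fun h => h1 (h.trans h2.symm)
      simp only [h1', h2, if_true, if_false] at hp k2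
      apply k2 (Or.inr trivial)
      rw [mem_uIcc]
      left
      constructor
      · linarith
      · linarith [neg_abs_le (p.height - y.height), le_abs_self (p.height - y.height)]
    · by_cases h3 : x.label = y.label
      · simp only [h2, h3, if_true, if_false] at hp
        have h4 : ¬ y.label = p.label := fun h => h2 h.symm
        simp only [h4, if_false] at hp
        rcases le_total x.height y.height with c | c
        · rw [abs_of_nonpos (by linarith)] at hp
          exact hpx (eq_of_height_eq_zero (by linarith) (by linarith))
        · rw [abs_of_nonneg (by linarith)] at hp
          exact hpy (eq_of_height_eq_zero (by linarith) (by linarith))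
      · have h3' : ¬ y.label = x.label := fun h => h3 h.symm
        simp only [h1, h2, h3, h3', if_false] at hp k1
        have hz : p.height = 0 := by linarith
        apply k1 (Or.inl hz)
        rw [mem_uIcc]
        right
        constructor <;> linarith

variable (i₀) in
lemma isRTree : IsRTree (StarTree i₀) :=
  isRTree_of_geodesic exists_geodesic fun _ hc _ hp => mem_image_of_dist_add_dist hc hp

end StarTree

end StarTree

section Nets

variable [MetricSpace X]

lemma exists_maximal_separated {t : ℝ} (ht : 0 < t) (U : Set X) : ∃ N ⊆ U,
    (∀ a ∈ N, ∀ b ∈ N, a ≠ b → t ≤ dist a b) ∧ ∀ x ∈ U, ∃ c ∈ N, dist x c < t := by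
  obtain ⟨N, hN⟩ := zorn_subset {N : Set X | N ⊆ U ∧ ∀ a ∈ N, ∀ b ∈ N, a ≠ b → t ≤ dist a b} (by
    intro c hc hch
    refine ⟨⋃₀ c, ⟨Set.sUnion_subset fun s hs => (hc hs).1, ?_⟩, fun s hs => Set.subset_sUnion_of_mem hs⟩
    rintro a ⟨s, hs, has⟩ b ⟨s', hs', hbs⟩ hab
    rcases hch.total hs hs' with h | h
    · exact (hc hs').2 a (h has) b hbs hab
    · exact (hc hs).2 a has b (h hbs) hab)
  refine ⟨N, hN.prop.1, hN.prop.2, fun x hx => ?_⟩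
  by_contra! hcon
  have hmem : insert x N ∈ {N : Set X | N ⊆ U ∧ ∀ a ∈ N, ∀ b ∈ N, a ≠ b → t ≤ dist a b} := by
    refine ⟨Set.insert_subset hx hN.prop.1, ?_⟩
    rintro a (rfl | ha) b (rfl | hb) hab
    · exact absurd rfl hab
    · exact hcon b hb
    · rw [dist_comm]; exact hcon a ha
    · exact hN.prop.2 a ha b hb hab
  have := hcon x (hN.le_of_ge hmem (Set.subset_insert x N) (Set.mem_insert x N))
  rw [dist_self] at this
  linarith

lemma exists_nets {K : ℝ} (hK : 0 ≤ K) (hE : TSPEfficient (dist : X → X → ℝ) K) :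
    ∃ m : ℕ, 0 < m ∧ ∀ t : ℝ, 0 < t → ∃ N : Fin m → Set X,
      (∀ i, ∀ a ∈ N i, ∀ b ∈ N i, a ≠ b → 4 * t ≤ dist a b) ∧
      ∀ x, ∃ i, ∃ c ∈ N i, dist x c < t := by
  refine ⟨⌈8 * K⌉₊ + 2, by omega, fun t ht => ?_⟩
  choose mx hmxU hmxs hmxc using exists_maximal_separated (X := X) (t := 4 * t) (by linarith)
  let F : Set X → Set X := fun A => {x | ∀ c ∈ A, t ≤ dist x c}
  let A : ℕ → Set X := fun n => Nat.rec ∅ (fun _ A => A ∪ mx (F A)) n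
  have hA : ∀ n, A (n + 1) = A n ∪ mx (F (A n)) := fun n => rfl
  have hmono : Monotone A := monotone_nat_of_le_succ fun n => by
    rw [hA]; exact Set.subset_union_left
  have hmemA : ∀ n, ∀ c ∈ A n, ∃ j < n, c ∈ mx (F (A j)) := by
    intro n
    induction n with
    | zero => exact fun c hc => absurd hc (Set.notMem_empty c)
    | succ n ih =>
      rintro c (hc | hc)
      · obtain ⟨j, hj, h⟩ := ih c hc
        exact ⟨j, by omega, h⟩
      · exact ⟨n, by omega, hc⟩
  refine ⟨fun i => mx (F (A i)), fun i => hmxs _, fun x => ?_⟩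
  by_contra! hcon
  set m := ⌈8 * K⌉₊ + 2 with hm
  have hxF : ∀ i : Fin m, x ∈ F (A i) := fun i c hc => by
    obtain ⟨j, hj, h⟩ := hmemA i c hc
    exact hcon ⟨j, by omega⟩ c h
  choose c hcN hcx using fun i : Fin m => hmxc (F (A i)) x (hxF i)
  have hlt : ∀ i j : Fin m, j < i → t ≤ dist (c i) (c j) := fun i j hij => by
    refine hmxU _ (hcN i) (c j) (hmono (show (j : ℕ) + 1 ≤ i from hij) ?_)
    rw [hA]
    exact Or.inr (hcN j)
  have hne : ∀ i j : Fin m, i ≠ j → t ≤ dist (c i) (c j) := fun i j hij => by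
    rcases lt_or_gt_of_ne hij with h | h
    · rw [dist_comm]; exact hlt j i h
    · exact hlt i j h
  have hinj : Function.Injective c := fun i j hij => by
    by_contra h
    have := hne i j h
    rw [hij, dist_self] at this
    linarith
  let S : Finset X := Finset.univ.image c
  have hS : S.card = m := by
    rw [Finset.card_image_of_injective _ hinj, Finset.card_univ, Fintype.card_fin]
  have hsd : sd ((∅, x) : Lamp X) (S, x) = (S : Set X) := by simp [sd]
  have h1 : ((m : ℝ) - 1) * t ≤ TSP dist ((∅, x) : Lamp X) (S, x) := by
    refine le_TSP fun l hl => ?_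
    have hsepS : ∀ a ∈ S, ∀ b ∈ S, a ≠ b → t ≤ dist a b := fun a ha b hb hab => by
      obtain ⟨i, -, rfl⟩ := Finset.mem_image.1 ha
      obtain ⟨j, -, rfl⟩ := Finset.mem_image.1 hb
      exact hne i j fun h => hab (by rw [h])
    rcases le_pathLength_of_separated S hsepS fun a ha => hl.2.2 a (by rw [hsd]; exact ha) with h | h
    · rwa [hS] at h
    · rw [h, Finset.card_empty] at hS
      exact absurd hS (by omega)
  have h2 : TSCP dist ((∅, x) : Lamp X) (S, x) ≤ 8 * t := by
    have hx : ∀ a ∈ ({x, x} : Set X) ∪ sd ((∅, x) : Lamp X) (S, x), dist x a ≤ 4 * t := by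
      rintro a ((rfl | rfl) | ha)
      · rw [dist_self]; linarith
      · rw [dist_self]; linarith
      · rw [hsd] at ha
        obtain ⟨i, -, rfl⟩ := Finset.mem_image.1 ha
        exact (hcx i).le
    refine TSCP_le (by linarith) fun a ha b hb => ?_
    linarith [dist_triangle_left a b x, hx a ha, hx b hb]
  have h3 := hE ((∅, x) : Lamp X) (S, x)
  have h4 : K * TSCP dist ((∅, x) : Lamp X) (S, x) ≤ K * (8 * t) :=
    mul_le_mul_of_nonneg_left h2 hK
  have h5 : 8 * K ≤ ⌈8 * K⌉₊ := Nat.le_ceil _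
  have h6 : (m : ℝ) = ⌈8 * K⌉₊ + 2 := by rw [hm]; push_cast; ring
  nlinarith

/-- The lit lamps of `A` at distance at least `2t` from `c`. -/
def outer (t : ℝ) (c : X) (A : Finset X) : Finset X := A.filter fun a => 2 * t ≤ dist a c

lemma exists_mem_sd_of_outer_ne {t : ℝ} {c : X} {p q : Lamp X} (h : outer t c p.1 ≠ outer t c q.1) :
    ∃ a ∈ sd p q, 2 * t ≤ dist a c := by
  by_contra! hcon
  refine h (Finset.ext fun a => ?_)
  simp only [outer, Finset.mem_filter, and_congr_left_iff]
  intro ha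
  by_contra hne
  have : a ∈ sd p q := by
    simp only [sd, Set.mem_union, Set.mem_sdiff, Finset.mem_coe]
    tauto
  linarith [hcon a this]

/-- The map from the lamplighter space to a star whose rays are indexed by the centres `c` of a
`4t`-separated set together with the configurations of the lamps at distance at least `2t`
from `c`. -/
def starMap (i₀ : Lamp X) (t : ℝ) (N : Set X) (p : Lamp X) : StarTree i₀ :=
  if h : ∃ c ∈ N, dist p.2 c < 2 * t then
    StarTree.point i₀ (outer t h.choose p.1, h.choose) (2 * t - dist p.2 h.choose)
  else StarTree.point i₀ i₀ 0

variable {i₀ : Lamp X} {t : ℝ} {N : Set X}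

lemma starMap_of_mem (hN : ∀ a ∈ N, ∀ b ∈ N, a ≠ b → 4 * t ≤ dist a b) {p : Lamp X} {c : X}
    (hc : c ∈ N) (hp : dist p.2 c < 2 * t) :
    starMap i₀ t N p = StarTree.point i₀ (outer t c p.1, c) (2 * t - dist p.2 c) := by
  have h : ∃ c ∈ N, dist p.2 c < 2 * t := ⟨c, hc, hp⟩
  have : h.choose = c := by
    by_contra hne
    linarith [hN _ h.choose_spec.1 c hc hne, dist_triangle_left h.choose c p.2, h.choose_spec.2]
  unfold starMap
  rw [dif_pos h, this]

lemma dist_starMap_le (hN : ∀ a ∈ N, ∀ b ∈ N, a ≠ b → 4 * t ≤ dist a b) (p q : Lamp X) :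
    dist (starMap i₀ t N p) (starMap i₀ t N q) ≤ TSP dist p q := by
  have hpq := dist_le_TSP p q
  have one_sided : ∀ p q : Lamp X, (∃ c ∈ N, dist p.2 c < 2 * t) → (¬ ∃ c ∈ N, dist q.2 c < 2 * t) →
      dist (starMap i₀ t N p) (starMap i₀ t N q) ≤ dist p.2 q.2 := by
    rintro p q ⟨c, hc, hp⟩ hq
    have hqc : 2 * t ≤ dist q.2 c := not_lt.1 fun h => hq ⟨c, hc, h⟩
    rw [starMap_of_mem hN hc hp, starMap, dif_neg hq, StarTree.dist_point (by linarith) le_rfl]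
    have := dist_triangle_left q.2 c p.2
    split_ifs
    · rw [sub_zero, abs_of_nonneg (by linarith)]
      linarith
    · linarith
  by_cases hp : ∃ c ∈ N, dist p.2 c < 2 * t <;> by_cases hq : ∃ c ∈ N, dist q.2 c < 2 * t
  · obtain ⟨c, hc, hp⟩ := hp
    obtain ⟨c', hc', hq⟩ := hq
    rw [starMap_of_mem hN hc hp, starMap_of_mem hN hc' hq,
      StarTree.dist_point (by linarith) (by linarith)]
    by_cases hcc : c = c'
    · subst hcc
      split_ifs with h
      · rw [show 2 * t - dist p.2 c - (2 * t - dist q.2 c) = dist q.2 c - dist p.2 c by ring, abs_le]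
        constructor <;> linarith [dist_triangle_left q.2 c p.2, dist_triangle p.2 q.2 c]
      · obtain ⟨a, ha, hac⟩ := exists_mem_sd_of_outer_ne (t := t) (c := c) (p := p) (q := q)
          fun h' => h (by rw [h'])
        linarith [dist_add_dist_le_TSP ha, dist_triangle_left a c p.2, dist_triangle a q.2 c]
    · rw [if_neg fun h => hcc (congrArg Prod.snd h)]
      linarith [hN c hc c' hc' hcc, dist_triangle_left c c' p.2, dist_triangle p.2 q.2 c']
  · exact (one_sided p q hp hq).trans hpq
  · rw [dist_comm]
    exact (one_sided q p hq hp).trans (by rwa [dist_comm])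
  · unfold starMap
    rw [dif_neg hp, dif_neg hq, dist_self]
    exact TSP_nonneg p q

lemma le_dist_starMap (hN : ∀ a ∈ N, ∀ b ∈ N, a ≠ b → 4 * t ≤ dist a b) {p q : Lamp X} {c : X}
    (hc : c ∈ N) (hp : dist p.2 c < 2 * t)
    (h : dist q.2 c < 2 * t → outer t c p.1 ≠ outer t c q.1) :
    2 * t - dist p.2 c ≤ dist (starMap i₀ t N p) (starMap i₀ t N q) := by
  rw [starMap_of_mem hN hc hp]
  by_cases hq : ∃ c ∈ N, dist q.2 c < 2 * t
  · obtain ⟨c', hc', hq⟩ := hq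
    rw [starMap_of_mem hN hc' hq, StarTree.dist_point (by linarith) (by linarith), if_neg]
    · linarith
    · intro h'
      rw [Prod.mk.injEq] at h'
      obtain ⟨h1, rfl⟩ := h'
      exact h hq h1
  · rw [starMap, dif_neg hq, StarTree.dist_point (by linarith) le_rfl]
    split_ifs
    · rw [sub_zero]
      exact le_abs_self _
    · linarith

lemma exists_far_of_lt_TSCP {p q : Lamp X} {R : ℝ} (hR : 0 ≤ R) (h : 2 * R < TSCP dist p q) :
    R < dist p.2 q.2 ∨ ∃ a ∈ sd p q, R < dist p.2 a := by
  by_contra! hcon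
  have hx : ∀ a ∈ ({p.2, q.2} : Set X) ∪ sd p q, dist p.2 a ≤ R := by
    rintro a ((rfl | rfl) | ha)
    · rwa [dist_self]
    · exact hcon.1
    · exact hcon.2 a ha
  refine absurd h (not_lt.2 (TSCP_le (by linarith) fun a ha b hb => ?_))
  linarith [dist_triangle_left a b p.2, hx a ha, hx b hb]

theorem weakBiLip_of_TSPEfficient {X : Type u} [MetricSpace X]
    (hsep : ∀ x y : X, x ≠ y → 1 ≤ dist x y) {K : ℝ} (hE : TSPEfficient (dist : X → X → ℝ) K) :
    ∃ (n : ℕ) (T : Fin n → Type u) (I : ∀ i, MetricSpace (T i)),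
      (∀ i, @IsRTree (T i) (I i)) ∧
      ∃ C : ℝ, WeakBiLip (dLa (dist : X → X → ℝ)) (piSupDist I) C := by
  rcases isEmpty_or_nonempty (Lamp X) with hemp | ⟨⟨i₀⟩⟩
  · exact ⟨0, fun i => PUnit, fun i => inferInstance, fun i => i.elim0, 0, fun _ p => hemp.elim p,
      fun t ht => ⟨1, one_pos, fun p => hemp.elim p, fun p => hemp.elim p⟩⟩
  have hE' : TSPEfficient (dist : X → X → ℝ) (max K 0) := fun p q =>
    (hE p q).trans (mul_le_mul_of_nonneg_right (le_max_left _ _) (TSCP_nonneg p q))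
  obtain ⟨m, hm, hnet⟩ := exists_nets (le_max_right K 0) hE'
  refine ⟨m, fun _ => StarTree i₀, fun _ => inferInstance, fun _ => StarTree.isRTree i₀,
    8 * max K 0 + 3, ?_⟩
  have hK : 0 ≤ max K 0 := le_max_right _ _
  have key : ∀ t : ℝ, 0 < t → ∃ φ : Lamp X → Fin m → StarTree i₀,
      (∀ p q, dist (φ p) (φ q) ≤ dLa dist p q) ∧
      ∀ p q, (8 * max K 0 + 3) * t ≤ dLa dist p q → t ≤ dist (φ p) (φ q) := by
    intro t ht
    by_cases ht2 : t ≤ 1 / 2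
    · refine ⟨fun p _ => StarTree.point i₀ p t, fun p q => ?_, fun p q hpq => ?_⟩
      · refine (dist_pi_le_iff (dLa_nonneg p q)).2 fun i => ?_
        rw [StarTree.dist_point ht.le ht.le]
        split_ifs with h
        · simpa using dLa_nonneg p q
        · linarith [one_le_dLa hsep h]
      · have hne : p ≠ q := by
          rintro rfl
          have h0 : dLa dist p p = 0 := by simp [dLa, rho, TSP_self]
          nlinarith
        refine le_trans ?_ (dist_le_pi_dist _ _ (⟨0, hm⟩ : Fin m))
        rw [StarTree.dist_point ht.le ht.le, if_neg hne]
        linarith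
    · obtain ⟨N, hN, hcov⟩ := hnet t ht
      refine ⟨fun p i => starMap i₀ t (N i) p, fun p q => ?_, fun p q hpq => ?_⟩
      · exact (dist_pi_le_iff (dLa_nonneg p q)).2 fun i =>
          (dist_starMap_le (hN i) p q).trans (TSP_le_dLa p q)
      · obtain ⟨i, c, hc, hpc⟩ := hcov p.2
        refine le_trans ?_ (dist_le_pi_dist _ _ i)
        refine le_trans ?_ (le_dist_starMap (hN i) hc (by linarith) fun hq => ?_)
        · linarith
        have h1 : 2 * (4 * t) < TSCP dist p q := by
          by_contra! h1
          have h2 := mul_le_mul_of_nonneg_left h1 hK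
          linarith [hE' p q, dLa_le_TSP_add_one p q]
        rcases exists_far_of_lt_TSCP (by linarith) h1 with h2 | ⟨a, ha, h2⟩
        · linarith [dist_triangle_right p.2 q.2 c]
        · intro h3
          have h4 : 2 * t ≤ dist a c := by linarith [dist_triangle_right p.2 a c]
          have h5 := Finset.ext_iff.1 h3 a
          simp only [outer, Finset.mem_filter, h4, and_true] at h5
          simp only [sd, Set.mem_union, Set.mem_sdiff, Finset.mem_coe, h5] at ha
          tauto
  choose φ h1 h2 using key
  refine ⟨fun t => if h : 0 < t then φ t h else fun _ _ => StarTree.point i₀ i₀ 0, fun t ht => ?_⟩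
  refine ⟨1, one_pos, fun p q => ?_, fun p q hpq => ?_⟩
  · simp only [dif_pos ht, one_mul]
    exact h1 t ht p q
  · simp only [dif_pos ht, mul_one]
    exact h2 t ht p q hpq

theorem nagataDimD_of_TSPEfficient
    (hsep : ∀ x y : X, x ≠ y → 1 ≤ dist x y) {K : ℝ} (hE : TSPEfficient (dist : X → X → ℝ) K) :
    ∃ (n : ℕ) (γ : ℝ), NagataDimD (dLa (dist : X → X → ℝ)) n γ := by
  have hE' : TSPEfficient (dist : X → X → ℝ) (max K 0) := fun p q =>
    (hE p q).trans (mul_le_mul_of_nonneg_right (le_max_left _ _) (TSCP_nonneg p q))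
  have hK : 0 ≤ max K 0 := le_max_right _ _
  obtain ⟨m, hm, hnet⟩ := exists_nets hK hE'
  refine ⟨m, 4 * max K 0 + 1, fun s hs => ?_⟩
  have lt_of_diam : ∀ {A : Set (Lamp X)}, ediamD (dLa dist) A < ENNReal.ofReal s →
      ∀ p ∈ A, ∀ q ∈ A, dLa dist p q < s := fun hA p hp q hq =>
    (ENNReal.ofReal_lt_ofReal_iff hs).1 ((le_ediamD hp hq).trans_lt hA)
  by_cases hs1 : s ≤ 1
  · refine ⟨Set.range singleton, fun p => ⟨{p}, ⟨p, rfl⟩, rfl⟩, ?_, fun A hA => ?_⟩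
    · rintro _ ⟨p, rfl⟩
      refine ediamD_le ?_
      rintro _ rfl _ rfl
      have h0 : ∀ p : Lamp X, dLa dist p p = 0 := fun p => by simp [dLa, rho, TSP_self]
      rw [h0]
      positivity
    · refine le_trans (Set.encard_le_one_iff.2 ?_) le_add_self
      rintro _ _ ⟨⟨p, rfl⟩, p', hp', hp⟩ ⟨⟨q, rfl⟩, q', hq', hq⟩
      rw [Set.mem_singleton_iff] at hp' hq'
      subst hp' hq'
      by_contra hne
      have := one_le_dLa hsep (p := p') (q := q') fun h => hne (by rw [h])
      linarith [lt_of_diam hA _ hp _ hq]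
  obtain ⟨N, hN, hcov⟩ := hnet s hs
  let b : Fin m → Lamp X → Set (Lamp X) := fun i l =>
    {p | l.2 ∈ N i ∧ dist p.2 l.2 < s ∧ outer s l.2 p.1 = l.1}
  refine ⟨{B | ∃ i l, B = b i l}, fun p => ?_, ?_, fun A hA => ?_⟩
  · obtain ⟨i, c, hc, hpc⟩ := hcov p.2
    exact ⟨b i (outer s c p.1, c), ⟨i, _, rfl⟩, hc, hpc, rfl⟩
  · rintro _ ⟨i, l, rfl⟩
    refine ediamD_le fun p hp q hq => ?_
    have hx : ∀ a ∈ ({p.2, q.2} : Set X) ∪ sd p q, dist a l.2 ≤ 2 * s := by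
      rintro a ((rfl | rfl) | ha)
      · linarith [hp.2.1]
      · linarith [hq.2.1]
      · by_contra! h4
        have h5 := Finset.ext_iff.1 (hp.2.2.trans hq.2.2.symm) a
        simp only [outer, Finset.mem_filter, h4.le, and_true] at h5
        simp only [sd, Set.mem_union, Set.mem_sdiff, Finset.mem_coe, h5] at ha
        tauto
    have h1 : TSCP dist p q ≤ 4 * s := TSCP_le (by linarith) fun a ha c hc => by
      linarith [dist_triangle_right a c l.2, hx a ha, hx c hc]
    have h2 := mul_le_mul_of_nonneg_left h1 hK
    linarith [hE' p q, dLa_le_TSP_add_one p q]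
  · have hcol : ∀ B ∈ {B | B ∈ {B | ∃ i l, B = b i l} ∧ (B ∩ A).Nonempty}, ∃ i, ∃ l, B = b i l :=
      fun B hB => hB.1
    have : Nonempty (Fin m) := ⟨⟨0, hm⟩⟩
    choose! col hcol using hcol
    have := Set.encard_le_encard_of_injOn (s := {B | B ∈ {B | ∃ i l, B = b i l} ∧ (B ∩ A).Nonempty})
      (t := (Set.univ : Set (Fin m))) (f := col) (fun _ _ => Set.mem_univ _) ?_
    · refine this.trans ?_
      rw [Set.encard_univ, ENat.card_eq_coe_fintype_card, Fintype.card_fin]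
      exact le_self_add
    · intro B hB B' hB' hBB
      obtain ⟨l, hl⟩ := hcol B hB
      obtain ⟨l', hl'⟩ := hcol B' hB'
      rw [← hBB] at hl'
      obtain ⟨p, hp, hpA⟩ := hB.2
      obtain ⟨q, hq, hqA⟩ := hB'.2
      rw [hl] at hp
      rw [hl'] at hq
      rw [hl, hl']
      congr 1
      by_contra hne
      have h1 := le_dist_starMap (i₀ := p) (hN _) hp.1 (by linarith [hp.2.1]) (q := q) fun hql => by
        by_cases hll : l.2 = l'.2
        · intro h
          rw [hp.2.2, hll, hq.2.2] at h
          exact hne (Prod.ext h hll)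
        · have := hN _ _ hp.1 _ hq.1 hll
          linarith [dist_triangle_left l.2 l'.2 q.2, hq.2.1]
      linarith [dist_starMap_le (i₀ := p) (hN (col B)) p q, TSP_le_dLa p q,
        lt_of_diam hA p hpA q hqA, hp.2.1]

end Nets

section Enflo

lemma dist_eq_add_of_geodesics {T : Type*} [MetricSpace T] (hT : IsRTree T) {α β : ℝ → T} {a b : ℝ}
    (ha : 0 ≤ a) (hb : 0 ≤ b)
    (hα : ∀ s ∈ Icc (0 : ℝ) a, ∀ t ∈ Icc (0 : ℝ) a, dist (α s) (α t) = |s - t|)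
    (hβ : ∀ s ∈ Icc (0 : ℝ) b, ∀ t ∈ Icc (0 : ℝ) b, dist (β s) (β t) = |s - t|)
    (hαβ : α a = β 0) (hmeet : ∀ s ∈ Icc (0 : ℝ) a, ∀ t ∈ Icc (0 : ℝ) b, α s = β t → s = a) :
    dist (α 0) (β b) = a + b := by
  have h0a : (0 : ℝ) ∈ Icc 0 a := ⟨le_rfl, ha⟩
  have haa : a ∈ Icc 0 a := ⟨ha, le_rfl⟩
  have h0b : (0 : ℝ) ∈ Icc 0 b := ⟨le_rfl, hb⟩
  have hbb : b ∈ Icc 0 b := ⟨hb, le_rfl⟩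
  rcases ha.eq_or_lt with rfl | ha
  · rw [hαβ, hβ 0 h0b b hbb]
    simp [abs_of_nonneg hb]
  rcases hb.eq_or_lt with rfl | hb
  · rw [← hαβ, hα 0 h0a a haa]
    simp [abs_of_pos ha]
  have cont : ∀ {c : ℝ} {γ : ℝ → T},
      (∀ s ∈ Icc (0 : ℝ) c, ∀ t ∈ Icc (0 : ℝ) c, dist (γ s) (γ t) = |s - t|) →
      ContinuousOn γ (Icc 0 c) := fun h => by
    refine (LipschitzOnWith.of_dist_le_mul (K := 1) fun s hs t ht => ?_).continuousOn
    rw [h s hs t ht, Real.dist_eq, NNReal.coe_one, one_mul]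
  have meet' : ∀ s ∈ Icc (0 : ℝ) a, ∀ t ∈ Icc (0 : ℝ) b, α s = β t → s = a ∧ t = 0 := by
    intro s hs t ht h
    have hsa := hmeet s hs t ht h
    refine ⟨hsa, ?_⟩
    have h1 := hβ 0 h0b t ht
    rw [← h, hsa, ← hαβ, dist_self] at h1
    have := abs_eq_zero.1 h1.symm
    linarith
  let γ : ℝ → T := fun s => if s ≤ 1 / 2 then α (2 * s * a) else β ((2 * s - 1) * b)
  have hγ1 : ∀ s ∈ Icc (0 : ℝ) 1, s ≤ 1 / 2 → 2 * s * a ∈ Icc (0 : ℝ) a := fun s hs h =>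
    ⟨by have := hs.1; positivity, by nlinarith⟩
  have hγ2 : ∀ s ∈ Icc (0 : ℝ) 1, 1 / 2 ≤ s → (2 * s - 1) * b ∈ Icc (0 : ℝ) b := fun s hs h =>
    ⟨mul_nonneg (by linarith) hb.le, by nlinarith [hs.2]⟩
  have harc : IsArc (α 0) (β b) (γ '' Icc 0 1) := by
    refine ⟨γ, ?_, ?_, by simp [γ], by norm_num [γ], rfl⟩
    · refine ContinuousOn.if ?_ ?_ ?_
      · rintro s ⟨hs, hs'⟩
        have : s = 1 / 2 := by
          have h := frontier_le_subset_eq continuous_id continuous_const hs'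
          exact h
        subst this
        norm_num [hαβ]
      · refine (cont hα).comp (by fun_prop) fun s hs => ?_
        have h : s ≤ 1 / 2 := by
          have h := hs.2
          have h2 : {x : ℝ | x ≤ 1 / 2} = Iic (1 / 2) := rfl
          rw [h2, closure_Iic] at h
          exact h
        exact hγ1 s hs.1 h
      · refine (cont hβ).comp (by fun_prop) fun s hs => ?_
        have h : 1 / 2 ≤ s := by
          have h := hs.2
          have h2 : {x : ℝ | ¬x ≤ 1 / 2} = Ioi (1 / 2) := by ext; simp
          rw [h2, closure_Ioi] at h
          exact h
        exact hγ2 s hs.1 h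
    · have mixed : ∀ s ∈ Icc (0 : ℝ) 1, ∀ t ∈ Icc (0 : ℝ) 1, s ≤ 1 / 2 → ¬ t ≤ 1 / 2 →
          α (2 * s * a) ≠ β ((2 * t - 1) * b) := by
        intro s hs t ht h1 h2 h
        have := (meet' _ (hγ1 s hs h1) _ (hγ2 t ht (not_le.1 h2).le) h).2
        rcases mul_eq_zero.1 this with h3 | h3 <;> linarith
      intro s hs t ht hst
      simp only [γ] at hst
      split_ifs at hst with h1 h2 h2
      · have := hα _ (hγ1 s hs h1) _ (hγ1 t ht h2)
        rw [hst, dist_self] at this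
        have h3 := abs_eq_zero.1 this.symm
        have h4 : (s - t) * a = 0 := by linarith
        rcases mul_eq_zero.1 h4 with h | h <;> linarith
      · exact absurd hst (mixed s hs t ht h1 h2)
      · exact absurd hst.symm (mixed t ht s hs h2 h1)
      · have := hβ _ (hγ2 s hs (not_le.1 h1).le) _ (hγ2 t ht (not_le.1 h2).le)
        rw [hst, dist_self] at this
        have h3 := abs_eq_zero.1 this.symm
        have h4 : (s - t) * b = 0 := by linarith
        rcases mul_eq_zero.1 h4 with h | h <;> linarith
  have hne : α 0 ≠ β b := fun h => hb.ne' (meet' 0 h0a b hbb h).2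
  obtain ⟨δ, hδ0, hδ1, hδ, him⟩ := (hT _ _ hne).2.2 _ harc
  have hp : α a ∈ γ '' Icc 0 1 := ⟨1 / 2, by norm_num, by simp [γ]⟩
  rw [← him] at hp
  obtain ⟨s, hs, hsp⟩ := hp
  have e1 := hδ 0 ⟨le_rfl, dist_nonneg⟩ s hs
  have e2 := hδ s hs _ ⟨dist_nonneg, le_rfl⟩
  rw [hδ0, hsp, hα 0 h0a a haa, zero_sub, zero_sub, abs_neg, abs_neg, abs_of_pos ha,
    abs_of_nonneg hs.1] at e1
  rw [hδ1, hsp, hαβ, hβ 0 h0b b hbb, zero_sub, abs_neg, abs_of_pos hb, abs_sub_comm,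
    abs_of_nonneg (by linarith [hs.2])] at e2
  linarith

lemma IsRTree.exists_geodesic {T : Type*} [MetricSpace T] (hT : IsRTree T) (x y : T) :
    ∃ γ : ℝ → T, γ 0 = x ∧ γ (dist x y) = y ∧
      ∀ s ∈ Icc (0 : ℝ) (dist x y), ∀ t ∈ Icc (0 : ℝ) (dist x y), dist (γ s) (γ t) = |s - t| := by
  rcases eq_or_ne x y with rfl | h
  · refine ⟨fun _ => x, rfl, rfl, fun s hs t ht => ?_⟩
    rw [dist_self] at hs ht ⊢
    rw [le_antisymm hs.2 hs.1, le_antisymm ht.2 ht.1]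
    simp
  · obtain ⟨⟨A, hA⟩, -, h3⟩ := hT x y h
    obtain ⟨γ, h0, h1, h2, -⟩ := h3 A hA
    exact ⟨γ, h0, h1, h2⟩

lemma IsRTree.exists_midpoint {T : Type*} [MetricSpace T] (hT : IsRTree T) (y w : T) :
    ∃ m : T, ∀ x : T,
      dist x m ^ 2 ≤ dist x y ^ 2 / 2 + dist x w ^ 2 / 2 - dist y w ^ 2 / 4 := by
  obtain ⟨β, hβ0, hβ1, hβ⟩ := hT.exists_geodesic y w
  set L := dist y w with hL
  have hL0 : 0 ≤ L := dist_nonneg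
  refine ⟨β (L / 2), fun x => ?_⟩
  have hcont : ContinuousOn (fun s => dist x (β s)) (Icc 0 L) := by
    refine (continuous_const.dist continuous_id).comp_continuousOn
      (LipschitzOnWith.of_dist_le_mul (K := 1) fun s hs t ht => ?_).continuousOn
    rw [hβ s hs t ht, Real.dist_eq, NNReal.coe_one, one_mul]
  obtain ⟨s₀, hs₀, hmin⟩ := isCompact_Icc.exists_isMinOn ⟨0, le_rfl, hL0⟩ hcont
  have hmin' : ∀ s ∈ Icc 0 L, dist x (β s₀) ≤ dist x (β s) := fun s hs => hmin hs
  obtain ⟨α, hα0, hα1, hα⟩ := hT.exists_geodesic x (β s₀)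
  set a := dist x (β s₀) with ha
  have ha0 : 0 ≤ a := dist_nonneg
  have meet : ∀ s ∈ Icc (0 : ℝ) a, ∀ t ∈ Icc (0 : ℝ) L, α s = β t → s = a := by
    intro s hs t ht h
    have h1 := hmin' t ht
    rw [← h, ← hα0, hα 0 ⟨le_rfl, ha0⟩ s hs, zero_sub, abs_neg, abs_of_nonneg hs.1] at h1
    exact le_antisymm hs.2 h1
  have e1 : dist x w = a + (L - s₀) := by
    have := dist_eq_add_of_geodesics hT (α := α) (β := fun s => β (s₀ + s)) ha0
      (b := L - s₀) (by linarith [hs₀.2]) hα (fun s hs t ht => ?_) (by simp [hα1])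
      fun s hs t ht h => meet s hs (s₀ + t) ⟨by linarith [hs₀.1, ht.1], by linarith [ht.2]⟩ h
    · simpa [hα0, hβ1] using this
    · rw [hβ _ ⟨by linarith [hs₀.1, hs.1], by linarith [hs.2]⟩ _
        ⟨by linarith [hs₀.1, ht.1], by linarith [ht.2]⟩]
      congr 1
      ring
  have e2 : dist x y = a + s₀ := by
    have := dist_eq_add_of_geodesics hT (α := α) (β := fun s => β (s₀ - s)) ha0
      (b := s₀) hs₀.1 hα (fun s hs t ht => ?_) (by simp [hα1])
      fun s hs t ht h => meet s hs (s₀ - t) ⟨by linarith [ht.2], by linarith [hs₀.2, ht.1]⟩ h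
    · simpa [hα0, hβ0] using this
    · rw [hβ _ ⟨by linarith [hs.2], by linarith [hs₀.2, hs.1]⟩ _
        ⟨by linarith [ht.2], by linarith [hs₀.2, ht.1]⟩, abs_sub_comm]
      congr 1
      ring
  have e3 : dist x (β (L / 2)) ≤ a + |s₀ - L / 2| := by
    rw [← hβ s₀ hs₀ (L / 2) ⟨by linarith, by linarith⟩]
    exact dist_triangle _ _ _
  have e4 : |s₀ - L / 2| ≤ L / 2 := abs_le.2 ⟨by linarith [hs₀.1], by linarith [hs₀.2]⟩
  have e5 := pow_le_pow_left₀ dist_nonneg e3 2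
  rw [e1, e2]
  nlinarith [sq_abs (s₀ - L / 2), mul_le_mul_of_nonneg_left e4 ha0]

lemma IsRTree.quadrilateral {T : Type*} [MetricSpace T] (hT : IsRTree T) (x y z w : T) :
    dist x z ^ 2 + dist y w ^ 2 ≤
      dist x y ^ 2 + dist y z ^ 2 + dist z w ^ 2 + dist w x ^ 2 := by
  obtain ⟨m, hm⟩ := hT.exists_midpoint y w
  have h1 := hm x
  have h2 := hm z
  have h3 := pow_le_pow_left₀ dist_nonneg (dist_triangle_right x z m) 2
  rw [dist_comm w x, dist_comm y z]
  nlinarith [sq_nonneg (dist x m - dist z m)]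

/-- Enflo's inequality on the Hamming cube. -/
lemma enflo {T : Type*} {e : T → T → ℝ} (hself : ∀ x, e x x = 0) (hsymm : ∀ x y, e x y = e y x)
    (hquad : ∀ x y z w, e x z + e y w ≤ e x y + e y z + e z w + e w x) :
    ∀ (M : ℕ) (g : (Fin M → Bool) → T),
      ∑ x, e (g x) (g fun i => !x i) ≤ ∑ x, ∑ k, e (g x) (g (Function.update x k (!x k))) := by
  intro M
  induction M with
  | zero =>
    intro g
    refine Finset.sum_le_sum fun x _ => ?_
    rw [Finset.univ_eq_empty, Finset.sum_empty, Subsingleton.elim (fun i => !x i) x]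
    exact (hself _).le
  | succ M ih =>
    intro g
    have hsum : ∀ F : (Fin (M + 1) → Bool) → ℝ,
        ∑ x, F x = ∑ x' : Fin M → Bool, (F (Fin.cons true x') + F (Fin.cons false x')) := by
      intro F
      rw [← (Fin.consEquiv fun _ => Bool).sum_comp, Fintype.sum_prod_type, Fintype.sum_bool,
        Finset.sum_add_distrib]
      rfl
    have hneg : ∀ (b : Bool) (x : Fin M → Bool),
        (fun i => !(Fin.cons b x : Fin (M + 1) → Bool) i) = Fin.cons (!b) fun i => !x i := by
      intro b x
      funext i
      refine Fin.cases rfl (fun i => rfl) i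
    rw [hsum, hsum]
    simp only [hneg, Fin.sum_univ_succ, Fin.cons_zero, Fin.cons_succ, Fin.update_cons_zero,
      ← Fin.cons_update, Bool.not_true, Bool.not_false]
    have i1 := ih fun x => g (Fin.cons true x)
    have i2 := ih fun x => g (Fin.cons false x)
    have hflip : ∑ x : Fin M → Bool, e (g (Fin.cons false fun i => !x i)) (g (Fin.cons true fun i => !x i)) =
        ∑ x : Fin M → Bool, e (g (Fin.cons false x)) (g (Fin.cons true x)) := by
      refine Function.Bijective.sum_comp (e := fun (x : Fin M → Bool) i => !x i)
        (Function.Involutive.bijective fun x => by simp)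
        fun x => e (g (Fin.cons false x)) (g (Fin.cons true x))
    have hq := Finset.sum_le_sum fun (x : Fin M → Bool) (_ : x ∈ Finset.univ) =>
      hquad (g (Fin.cons true x)) (g (Fin.cons true fun i => !x i))
        (g (Fin.cons false fun i => !x i)) (g (Fin.cons false x))
    have hs1 := Finset.sum_congr rfl fun (x : Fin M → Bool) (_ : x ∈ Finset.univ) =>
      hsymm (g (Fin.cons true x)) (g (Fin.cons false x))
    have hs2 := Finset.sum_congr rfl fun (x : Fin M → Bool) (_ : x ∈ Finset.univ) =>
      hsymm (g (Fin.cons true fun i => !x i)) (g (Fin.cons false fun i => !x i))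
    have hs3 := Finset.sum_congr rfl fun (x : Fin M → Bool) (_ : x ∈ Finset.univ) =>
      hsymm (g (Fin.cons true fun i => !x i)) (g (Fin.cons false x))
    have hs4 := Finset.sum_congr rfl fun (x : Fin M → Bool) (_ : x ∈ Finset.univ) =>
      hsymm (g (Fin.cons false fun i => !x i)) (g (Fin.cons false x))
    simp only [Finset.sum_add_distrib] at hq ⊢
    linarith

lemma hamDist_not {M : ℕ} (x : Fin M → Bool) : hamDist x (fun i => !x i) = M := by
  simp [hamDist]

lemma hamDist_update_not {M : ℕ} (x : Fin M → Bool) (k : Fin M) :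
    hamDist x (Function.update x k (!x k)) = 1 := by
  have : (Finset.univ.filter fun i => x i ≠ Function.update x k (!x k) i) = {k} := by
    ext i
    rcases eq_or_ne i k with rfl | h
    · simp
    · simp [h]
  rw [hamDist, this, Finset.card_singleton, Nat.cast_one]

lemma not_cube_biLip_of_weakBiLip {dY : Y → Y → ℝ} {n : ℕ} {T : Fin n → Type*}
    {I : ∀ i, MetricSpace (T i)} (hT : ∀ i, @IsRTree (T i) (I i)) {C : ℝ}
    (hφ : WeakBiLip dY (piSupDist I) C) :
    ¬ ∃ D : ℝ, ∀ M : ℕ, ∃ f : (Fin M → Bool) → Y, BiLipWith hamDist dY D f := by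
  rintro ⟨D, hD⟩
  obtain ⟨φ, hφ⟩ := hφ
  set C' := max C 1 with hC'
  have hC'1 : 1 ≤ C' := le_max_right _ _
  obtain ⟨M, hM⟩ := exists_nat_gt (n * D ^ 2 * C' ^ 2)
  have hM0 : (0 : ℝ) < M := lt_of_le_of_lt (by positivity) hM
  obtain ⟨f, -, s, hs, hf⟩ := hD M
  have ht : 0 < s * M / C' := by positivity
  obtain ⟨σ, hσ, hup, hlow⟩ := hφ _ ht
  set g := fun x => φ (s * M / C') (f x) with hg
  have hdiag : ∀ x, (s * M / C' * σ) ^ 2 ≤ ∑ i, dist (g x i) (g (fun j => !x j) i) ^ 2 := by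
    intro x
    have h1 := hlow (f x) (f fun j => !x j) (by
      refine le_trans ?_ (hf _ _).1
      rw [hamDist_not]
      calc C * (s * M / C') ≤ C' * (s * M / C') :=
            mul_le_mul_of_nonneg_right (le_max_left _ _) ht.le
        _ = s * M := by field_simp)
    have h2 : piSupDist I (g x) (g fun j => !x j) ≤
        √(∑ i, dist (g x i) (g (fun j => !x j) i) ^ 2) := by
      refine (dist_pi_le_iff (Real.sqrt_nonneg _)).2 fun i => Real.le_sqrt_of_sq_le ?_
      exact Finset.single_le_sum (f := fun i => dist (g x i) (g (fun j => !x j) i) ^ 2)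
        (fun _ _ => sq_nonneg _) (Finset.mem_univ i)
    exact (Real.le_sqrt' (by positivity)).1 (h1.trans h2)
  have hedge : ∀ x k i, dist (g x i) (g (Function.update x k (!x k)) i) ^ 2 ≤ (σ * (D * s)) ^ 2 := by
    intro x k i
    refine pow_le_pow_left₀ dist_nonneg ?_ 2
    have h1 : dist (g x i) (g (Function.update x k (!x k)) i) ≤
      piSupDist I (g x) (g (Function.update x k (!x k))) := dist_le_pi_dist _ _ i
    refine h1.trans ((hup _ _).trans (mul_le_mul_of_nonneg_left ?_ hσ.le))
    simpa [hamDist_update_not] using (hf x (Function.update x k (!x k))).2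
  have henflo := Finset.sum_le_sum fun (i : Fin n) (_ : i ∈ Finset.univ) =>
    enflo (T := T i) (e := fun a b => dist a b ^ 2) (fun a => by simp) (fun a b => by rw [dist_comm])
      (hT i).quadrilateral M fun x => g x i
  have h1 : (2 : ℝ) ^ M * (s * M / C' * σ) ^ 2 ≤
      ∑ i, ∑ x, dist (g x i) (g (fun j => !x j) i) ^ 2 := by
    rw [Finset.sum_comm]
    have := Finset.card_nsmul_le_sum Finset.univ _ _ fun x _ => hdiag x
    simpa using this
  have h2 : ∑ i, ∑ x, ∑ k, dist (g x i) (g (Function.update x k (!x k)) i) ^ 2 ≤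
      n * (2 ^ M * (M * (σ * (D * s)) ^ 2)) := by
    have := Finset.sum_le_sum fun (i : Fin n) (_ : i ∈ Finset.univ) =>
      Finset.sum_le_sum fun (x : Fin M → Bool) (_ : x ∈ Finset.univ) =>
      Finset.sum_le_sum fun (k : Fin M) (_ : k ∈ Finset.univ) => hedge x k i
    simpa using this
  have h3 := (h1.trans henflo).trans h2
  have h4 : (2 : ℝ) ^ M * s ^ 2 * σ ^ 2 * M * (M / C' ^ 2) ≤
      2 ^ M * s ^ 2 * σ ^ 2 * M * (n * D ^ 2) := by
    calc _ = (2 : ℝ) ^ M * (s * M / C' * σ) ^ 2 := by field_simp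
      _ ≤ _ := h3
      _ = _ := by ring
  have h5 := le_of_mul_le_mul_left h4 (by positivity)
  rw [div_le_iff₀ (by positivity)] at h5
  linarith

end Enflo

section RandomWalk

lemma HasMarkovType2.fintype {dY : Y → Y → ℝ} {L : ℝ} (h : HasMarkovType2 dY L) {Ω : Type*}
    [Fintype Ω] [DecidableEq Ω] (μ : Ω → ℝ) (P : Matrix Ω Ω ℝ) (hμ : ∀ i, 0 ≤ μ i)
    (hμ1 : ∑ i, μ i = 1) (hP : ∀ i j, 0 ≤ P i j) (hP1 : ∀ i, ∑ j, P i j = 1)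
    (hrev : ∀ i j, μ i * P i j = μ j * P j i) (f : Ω → Y) (t : ℕ) :
    ∑ i, ∑ j, μ i * (P ^ t) i j * dY (f i) (f j) ^ 2 ≤
      L ^ 2 * t * ∑ i, ∑ j, μ i * P i j * dY (f i) (f j) ^ 2 := by
  let e := Fintype.equivFin Ω
  have hpow : Matrix.reindexAlgEquiv ℝ ℝ e P ^ t = Matrix.reindexAlgEquiv ℝ ℝ e (P ^ t) :=
    (map_pow _ _ _).symm
  have key := h (Fintype.card Ω) (μ ∘ e.symm) (Matrix.reindexAlgEquiv ℝ ℝ e P)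
    (fun i => hμ _) ((e.symm.sum_comp μ).trans hμ1) (fun i j => hP _ _)
    (fun i => (e.symm.sum_comp fun j => P (e.symm i) j).trans (hP1 _))
    (fun i j => hrev _ _) (f ∘ e.symm) t
  rw [hpow] at key
  have hsum : ∀ Q : Matrix Ω Ω ℝ,
      ∑ i, ∑ j, (μ ∘ e.symm) i * Matrix.reindexAlgEquiv ℝ ℝ e Q i j *
        dY ((f ∘ e.symm) i) ((f ∘ e.symm) j) ^ 2 =
      ∑ i, ∑ j, μ i * Q i j * dY (f i) (f j) ^ 2 := by
    intro Q
    rw [← e.symm.sum_comp]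
    refine Finset.sum_congr rfl fun i _ => ?_
    rw [← e.symm.sum_comp]
    rfl
  rwa [hsum, hsum] at key

/-- The point of the cube obtained from `x` by changing the coordinate `k`. -/
def cubeFlip {M : ℕ} (x : Fin M → Bool) (k : Fin M) : Fin M → Bool := Function.update x k (!x k)

lemma cubeFlip_cubeFlip {M : ℕ} (x : Fin M → Bool) (k : Fin M) : cubeFlip (cubeFlip x k) k = x := by
  simp [cubeFlip]

lemma cubeFlip_eq_iff {M : ℕ} {x y : Fin M → Bool} {k : Fin M} : cubeFlip x k = y ↔ cubeFlip y k = x :=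
  ⟨fun h => by rw [← h, cubeFlip_cubeFlip], fun h => by rw [← h, cubeFlip_cubeFlip]⟩

lemma hamDist_cubeFlip {M : ℕ} (x : Fin M → Bool) (k : Fin M) : hamDist x (cubeFlip x k) = 1 :=
  hamDist_update_not x k

/-- The transition matrix of the simple random walk on the Hamming cube. -/
def cubeWalk (M : ℕ) : Matrix (Fin M → Bool) (Fin M → Bool) ℝ := fun x y =>
  (∑ k, if cubeFlip x k = y then 1 else 0) / M

lemma cubeWalk_nonneg {M : ℕ} (x y : Fin M → Bool) : 0 ≤ cubeWalk M x y :=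
  div_nonneg (Finset.sum_nonneg fun _ _ => by split_ifs <;> norm_num) (Nat.cast_nonneg M)

lemma cubeWalk_symm {M : ℕ} (x y : Fin M → Bool) : cubeWalk M x y = cubeWalk M y x := by
  simp only [cubeWalk, cubeFlip_eq_iff (x := x)]

lemma sum_cubeWalk_mul {M : ℕ} (x : Fin M → Bool) (g : (Fin M → Bool) → ℝ) :
    ∑ y, cubeWalk M x y * g y = (∑ k, g (cubeFlip x k)) / M := by
  simp only [cubeWalk, div_mul_eq_mul_div, ← Finset.sum_div, Finset.sum_mul]
  rw [Finset.sum_comm]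
  simp

lemma sum_cubeWalk {M : ℕ} (hM : 0 < M) (x : Fin M → Bool) : ∑ y, cubeWalk M x y = 1 := by
  have := sum_cubeWalk_mul x fun _ => 1
  simp only [mul_one] at this
  rw [this]
  simp [hM.ne']

/-- The Rademacher function of the coordinate `i`. -/
def rademacher {M : ℕ} (i : Fin M) (x : Fin M → Bool) : ℝ := if x i then 1 else -1

lemma rademacher_mul_self {M : ℕ} (i : Fin M) (x : Fin M → Bool) :
    rademacher i x * rademacher i x = 1 := by
  unfold rademacher
  split_ifs <;> norm_num

lemma hamDist_eq_sum {M : ℕ} (x y : Fin M → Bool) :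
    hamDist x y = ∑ i, (1 - rademacher i x * rademacher i y) / 2 := by
  rw [hamDist, Finset.card_filter]
  push_cast
  refine Finset.sum_congr rfl fun i _ => ?_
  unfold rademacher
  cases x i <;> cases y i <;> norm_num

lemma sum_rademacher_cubeFlip {M : ℕ} (i : Fin M) (x : Fin M → Bool) :
    ∑ k, rademacher i (cubeFlip x k) = (M - 2) * rademacher i x := by
  have : ∀ k, rademacher i (cubeFlip x k) = rademacher i x - if k = i then 2 * rademacher i x else 0 := by
    intro k
    rcases eq_or_ne k i with rfl | h
    · unfold rademacher cubeFlip
      cases hx : x k <;> simp <;> norm_num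
    · simp [rademacher, cubeFlip, h, h.symm]
  simp only [this, Finset.sum_sub_distrib, Finset.sum_ite_eq', Finset.sum_const, Finset.card_univ,
    Fintype.card_fin, nsmul_eq_mul, Finset.mem_univ, if_true]
  ring

lemma cubeWalk_pow_rademacher {M : ℕ} (hM : 0 < M) (i : Fin M) (t : ℕ) (x : Fin M → Bool) :
    ∑ y, (cubeWalk M ^ t) x y * rademacher i y = (1 - 2 / M) ^ t * rademacher i x := by
  have hM' : (M : ℝ) ≠ 0 := by exact_mod_cast hM.ne'
  have h1 : (cubeWalk M).mulVec (rademacher i) = (1 - 2 / M : ℝ) • rademacher i := by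
    funext x
    rw [Pi.smul_apply, smul_eq_mul]
    refine (sum_cubeWalk_mul x _).trans ?_
    rw [sum_rademacher_cubeFlip]
    field_simp
  have h2 : (cubeWalk M ^ t).mulVec (rademacher i) = ((1 - 2 / M : ℝ) ^ t) • rademacher i := by
    induction t with
    | zero => simp
    | succ t ih => rw [pow_succ, ← Matrix.mulVec_mulVec, h1, Matrix.mulVec_smul, ih, smul_smul, pow_succ']
  exact congrFun h2 x

lemma cubeWalk_pow_sum {M : ℕ} (hM : 0 < M) (t : ℕ) (x : Fin M → Bool) :
    ∑ y, (cubeWalk M ^ t) x y = 1 := by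
  have h1 : (cubeWalk M).mulVec 1 = 1 := by
    funext x
    simpa [Matrix.mulVec, dotProduct] using sum_cubeWalk hM x
  have h2 : (cubeWalk M ^ t).mulVec 1 = 1 := by
    induction t with
    | zero => simp
    | succ t ih => rw [pow_succ, ← Matrix.mulVec_mulVec, h1, ih]
  simpa [Matrix.mulVec, dotProduct] using congrFun h2 x

lemma cubeWalk_pow_nonneg {M : ℕ} (t : ℕ) : ∀ x y : Fin M → Bool, 0 ≤ (cubeWalk M ^ t) x y := by
  induction t with
  | zero =>
    intro x y
    rw [pow_zero, Matrix.one_apply]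
    split_ifs <;> norm_num
  | succ t ih =>
    intro x y
    rw [pow_succ, Matrix.mul_apply]
    exact Finset.sum_nonneg fun z _ => mul_nonneg (ih x z) (cubeWalk_nonneg z y)

lemma sum_cubeWalk_pow_mul_hamDist {M : ℕ} (hM : 0 < M) (t : ℕ) (x : Fin M → Bool) :
    ∑ y, (cubeWalk M ^ t) x y * hamDist x y = M * ((1 - (1 - 2 / M) ^ t) / 2) := by
  have : ∀ y, (cubeWalk M ^ t) x y * hamDist x y =
      ∑ i, ((cubeWalk M ^ t) x y - rademacher i x * ((cubeWalk M ^ t) x y * rademacher i y)) / 2 := by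
    intro y
    rw [hamDist_eq_sum, Finset.mul_sum]
    exact Finset.sum_congr rfl fun i _ => by ring
  simp only [this]
  rw [Finset.sum_comm]
  simp only [← Finset.sum_div, Finset.sum_sub_distrib, ← Finset.mul_sum,
    cubeWalk_pow_rademacher hM, cubeWalk_pow_sum hM]
  simp only [mul_left_comm (rademacher _ x), rademacher_mul_self, Finset.sum_const,
    Finset.card_univ, Fintype.card_fin, nsmul_eq_mul]
  ring

lemma le_sum_cubeWalk_pow_mul_hamDist_sq {M : ℕ} (hM : 2 ≤ M) (x : Fin M → Bool) :
    (M : ℝ) ^ 2 / 16 ≤ ∑ y, (cubeWalk M ^ M) x y * hamDist x y ^ 2 := by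
  have hM0 : 0 < M := by omega
  have hexp : (1 - 2 / M : ℝ) ^ M ≤ 1 / 2 := by
    refine (Real.one_sub_div_pow_le_exp_neg (by exact_mod_cast hM)).trans ?_
    rw [Real.exp_neg, inv_le_comm₀ (Real.exp_pos _) (by norm_num)]
    linarith [Real.add_one_le_exp 2]
  have h1 : ∑ y, (cubeWalk M ^ M) x y * (M / 2 * hamDist x y - (M / 4) ^ 2) ≤
      ∑ y, (cubeWalk M ^ M) x y * hamDist x y ^ 2 :=
    Finset.sum_le_sum fun y _ => mul_le_mul_of_nonneg_left
      (by nlinarith [sq_nonneg (hamDist x y - M / 4)]) (cubeWalk_pow_nonneg M x y)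
  refine le_trans ?_ h1
  have h2 : ∑ y, (cubeWalk M ^ M) x y * (M / 2 * hamDist x y - (M / 4) ^ 2) =
      (M / 2 : ℝ) * (M * ((1 - (1 - 2 / (M : ℝ)) ^ M) / 2)) - (M / 4 : ℝ) ^ 2 := by
    rw [← sum_cubeWalk_pow_mul_hamDist hM0, Finset.mul_sum]
    conv_rhs => rw [← mul_one ((M / 4 : ℝ) ^ 2), ← cubeWalk_pow_sum hM0 M x, Finset.mul_sum]
    rw [← Finset.sum_sub_distrib]
    exact Finset.sum_congr rfl fun y _ => by ring
  rw [h2]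
  nlinarith [mul_le_mul_of_nonneg_left hexp (sq_nonneg (M : ℝ))]

lemma not_cube_biLip_of_hasMarkovType2 {dY : Y → Y → ℝ} {L : ℝ} (h : HasMarkovType2 dY L) :
    ¬ ∃ D : ℝ, ∀ M : ℕ, ∃ f : (Fin M → Bool) → Y, BiLipWith hamDist dY D f := by
  rintro ⟨D, hD⟩
  obtain ⟨M', hM'⟩ := exists_nat_gt (16 * L ^ 2 * D ^ 2)
  set M := M' + 2 with hMdef
  have hM : 16 * L ^ 2 * D ^ 2 < M := by rw [hMdef]; push_cast; linarith
  have hM0 : (0 : ℝ) < M := by rw [hMdef]; positivity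
  obtain ⟨f, -, s, hs, hf⟩ := hD M
  have hcard : (0 : ℝ) < 2 ^ M := by positivity
  have hsum1 : ∑ _x : Fin M → Bool, (1 / 2 ^ M : ℝ) = 1 := by simp
  have key := h.fintype (fun _ : Fin M → Bool => (1 / 2 ^ M : ℝ)) (cubeWalk M)
    (fun _ => by positivity) hsum1 cubeWalk_nonneg (sum_cubeWalk (by omega))
    (fun x y => by rw [cubeWalk_symm]) f M
  have hlow : s ^ 2 * (M ^ 2 / 16) ≤
      ∑ x, ∑ y, 1 / 2 ^ M * (cubeWalk M ^ M) x y * dY (f x) (f y) ^ 2 := by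
    have : ∀ x ∈ (Finset.univ : Finset (Fin M → Bool)), 1 / 2 ^ M * (s ^ 2 * (M ^ 2 / 16)) ≤
        ∑ y, 1 / 2 ^ M * (cubeWalk M ^ M) x y * dY (f x) (f y) ^ 2 := fun x _ => by
      simp only [mul_assoc, ← Finset.mul_sum]
      refine mul_le_mul_of_nonneg_left ?_ (by positivity)
      refine (mul_le_mul_of_nonneg_left (le_sum_cubeWalk_pow_mul_hamDist_sq (by omega) x)
        (sq_nonneg s)).trans ?_
      rw [Finset.mul_sum]
      refine Finset.sum_le_sum fun y _ => ?_
      rw [mul_left_comm, ← mul_pow]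
      refine mul_le_mul_of_nonneg_left (pow_le_pow_left₀ ?_ (hf x y).1 2) (cubeWalk_pow_nonneg M x y)
      exact mul_nonneg hs.le (Nat.cast_nonneg _)
    refine le_trans (le_of_eq ?_) (Finset.sum_le_sum this)
    rw [← Finset.sum_mul, hsum1, one_mul]
  have hup : ∑ x, ∑ y, 1 / 2 ^ M * cubeWalk M x y * dY (f x) (f y) ^ 2 ≤ (D * s) ^ 2 := by
    have : ∀ x ∈ (Finset.univ : Finset (Fin M → Bool)),
        ∑ y, 1 / 2 ^ M * cubeWalk M x y * dY (f x) (f y) ^ 2 ≤ 1 / 2 ^ M * (D * s) ^ 2 := fun x _ => by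
      simp only [mul_assoc, ← Finset.mul_sum]
      refine mul_le_mul_of_nonneg_left ?_ (by positivity)
      rw [sum_cubeWalk_mul, div_le_iff₀ hM0]
      have : ∀ k ∈ (Finset.univ : Finset (Fin M)), dY (f x) (f (cubeFlip x k)) ^ 2 ≤ (D * s) ^ 2 :=
        fun k _ => by
          have h1 := hf x (cubeFlip x k)
          rw [hamDist_cubeFlip, mul_one, mul_one] at h1
          exact pow_le_pow_left₀ (by linarith) h1.2 2
      refine (Finset.sum_le_sum this).trans (le_of_eq ?_)
      simp [mul_comm]
    refine (Finset.sum_le_sum this).trans (le_of_eq ?_)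
    rw [← Finset.sum_mul, hsum1, one_mul]
  have h1 := (hlow.trans key).trans (mul_le_mul_of_nonneg_left hup (by positivity))
  have h2 : s ^ 2 * M * M ≤ s ^ 2 * M * (16 * L ^ 2 * D ^ 2) := by nlinarith
  have h3 := le_of_mul_le_mul_left h2 (by positivity)
  linarith

end RandomWalk

section Cubes

lemma sd_empty_left (x y : X) (S : Finset X) : sd ((∅, x) : Lamp X) (S, y) = (S : Set X) := by
  simp [sd]

variable [MetricSpace X]

lemma exists_pieces {r : ℝ} (l : List X) : ∀ x : X, ∃ (s : List X) (P : List (List X)),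
    0 ≤ r → ((x :: s) :: P).flatten = x :: l ∧ pathLength dist (x :: s) ≤ r ∧
      (∀ u ∈ P, pathLength dist u ≤ r) ∧
      P.length * r + pathLength dist (x :: s) ≤ pathLength dist (x :: l) := by
  induction l with
  | nil => exact fun x => ⟨[], [], fun hr => ⟨rfl, hr, by simp, by simp⟩⟩
  | cons y l ih =>
    intro x
    obtain ⟨s, P, h⟩ := ih y
    by_cases hd : dist x y + pathLength dist (y :: s) ≤ r
    · refine ⟨y :: s, P, fun hr => ?_⟩
      obtain ⟨h1, h2, h3, h4⟩ := h hr
      refine ⟨?_, hd, h3, ?_⟩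
      · rw [List.flatten_cons, List.cons_append, ← h1, List.flatten_cons]
      · rw [pathLength_cons_cons, pathLength_cons_cons]
        linarith
    · refine ⟨[], (y :: s) :: P, fun hr => ?_⟩
      obtain ⟨h1, h2, h3, h4⟩ := h hr
      refine ⟨?_, hr, ?_, ?_⟩
      · rw [List.flatten_cons, h1]
        rfl
      · rintro u (_ | ⟨_, hu⟩)
        · exact h2
        · exact h3 u hu
      · rw [pathLength_cons_cons, List.length_cons]
        push_cast
        change _ + 0 ≤ _
        linarith

/-- The length of a shortest closed tour starting at `x` and visiting all the points of `S`. -/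
def tourLength (x : X) (S : Finset X) : ℝ := TSP dist ((∅, x) : Lamp X) (S, x)

lemma tourLength_empty (x : X) : tourLength x (∅ : Finset X) = 0 := TSP_self _

lemma TSP_eq_tourLength {p q : Lamp X} {x : X} {S : Finset X} (hp : p.2 = x) (hq : q.2 = x)
    (h : sd p q = S) : TSP dist p q = tourLength x S :=
  TSP_congr hp hq (by rw [h, sd_empty_left])

lemma tourLength_union_le (x : X) (S S' : Finset X) :
    tourLength x (S ∪ S') ≤ tourLength x S + tourLength x S' := by
  have := TSP_le_add_of_subset (p := ((S, x) : Lamp X)) (q := (∅, x)) (r := (S', x))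
    (p' := (∅, x)) (r' := (S ∪ S', x)) rfl rfl (by
      rw [sd_comm (S, x), sd_empty_left, sd_empty_left, sd_empty_left, Finset.coe_union])
  rwa [TSP_comm (S, x)] at this

lemma tourLength_biUnion_le {ι : Type*} (x : X) (I : Finset ι) (S : ι → Finset X) :
    tourLength x (I.biUnion S) ≤ ∑ i ∈ I, tourLength x (S i) := by
  induction I using Finset.induction_on with
  | empty => simp [tourLength_empty]
  | insert i I hi ih =>
    rw [Finset.biUnion_insert, Finset.sum_insert hi]
    exact (tourLength_union_le _ _ _).trans (by linarith)

lemma tourLength_toFinset_le {x : X} {r : ℝ} (hr : 0 ≤ r) {l : List X} (hl : pathLength dist l ≤ r)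
    (hx : ∀ a ∈ l, dist x a ≤ r) : tourLength x l.toFinset ≤ 3 * r := by
  rcases l.eq_nil_or_concat with rfl | ⟨l₀, z, rfl⟩
  · rw [List.toFinset_nil, tourLength_empty]
    linarith
  · rw [List.concat_eq_append] at hl hx ⊢
    have h1 : tourLength x (l₀ ++ [z]).toFinset ≤ pathLength dist (x :: (l₀ ++ [z, x])) := by
      refine TSP_le ⟨rfl, by simp [List.getLast?_cons, List.getLast?_append], fun a ha => ?_⟩
      rw [sd_empty_left, Finset.mem_coe, List.mem_toFinset, List.mem_append] at ha
      rcases ha with ha | ha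
      · simp [ha]
      · rw [List.mem_singleton] at ha
        simp [ha]
    rw [← List.cons_append, pathLength_append (x :: l₀) z [x]] at h1
    have h2 : pathLength dist [z, x] ≤ r := by
      rw [pathLength_cons_cons]
      change _ + 0 ≤ _
      rw [dist_comm, add_zero]
      exact hx z (by simp)
    have h3 : pathLength dist ((x :: l₀) ++ [z]) ≤ 2 * r := by
      cases l₀ with
      | nil =>
        change dist x z + 0 ≤ _
        linarith [hx z (by simp)]
      | cons y l₁ =>
        rw [List.cons_append, List.cons_append, pathLength_cons_cons]
        rw [List.cons_append] at hl
        linarith [hx y (by simp)]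
    linarith

/-- A failure of TSP-efficiency with constant `3m` yields more than `m` disjoint pieces of a
near-optimal tour. -/
lemma exists_disjoint_pieces (hsep : ∀ x y : X, x ≠ y → 1 ≤ dist x y) {p q : Lamp X} {K : ℝ}
    (hK : 1 ≤ K) (h : K * TSCP dist p q < TSP dist p q) :
    ∃ (x : X) (r : ℝ) (m : ℕ) (S : Fin m → Finset X), 1 ≤ r ∧ K - 1 < 3 * m ∧
      (∀ i j, i ≠ j → Disjoint (S i) (S j)) ∧ (∀ i, tourLength x (S i) ≤ 3 * r) ∧
      (m - 1) * r ≤ 2 * tourLength x (Finset.univ.biUnion S) := by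
  set r := TSCP dist p q with hr
  have hx : ∀ a ∈ ({p.2, q.2} : Set X) ∪ sd p q, dist p.2 a ≤ r := fun a ha =>
    dist_le_TSCP (by simp) ha
  have hr1 : 1 ≤ r := by
    by_contra! hlt
    have heq : ∀ a ∈ ({p.2, q.2} : Set X) ∪ sd p q, a = p.2 := fun a ha => by
      by_contra hne
      linarith [hx a ha, hsep p.2 a (Ne.symm hne)]
    have h1 : TSP dist p q ≤ pathLength dist [p.2, q.2] :=
      TSP_le ⟨rfl, rfl, fun a ha => by rw [heq a (Or.inr ha)]; simp⟩
    have h2 : pathLength dist [p.2, q.2] = dist p.2 q.2 + 0 := rfl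
    have h3 := hx q.2 (by simp)
    have h4 : 0 ≤ r := TSCP_nonneg p q
    nlinarith
  set E : Finset X := (sd_finite p q).toFinset with hE
  have hEc : (E : Set X) = sd p q := by simp [hE]
  have hfE : (K - 1) * r < tourLength p.2 E := by
    have h1 := TSP_triangle p (q.1, p.2) q
    have h2 := TSP_self_config q.1 p.2 q.2
    have h3 : TSP dist p (q.1, p.2) = tourLength p.2 E :=
      TSP_eq_tourLength rfl rfl hEc.symm
    have h4 := hx q.2 (by simp)
    linarith
  have hfE0 : 0 < tourLength p.2 E := lt_of_le_of_lt (mul_nonneg (by linarith) (by linarith)) hfE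
  obtain ⟨l, hl, hlen⟩ := exists_isTour_lt (c := 2 * tourLength p.2 E)
    (p := ((∅, p.2) : Lamp X)) (q := (E, p.2)) (by unfold tourLength at *; linarith)
  set l' := (l.filter (· ∈ E)).dedup with hl'
  have hmem : ∀ a, a ∈ l' ↔ a ∈ E := fun a => by
    rw [hl', List.mem_dedup, List.mem_filter, decide_eq_true_iff]
    exact ⟨fun h => h.2, fun h => ⟨hl.2.2 a (by rw [sd_empty_left]; exact h), h⟩⟩
  have hlen' : pathLength dist l' ≤ 2 * tourLength p.2 E :=
    (pathLength_le_of_sublist ((List.dedup_sublist _).trans List.filter_sublist)).trans hlen.le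
  have hnodup : l'.Nodup := List.nodup_dedup _
  obtain ⟨y, l₁, hyl⟩ : ∃ y l₁, l' = y :: l₁ := by
    cases hc : l' with
    | nil =>
      have : E = ∅ := Finset.eq_empty_of_forall_notMem fun a ha => by
        rw [← hmem, hc] at ha
        exact absurd ha List.not_mem_nil
      rw [this, tourLength_empty] at hfE0
      exact absurd hfE0 (lt_irrefl _)
    | cons y l₁ => exact ⟨y, l₁, rfl⟩
  rw [hyl] at hlen' hnodup
  obtain ⟨s, P, hP⟩ := exists_pieces (r := r) l₁ y
  obtain ⟨h1, h2, h3, h4⟩ := hP (by linarith)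
  set Q := (y :: s) :: P with hQ
  have hQr : ∀ u ∈ Q, pathLength dist u ≤ r := by
    intro u hu
    rcases List.mem_cons.1 hu with rfl | hu
    · exact h2
    · exact h3 u hu
  have hQE : ∀ a, a ∈ E ↔ ∃ u ∈ Q, a ∈ u := fun a => by
    rw [← List.mem_flatten, h1, ← hyl, hmem]
  let S : Fin Q.length → Finset X := fun i => (Q.get i).toFinset
  have hS : Finset.univ.biUnion S = E := by
    ext a
    simp only [S, Finset.mem_biUnion, Finset.mem_univ, true_and, List.mem_toFinset, hQE]
    constructor
    · rintro ⟨i, hi⟩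
      exact ⟨_, List.get_mem Q i, hi⟩
    · rintro ⟨u, hu, ha⟩
      obtain ⟨i, rfl⟩ := List.get_of_mem hu
      exact ⟨i, ha⟩
  have hS3 : ∀ i, tourLength p.2 (S i) ≤ 3 * r := fun i => by
    refine tourLength_toFinset_le (by linarith) (hQr _ (List.get_mem Q i)) fun a ha => ?_
    refine hx a (Or.inr ?_)
    rw [← hEc]
    exact (hQE a).2 ⟨_, List.get_mem Q i, ha⟩
  refine ⟨p.2, r, Q.length, S, hr1, ?_, ?_, hS3, ?_⟩
  · have h5 := tourLength_biUnion_le p.2 Finset.univ S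
    have h6 := Finset.sum_le_sum fun (i : Fin Q.length) (_ : i ∈ Finset.univ) => hS3 i
    rw [hS] at h5
    rw [Finset.sum_const, Finset.card_univ, Fintype.card_fin, nsmul_eq_mul] at h6
    have h7 : (K - 1) * r < (3 * Q.length) * r := by linarith
    exact lt_of_mul_lt_mul_right h7 (by linarith)
  · rw [← h1, List.nodup_flatten] at hnodup
    have key : ∀ i j : Fin Q.length, i < j → Disjoint (S i) (S j) := fun i j hij => by
      have := List.pairwise_iff_get.1 hnodup.2 i j hij
      rw [Finset.disjoint_left]
      intro a ha hb
      exact this (List.mem_toFinset.1 ha) (List.mem_toFinset.1 hb)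
    intro i j hij
    rcases lt_or_gt_of_ne hij with h | h
    · exact key i j h
    · exact (key j i h).symm
  · rw [hS, hQ, List.length_cons]
    push_cast
    linarith [pathLength_nonneg (y :: s)]

theorem exists_cube_biLip (hsep : ∀ x y : X, x ≠ y → 1 ≤ dist x y)
    (hE : ¬ ∃ K : ℝ, TSPEfficient (dist : X → X → ℝ) K) (M : ℕ) :
    ∃ f : (Fin M → Bool) → Lamp X, BiLipWith hamDist (dLa dist) 32 f := by
  obtain ⟨p, q, hpq⟩ : ∃ p q : Lamp X, (24 * M + 7 : ℝ) * TSCP dist p q < TSP dist p q := by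
    by_contra! h
    exact hE ⟨24 * M + 7, h⟩
  have hM : (0 : ℝ) ≤ M := Nat.cast_nonneg M
  obtain ⟨x, r, m, S, hr1, hm, hdisj, hS3, hmr⟩ := exists_disjoint_pieces hsep (by linarith) hpq
  obtain ⟨J, hJ, hJmax⟩ := Finset.exists_max_image
    ((Finset.univ : Finset (Finset (Fin m))).filter fun J =>
      tourLength x (J.biUnion S) ≤ J.card * (r / 8)) Finset.card
    ⟨∅, by simp [tourLength_empty]⟩
  rw [Finset.mem_filter] at hJ
  have hlow : ∀ I ⊆ Jᶜ, I.card * (r / 8) ≤ tourLength x (I.biUnion S) := by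
    intro I hI
    by_contra! hlt
    have hd : Disjoint J I := Finset.disjoint_left.2 fun a ha hb => Finset.mem_compl.1 (hI hb) ha
    have h1 := hJmax (J ∪ I) (Finset.mem_filter.2 ⟨Finset.mem_univ _, by
      rw [Finset.card_union_of_disjoint hd, Finset.union_biUnion]
      push_cast
      linarith [tourLength_union_le x (J.biUnion S) (I.biUnion S)]⟩)
    rw [Finset.card_union_of_disjoint hd] at h1
    have h2 : I = ∅ := Finset.card_eq_zero.1 (by omega)
    rw [h2] at hlt
    simp [tourLength_empty] at hlt
  have hup : ∀ I : Finset (Fin m), tourLength x (I.biUnion S) ≤ I.card * (3 * r) := fun I => by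
    refine (tourLength_biUnion_le x I S).trans ?_
    simpa using Finset.sum_le_sum fun i (_ : i ∈ I) => hS3 i
  have hcard : M ≤ Jᶜ.card := by
    have h1 := tourLength_union_le x (J.biUnion S) (Jᶜ.biUnion S)
    rw [← Finset.union_biUnion, Finset.union_compl] at h1
    have h2 := hup Jᶜ
    have h3 : (J.card : ℝ) ≤ m := by
      exact_mod_cast (Finset.card_le_univ J).trans_eq (Fintype.card_fin m)
    have h4 : (m - 1 : ℝ) * r ≤ (m / 4 + 6 * Jᶜ.card) * r := by nlinarith [hJ.2]
    have h5 := le_of_mul_le_mul_right h4 (by linarith)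
    have h6 : (M : ℝ) ≤ Jᶜ.card := by linarith
    exact_mod_cast h6
  obtain ⟨e⟩ := Function.Embedding.nonempty_of_card_le (α := Fin M) (β := ↥(Jᶜ)) (by
    rwa [Fintype.card_fin, Fintype.card_coe])
  let e' : Fin M ↪ Fin m := e.trans (Function.Embedding.subtype _)
  let f : (Fin M → Bool) → Lamp X := fun ε =>
    ((Finset.univ.filter fun i => ε i = true).biUnion fun i => S (e' i), x)
  let I : (Fin M → Bool) → (Fin M → Bool) → Finset (Fin m) := fun ε δ =>
    (Finset.univ.filter fun i => ε i ≠ δ i).map e'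
  have hI : ∀ ε δ, ((I ε δ).card : ℝ) = hamDist ε δ := fun ε δ => by
    rw [Finset.card_map, hamDist]
  have hIJ : ∀ ε δ, I ε δ ⊆ Jᶜ := fun ε δ a ha => by
    obtain ⟨i, -, rfl⟩ := Finset.mem_map.1 ha
    exact (e i).2
  have hsd : ∀ ε δ, sd (f ε) (f δ) = ((I ε δ).biUnion S : Finset X) := by
    intro ε δ
    have huniq : ∀ {a i j}, a ∈ S (e' i) → a ∈ S (e' j) → i = j := fun {a i j} hi hj => by
      by_contra hne
      exact Finset.disjoint_left.1 (hdisj _ _ fun h => hne (e'.injective h)) hi hj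
    ext a
    simp only [sd, f, I, Set.mem_union, Set.mem_sdiff, Finset.mem_coe, Finset.mem_biUnion,
      Finset.mem_filter, Finset.mem_univ, true_and, Finset.mem_map]
    constructor
    · rintro (⟨⟨i, hi, ha⟩, h⟩ | ⟨⟨i, hi, ha⟩, h⟩)
      · exact ⟨_, ⟨i, fun h' => h ⟨i, by rw [← h', hi], ha⟩, rfl⟩, ha⟩
      · exact ⟨_, ⟨i, fun h' => h ⟨i, by rw [h', hi], ha⟩, rfl⟩, ha⟩
    · rintro ⟨_, ⟨i, hi, rfl⟩, ha⟩
      cases hε : ε i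
      · refine Or.inr ⟨⟨i, ?_, ha⟩, ?_⟩
        · rw [hε] at hi
          simpa using hi.symm
        · rintro ⟨j, hj, haj⟩
          rw [huniq haj ha, hε] at hj
          exact absurd hj (by simp)
      · refine Or.inl ⟨⟨i, hε, ha⟩, ?_⟩
        rintro ⟨j, hj, haj⟩
        rw [huniq haj ha] at hj
        exact hi (hε.trans hj.symm)
  have hTSP : ∀ ε δ, TSP dist (f ε) (f δ) = tourLength x ((I ε δ).biUnion S) := fun ε δ =>
    TSP_eq_tourLength rfl rfl (hsd ε δ)
  have hlower : ∀ ε δ, r / 8 * hamDist ε δ ≤ dLa dist (f ε) (f δ) := fun ε δ => by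
    refine le_trans ?_ (TSP_le_dLa _ _)
    rw [hTSP, ← hI, mul_comm]
    exact hlow _ (hIJ ε δ)
  have hham : ∀ ε δ : Fin M → Bool, ε ≠ δ → 1 ≤ hamDist ε δ := fun ε δ h => by
    obtain ⟨i, hi⟩ := Function.ne_iff.1 h
    rw [hamDist]
    exact_mod_cast Finset.card_pos.2 ⟨i, by simpa using hi⟩
  have hself : ∀ p : Lamp X, dLa dist p p = 0 := fun p => by simp [dLa, rho, TSP_self]
  refine ⟨f, fun ε δ h => ?_, r / 8, by linarith, fun ε δ => ⟨hlower ε δ, ?_⟩⟩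
  · by_contra hne
    have h1 := hlower ε δ
    rw [h, hself] at h1
    nlinarith [hham ε δ hne]
  · rcases eq_or_ne ε δ with rfl | hne
    · rw [hself]
      simp [hamDist]
    · have h1 := hup (I ε δ)
      rw [← hTSP, hI] at h1
      have h2 := dLa_le_TSP_add_one (f ε) (f δ)
      nlinarith [hham ε δ hne]

end Cubes

section PathExpectation

/-- `P` is a stochastic matrix, reversible with respect to the probability vector `μ`. -/
structure IsReversibleChain {Ω : Type*} [Fintype Ω] (μ : Ω → ℝ) (P : Matrix Ω Ω ℝ) : Prop where
  nonneg : ∀ i, 0 ≤ μ i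
  sum_eq_one : ∑ i, μ i = 1
  trans_nonneg : ∀ i j, 0 ≤ P i j
  sum_trans : ∀ i, ∑ j, P i j = 1
  reversible : ∀ i j, μ i * P i j = μ j * P j i

/-- The sum of `c` over the steps of a path; a path is listed from its last state to its first. -/
def stepSum {Ω A : Type*} [AddCommGroup A] (c : Ω → Ω → A) : List Ω → A
  | [] => 0
  | [_] => 0
  | z :: y :: l => c y z + stepSum c (y :: l)

lemma stepSum_cons_cons {Ω A : Type*} [AddCommGroup A] (c : Ω → Ω → A) (z y : Ω) (l : List Ω) :
    stepSum c (z :: y :: l) = c y z + stepSum c (y :: l) := rfl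

lemma stepSum_append {Ω A : Type*} [AddCommGroup A] (c : Ω → Ω → A) (l : List Ω) (z y : Ω) :
    stepSum c (l ++ [z, y]) = stepSum c (l ++ [z]) + c y z := by
  induction l with
  | nil => simp [stepSum]
  | cons a l ih =>
    cases l with
    | nil => simp [stepSum]
    | cons b l =>
      simp only [List.cons_append, stepSum_cons_cons] at ih ⊢
      rw [ih, add_assoc]

lemma stepSum_reverse {Ω A : Type*} [AddCommGroup A] (c : Ω → Ω → A) (l : List Ω) :
    stepSum c l.reverse = stepSum (fun a b => c b a) l := by
  induction l with
  | nil => rfl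
  | cons z l ih =>
    cases l with
    | nil => rfl
    | cons y l =>
      have h : (z :: y :: l).reverse = l.reverse ++ [y, z] := by simp
      rw [h, stepSum_append, stepSum_cons_cons, ← ih, add_comm]
      simp

lemma stepSum_nonneg {Ω : Type*} {c : Ω → Ω → ℝ} (hc : ∀ i j, 0 ≤ c i j) (l : List Ω) :
    0 ≤ stepSum c l := by
  induction l with
  | nil => exact le_rfl
  | cons z l ih =>
    cases l with
    | nil => exact le_rfl
    | cons y l => exact add_nonneg (hc y z) ih

lemma IsReversibleChain.sum_mul_trans {Ω : Type*} [Fintype Ω] {μ : Ω → ℝ}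
    {P : Matrix Ω Ω ℝ} (hP : IsReversibleChain μ P) (k : Ω → ℝ) :
    ∑ i, μ i * ∑ j, P i j * k j = ∑ i, μ i * k i := by
  simp only [Finset.mul_sum, ← mul_assoc]
  rw [Finset.sum_comm]
  refine Finset.sum_congr rfl fun j _ => ?_
  simp only [hP.reversible _ j, ← Finset.sum_mul, ← Finset.mul_sum, hP.sum_trans, mul_one]

lemma reverse_headI_cons_cons {Ω : Type*} [Inhabited Ω] (z y : Ω) (l : List Ω) :
    (z :: y :: l).reverse.headI = (y :: l).reverse.headI := by
  rw [List.reverse_cons (a := z)]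
  cases h : (y :: l).reverse with
  | nil => simp at h
  | cons a l' => rfl

variable {Ω : Type*} [Fintype Ω] [Inhabited Ω] {μ : Ω → ℝ} {P : Matrix Ω Ω ℝ}

/-- The expectation of a functional of the first `T` steps of the Markov chain with initial
distribution `μ` and transition matrix `P`. -/
def pathExp (μ : Ω → ℝ) (P : Matrix Ω Ω ℝ) : ℕ → (List Ω → ℝ) → ℝ
  | 0, G => ∑ i, μ i * G [i]
  | T + 1, G => pathExp μ P T fun l => ∑ j, P l.headI j * G (j :: l)

lemma pathExp_succ (T : ℕ) (G : List Ω → ℝ) :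
    pathExp μ P (T + 1) G = pathExp μ P T fun l => ∑ j, P l.headI j * G (j :: l) := rfl

lemma IsReversibleChain.pathExp_mono (hP : IsReversibleChain μ P) (T : ℕ) {G G' : List Ω → ℝ}
    (h : ∀ z l, G (z :: l) ≤ G' (z :: l)) : pathExp μ P T G ≤ pathExp μ P T G' := by
  induction T generalizing G G' with
  | zero => exact Finset.sum_le_sum fun i _ => mul_le_mul_of_nonneg_left (h i []) (hP.nonneg i)
  | succ T ih =>
    exact ih fun z l => Finset.sum_le_sum fun j _ =>
      mul_le_mul_of_nonneg_left (h j _) (hP.trans_nonneg _ _)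

lemma IsReversibleChain.pathExp_congr (hP : IsReversibleChain μ P) (T : ℕ) {G G' : List Ω → ℝ}
    (h : ∀ z l, G (z :: l) = G' (z :: l)) : pathExp μ P T G = pathExp μ P T G' :=
  (hP.pathExp_mono T fun z l => (h z l).le).antisymm (hP.pathExp_mono T fun z l => (h z l).ge)

lemma pathExp_add (T : ℕ) (G G' : List Ω → ℝ) :
    pathExp μ P T (fun l => G l + G' l) = pathExp μ P T G + pathExp μ P T G' := by
  induction T generalizing G G' with
  | zero => simp only [pathExp, mul_add, Finset.sum_add_distrib]
  | succ T ih => simp only [pathExp, mul_add, Finset.sum_add_distrib, ih]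

lemma pathExp_const_mul (T : ℕ) (a : ℝ) (G : List Ω → ℝ) :
    pathExp μ P T (fun l => a * G l) = a * pathExp μ P T G := by
  induction T generalizing G with
  | zero => simp only [pathExp, mul_left_comm _ a, Finset.mul_sum]
  | succ T ih => simp only [pathExp, mul_left_comm _ a, ← Finset.mul_sum, ih]

lemma pathExp_sum {ι : Type*} (s : Finset ι) (T : ℕ) (G : ι → List Ω → ℝ) :
    pathExp μ P T (fun l => ∑ k ∈ s, G k l) = ∑ k ∈ s, pathExp μ P T (G k) := by
  induction s using Finset.induction_on with
  | empty => simpa using pathExp_const_mul (μ := μ) (P := P) T 0 0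
  | insert a s ha ih => simp only [Finset.sum_insert ha, pathExp_add, ih]

lemma IsReversibleChain.pathExp_headI (hP : IsReversibleChain μ P) (T : ℕ) (k : Ω → ℝ) :
    pathExp μ P T (fun l => k l.headI) = ∑ i, μ i * k i := by
  induction T generalizing k with
  | zero => rfl
  | succ T ih =>
    rw [pathExp_succ]
    simp only [List.headI_cons]
    rw [ih fun z => ∑ j, P z j * k j, hP.sum_mul_trans]

lemma IsReversibleChain.pathExp_stepSum (hP : IsReversibleChain μ P) (T : ℕ) (c : Ω → Ω → ℝ) :
    pathExp μ P T (stepSum c) = T * ∑ i, ∑ j, μ i * P i j * c i j := by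
  induction T with
  | zero => simp [pathExp, stepSum]
  | succ T ih =>
    have h : ∀ z l, ∑ j, P (z :: l).headI j * stepSum c (j :: z :: l) =
        (fun i => ∑ j, P i j * c i j) (z :: l).headI + stepSum c (z :: l) := fun z l => by
      simp only [stepSum_cons_cons, mul_add, Finset.sum_add_distrib, ← Finset.sum_mul, hP.sum_trans,
        one_mul, List.headI_cons]
    rw [pathExp_succ, hP.pathExp_congr T (G' := fun l => (fun i => ∑ j, P i j * c i j) l.headI +
      stepSum c l) h, pathExp_add,
      hP.pathExp_headI T fun i => ∑ j, P i j * c i j, ih]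
    have h' : ∑ i, μ i * ∑ j, P i j * c i j = ∑ i, ∑ j, μ i * P i j * c i j := by
      simp only [Finset.mul_sum, mul_assoc]
    rw [h']
    push_cast
    ring

lemma IsReversibleChain.pathExp_endpoints [DecidableEq Ω] (hP : IsReversibleChain μ P) (T : ℕ)
    (g : Ω → Ω → ℝ) : pathExp μ P T (fun l => g l.reverse.headI l.headI) =
      ∑ i, ∑ j, μ i * (P ^ T) i j * g i j := by
  induction T generalizing g with
  | zero => simp [pathExp, Matrix.one_apply]
  | succ T ih =>
    have h : ∀ z l, ∑ j, P (z :: l).headI j * g (j :: z :: l).reverse.headI (j :: z :: l).headI =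
        (fun a b => ∑ j, P b j * g a j) (z :: l).reverse.headI (z :: l).headI := fun z l => by
      simp only [reverse_headI_cons_cons, List.headI_cons]
    rw [pathExp_succ, hP.pathExp_congr T
      (G' := fun l => (fun a b => ∑ j, P b j * g a j) l.reverse.headI l.headI) h, ih fun a b => ∑ j, P b j * g a j]
    refine Finset.sum_congr rfl fun i _ => ?_
    simp only [pow_succ, Matrix.mul_apply, Finset.mul_sum, Finset.sum_mul]
    rw [Finset.sum_comm]
    exact Finset.sum_congr rfl fun _ _ => Finset.sum_congr rfl fun _ _ => by ring

lemma IsReversibleChain.pathExp_succ_append (hP : IsReversibleChain μ P) (T : ℕ)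
    (G : List Ω → ℝ) : pathExp μ P (T + 1) G =
      pathExp μ P T fun l => ∑ j, P l.reverse.headI j * G (l ++ [j]) := by
  induction T generalizing G with
  | zero =>
    simp only [pathExp, List.headI_cons, List.reverse_singleton, Finset.mul_sum, ← mul_assoc,
      List.singleton_append]
    rw [Finset.sum_comm]
    simp only [hP.reversible]
  | succ T ih =>
    rw [pathExp_succ, ih, pathExp_succ]
    refine hP.pathExp_congr T fun z l => ?_
    simp only [reverse_headI_cons_cons, List.cons_append, List.headI_cons, Finset.mul_sum]
    rw [Finset.sum_comm]
    exact Finset.sum_congr rfl fun _ _ => Finset.sum_congr rfl fun _ _ => mul_left_comm _ _ _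

lemma IsReversibleChain.pathExp_reverse (hP : IsReversibleChain μ P) (T : ℕ) (G : List Ω → ℝ) :
    pathExp μ P T (fun l => G l.reverse) = pathExp μ P T G := by
  induction T generalizing G with
  | zero => rfl
  | succ T ih =>
    rw [hP.pathExp_succ_append, ← ih, pathExp_succ]
    simp only [List.reverse_append, List.reverse_singleton, List.reverse_reverse,
      List.singleton_append]

end PathExpectation

section TruncatedMartingale

variable {E : Type*} [NormedAddCommGroup E]

/-- The sum of the increments `ξ` along a path, where the steps that would make the accumulated
conditional variance `v` exceed `1` are skipped, together with the accumulated variance. -/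
def skipSum {Ω : Type*} (ξ : Ω → Ω → E) (v : Ω → ℝ) : List Ω → E × ℝ
  | [] => (0, 0)
  | [_] => (0, 0)
  | z :: y :: l =>
    if (skipSum ξ v (y :: l)).2 + v y ≤ 1 then
      ((skipSum ξ v (y :: l)).1 + ξ y z, (skipSum ξ v (y :: l)).2 + v y)
    else skipSum ξ v (y :: l)

lemma skipSum_cons_cons {Ω : Type*} (ξ : Ω → Ω → E) (v : Ω → ℝ) (z y : Ω) (l : List Ω) :
    skipSum ξ v (z :: y :: l) = if (skipSum ξ v (y :: l)).2 + v y ≤ 1 then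
      ((skipSum ξ v (y :: l)).1 + ξ y z, (skipSum ξ v (y :: l)).2 + v y)
    else skipSum ξ v (y :: l) := rfl

lemma skipSum_snd_nonneg {Ω : Type*} (ξ : Ω → Ω → E) {v : Ω → ℝ} (hv : ∀ i, 0 ≤ v i)
    (l : List Ω) : 0 ≤ (skipSum ξ v l).2 := by
  induction l with
  | nil => exact le_rfl
  | cons z l ih =>
    cases l with
    | nil => exact le_rfl
    | cons y l =>
      rw [skipSum_cons_cons]
      split_ifs
      · exact add_nonneg ih (hv y)
      · exact ih

lemma skipSum_snd_le_one {Ω : Type*} (ξ : Ω → Ω → E) (v : Ω → ℝ) (l : List Ω) :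
    (skipSum ξ v l).2 ≤ 1 := by
  induction l with
  | nil => exact zero_le_one
  | cons z l ih =>
    cases l with
    | nil => exact zero_le_one
    | cons y l =>
      rw [skipSum_cons_cons]
      split_ifs with h
      · exact h
      · exact ih

lemma skipSum_snd_le {Ω : Type*} (ξ : Ω → Ω → E) {v : Ω → ℝ} (hv : ∀ i, 0 ≤ v i)
    (l : List Ω) : (skipSum ξ v l).2 ≤ stepSum (fun y _ => v y) l := by
  induction l with
  | nil => exact le_rfl
  | cons z l ih =>
    cases l with
    | nil => exact le_rfl
    | cons y l =>
      rw [skipSum_cons_cons, stepSum_cons_cons]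
      split_ifs
      · simp only; linarith
      · linarith [hv y]

variable [InnerProductSpace ℝ E]

lemma norm_add_pow_four_le (a x : E) :
    ‖a + x‖ ^ 4 ≤ ‖a‖ ^ 4 + 4 * ‖a‖ ^ 2 * inner ℝ a x + 8 * ‖a‖ ^ 2 * ‖x‖ ^ 2 + 3 * ‖x‖ ^ 4 := by
  have h1 : ‖a + x‖ ^ 4 = (‖a‖ ^ 2 + 2 * inner ℝ a x + ‖x‖ ^ 2) ^ 2 := by
    rw [← norm_add_sq_real]; ring
  have h2 := abs_le.1 (abs_real_inner_le_norm a x)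
  have h3 : (inner ℝ a x : ℝ) ^ 2 ≤ ‖a‖ ^ 2 * ‖x‖ ^ 2 := by
    rw [← mul_pow]; exact sq_le_sq' h2.1 h2.2
  have h4 : (inner ℝ a x : ℝ) * ‖x‖ ^ 2 ≤ ‖a‖ * ‖x‖ * ‖x‖ ^ 2 :=
    mul_le_mul_of_nonneg_right h2.2 (sq_nonneg _)
  rw [h1]
  nlinarith [sq_nonneg (‖a‖ * ‖x‖ - ‖x‖ ^ 2)]

variable {Ω : Type*} [Fintype Ω] {μ : Ω → ℝ} {P : Matrix Ω Ω ℝ}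

lemma IsReversibleChain.norm_sum_smul_sq_le (hP : IsReversibleChain μ P) (n : ℕ) (y : Ω)
    (u : Ω → E) : ‖∑ j, P y j • u j‖ ^ n ≤ ∑ j, P y j * ‖u j‖ ^ n := by
  refine (pow_le_pow_left₀ (norm_nonneg _) (norm_sum_le _ _) n).trans ?_
  simp only [norm_smul, Real.norm_of_nonneg (hP.trans_nonneg y _)]
  exact Real.pow_arith_mean_le_arith_mean_pow _ _ _ (fun j _ => hP.trans_nonneg y j)
    (hP.sum_trans y) (fun j _ => norm_nonneg _) n

lemma IsReversibleChain.sum_smul_sub_mean (hP : IsReversibleChain μ P) (y : Ω) (u : Ω → E) :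
    ∑ j, P y j • (u j - ∑ k, P y k • u k) = 0 := by
  simp only [smul_sub, Finset.sum_sub_distrib, ← Finset.sum_smul, hP.sum_trans, one_smul, sub_self]

lemma IsReversibleChain.sum_norm_sub_mean_sq_le (hP : IsReversibleChain μ P) (y : Ω) (u : Ω → E) :
    ∑ j, P y j * ‖u j - ∑ k, P y k • u k‖ ^ 2 ≤ ∑ j, P y j * ‖u j‖ ^ 2 := by
  set m := ∑ k, P y k • u k with hm
  have h1 : ∑ j, P y j * inner ℝ (u j) m = ‖m‖ ^ 2 := by
    have : inner ℝ (∑ k, P y k • u k) m = ∑ j, P y j * inner ℝ (u j) m := by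
      simp only [sum_inner, real_inner_smul_left]
    rw [← real_inner_self_eq_norm_sq, ← this]
  have h2 : ∑ j, P y j * ‖u j - m‖ ^ 2 = ∑ j, P y j * ‖u j‖ ^ 2 - ‖m‖ ^ 2 := by
    simp only [norm_sub_sq_real, mul_add, mul_sub, Finset.sum_add_distrib, Finset.sum_sub_distrib,
      mul_left_comm _ (2 : ℝ), ← Finset.mul_sum, h1, ← Finset.sum_mul, hP.sum_trans]
    ring
  rw [h2]
  linarith [sq_nonneg ‖m‖]

lemma IsReversibleChain.sum_norm_sub_mean_pow_four_le (hP : IsReversibleChain μ P) (y : Ω)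
    (u : Ω → E) :
    ∑ j, P y j * ‖u j - ∑ k, P y k • u k‖ ^ 4 ≤ 16 * ∑ j, P y j * ‖u j‖ ^ 4 := by
  set m := ∑ k, P y k • u k with hm
  have h1 : ∀ j, ‖u j - m‖ ^ 4 ≤ 8 * ‖u j‖ ^ 4 + 8 * ‖m‖ ^ 4 := fun j => by
    refine (pow_le_pow_left₀ (norm_nonneg _) (norm_sub_le _ _) 4).trans ?_
    have := add_pow_le (norm_nonneg (u j)) (norm_nonneg m) 4
    norm_num at this
    linarith
  have h2 : ∑ j, P y j * ‖u j - m‖ ^ 4 ≤ ∑ j, P y j * (8 * ‖u j‖ ^ 4 + 8 * ‖m‖ ^ 4) :=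
    Finset.sum_le_sum fun j _ => mul_le_mul_of_nonneg_left (h1 j) (hP.trans_nonneg y j)
  simp only [mul_add, Finset.sum_add_distrib, mul_left_comm _ (8 : ℝ), ← Finset.mul_sum,
    ← Finset.sum_mul, hP.sum_trans] at h2
  linarith [hP.norm_sum_smul_sq_le 4 y u]

lemma IsReversibleChain.pathExp_skipSum_le [Inhabited Ω] (hP : IsReversibleChain μ P)
    {ξ : Ω → Ω → E} {v g : Ω → ℝ} (hv : ∀ i, 0 ≤ v i) (hg : ∀ i, 0 ≤ g i)
    (h1 : ∀ y, ∑ j, P y j • ξ y j = 0) (h2 : ∀ y, ∑ j, P y j * ‖ξ y j‖ ^ 2 ≤ v y)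
    (h4 : ∀ y, ∑ j, P y j * ‖ξ y j‖ ^ 4 ≤ 16 * g y) (T : ℕ) :
    pathExp μ P T (fun l => ‖(skipSum ξ v l).1‖ ^ 4 -
      8 * (skipSum ξ v l).2 * ‖(skipSum ξ v l).1‖ ^ 2 - 48 * stepSum (fun y _ => g y) l) ≤ 0 := by
  induction T with
  | zero => simp [pathExp, skipSum, stepSum]
  | succ T ih =>
    refine le_trans ?_ ih
    rw [pathExp_succ]
    refine hP.pathExp_mono T fun y l => ?_
    simp only [List.headI_cons, skipSum_cons_cons, stepSum_cons_cons]
    set N := (skipSum ξ v (y :: l)).1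
    set U := (skipSum ξ v (y :: l)).2
    set G := stepSum (fun y _ => g y) (y :: l)
    have hU : 0 ≤ U := skipSum_snd_nonneg ξ hv _
    split_ifs with hc
    · have hin : ∑ j, P y j * inner ℝ N (ξ y j) = 0 := by
        simp only [← real_inner_smul_right]
        rw [← inner_sum, h1, inner_zero_right]
      have hj : ∀ j, ‖N + ξ y j‖ ^ 4 - 8 * (U + v y) * ‖N + ξ y j‖ ^ 2 - 48 * (g y + G) ≤
          (‖N‖ ^ 4 - 8 * (U + v y) * ‖N‖ ^ 2 - 48 * (g y + G)) +
          (4 * ‖N‖ ^ 2 - 16 * (U + v y)) * inner ℝ N (ξ y j) + 8 * ‖N‖ ^ 2 * ‖ξ y j‖ ^ 2 +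
          3 * ‖ξ y j‖ ^ 4 := fun j => by
        have := norm_add_pow_four_le N (ξ y j)
        rw [norm_add_sq_real]
        nlinarith [mul_nonneg (add_nonneg hU (hv y)) (sq_nonneg ‖ξ y j‖)]
      refine (Finset.sum_le_sum fun j _ =>
        mul_le_mul_of_nonneg_left (hj j) (hP.trans_nonneg y j)).trans ?_
      simp only [mul_add (P y _), Finset.sum_add_distrib, mul_left_comm (P y _), ← Finset.mul_sum,
        hin, mul_comm (P y _) (_ - _ - _), hP.sum_trans]
      nlinarith [h4 y, mul_le_mul_of_nonneg_left (h2 y) (sq_nonneg ‖N‖)]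
    · rw [← Finset.sum_mul, hP.sum_trans, one_mul]
      linarith [hg y]

end TruncatedMartingale

section TailBound

/-- The truncated square `min 1 (x ^ 2)`. -/
def truncSq (x : ℝ) : ℝ := min 1 (x ^ 2)

lemma truncSq_nonneg (x : ℝ) : 0 ≤ truncSq x := le_min zero_le_one (sq_nonneg x)

lemma truncSq_of_one_le {x : ℝ} (h : 1 ≤ x) : truncSq x = 1 := min_eq_left (by nlinarith)

variable {E Ω : Type*} [NormedAddCommGroup E] {d : Ω → Ω → ℝ} {h : Ω → E}

/-- The increments of `h` along steps of size at most `1`. -/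
def smallStep (d : Ω → Ω → ℝ) (h : Ω → E) (y z : Ω) : E := if d y z ≤ 1 then h z - h y else 0

lemma norm_smallStep_le (hd : ∀ i j, ‖h i - h j‖ ≤ d j i) (y z : Ω) : ‖smallStep d h y z‖ ≤ d y z := by
  unfold smallStep
  split_ifs
  · exact hd z y
  · rw [norm_zero]
    exact (norm_nonneg _).trans (hd z y)

lemma norm_smallStep_pow_four_le (hd : ∀ i j, ‖h i - h j‖ ≤ d j i) (y z : Ω) :
    ‖smallStep d h y z‖ ^ 4 ≤ truncSq (d y z ^ 2) := by
  have h1 : ‖smallStep d h y z‖ ≤ 1 := by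
    unfold smallStep
    split_ifs with h1
    · exact (hd z y).trans h1
    · simp
  refine le_min (pow_le_one₀ (norm_nonneg _) h1) ?_
  rw [← pow_mul]
  exact pow_le_pow_left₀ (norm_nonneg _) (norm_smallStep_le hd y z) 4

variable [InnerProductSpace ℝ E] [Fintype Ω] {μ : Ω → ℝ} {P : Matrix Ω Ω ℝ}

/-- The mean square size of a step starting at `y`. -/
def stepVar (P : Matrix Ω Ω ℝ) (d : Ω → Ω → ℝ) (y : Ω) : ℝ := ∑ j, P y j * d y j ^ 2

/-- The small increments of `h`, centred with respect to the transition probabilities. -/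
def centredStep (P : Matrix Ω Ω ℝ) (d : Ω → Ω → ℝ) (h : Ω → E) (y z : Ω) : E :=
  smallStep d h y z - ∑ k, P y k • smallStep d h y k

lemma IsReversibleChain.stepVar_nonneg (hP : IsReversibleChain μ P) (d : Ω → Ω → ℝ) (y : Ω) :
    0 ≤ stepVar P d y :=
  Finset.sum_nonneg fun j _ => mul_nonneg (hP.trans_nonneg y j) (sq_nonneg _)

lemma IsReversibleChain.norm_sub_centredStep_le (hP : IsReversibleChain μ P)
    (hd : ∀ i j, ‖h i - h j‖ ≤ d j i) (y z : Ω) (hz : d y z ≤ 1) :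
    ‖h z - ∑ k, P y k • h k - centredStep P d h y z‖ ≤ stepVar P d y := by
  have h1 : h z - ∑ k, P y k • h k - centredStep P d h y z =
      -∑ k, P y k • (h k - h y - smallStep d h y k) := by
    simp only [smul_sub, Finset.sum_sub_distrib, ← Finset.sum_smul, hP.sum_trans, one_smul,
      centredStep]
    rw [smallStep, if_pos hz]
    abel
  rw [h1, norm_neg]
  refine (norm_sum_le _ _).trans (Finset.sum_le_sum fun k _ => ?_)
  rw [norm_smul, Real.norm_of_nonneg (hP.trans_nonneg y k)]
  refine mul_le_mul_of_nonneg_left ?_ (hP.trans_nonneg y k)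
  unfold smallStep
  split_ifs with hk
  · simp [sq_nonneg]
  · rw [sub_zero]
    have := hd k y
    nlinarith

lemma IsReversibleChain.skipSum_centredStep (hP : IsReversibleChain μ P)
    (hd : ∀ i j, ‖h i - h j‖ ≤ d j i) (l : List Ω)
    (hV : stepSum (fun y _ => stepVar P d y) l ≤ 1)
    (hJ : stepSum (fun y z => truncSq (d y z ^ 2)) l < 1) :
    (skipSum (centredStep P d h) (stepVar P d) l).2 = stepSum (fun y _ => stepVar P d y) l ∧
    ‖stepSum (fun y z => h z - ∑ k, P y k • h k) l -
      (skipSum (centredStep P d h) (stepVar P d) l).1‖ ≤ stepSum (fun y _ => stepVar P d y) l := by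
  induction l with
  | nil => simp [skipSum, stepSum]
  | cons z l ih =>
    cases l with
    | nil => simp [skipSum, stepSum]
    | cons y l =>
      simp only [stepSum_cons_cons] at hV hJ ⊢
      have hJ0 : 0 ≤ stepSum (fun y z => truncSq (d y z ^ 2)) (y :: l) :=
        stepSum_nonneg (fun _ _ => truncSq_nonneg _) _
      have hz : d y z ≤ 1 := by
        by_contra! hz
        rw [truncSq_of_one_le (by nlinarith)] at hJ
        linarith
      obtain ⟨h1, h2⟩ := ih (by linarith [hP.stepVar_nonneg d y])
        (by linarith [truncSq_nonneg (d y z ^ 2)])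
      rw [skipSum_cons_cons, if_pos (by rw [h1]; linarith)]
      refine ⟨(congrArg (· + stepVar P d y) h1).trans (add_comm _ _), ?_⟩
      simp only
      rw [add_comm (skipSum _ _ _).1, add_sub_add_comm]
      exact norm_add_le_of_le (hP.norm_sub_centredStep_le hd y z hz) h2

lemma IsReversibleChain.pathExp_norm_stepSum_le [Inhabited Ω] (hP : IsReversibleChain μ P)
    (hd : ∀ i j, ‖h i - h j‖ ≤ d j i) (T : ℕ) :
    pathExp μ P T (fun l => if 2 ≤ ‖stepSum (fun y z => h z - ∑ k, P y k • h k) l‖ then 1 else 0) ≤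
      65 * pathExp μ P T (fun l => truncSq (stepSum (fun y _ => stepVar P d y) l)) +
      97 * (T * ∑ i, ∑ j, μ i * P i j * truncSq (d i j ^ 2)) := by
  set ξ := centredStep P d h with hξ
  set v := stepVar P d with hv
  set g : Ω → ℝ := fun y => ∑ j, P y j * truncSq (d y j ^ 2) with hg
  have hv0 : ∀ i, 0 ≤ v i := hP.stepVar_nonneg d
  have hg0 : ∀ i, 0 ≤ g i := fun i => Finset.sum_nonneg fun j _ =>
    mul_nonneg (hP.trans_nonneg i j) (truncSq_nonneg _)
  have key := hP.pathExp_skipSum_le (ξ := ξ) hv0 hg0 (fun y => hP.sum_smul_sub_mean y _)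
    (fun y => (hP.sum_norm_sub_mean_sq_le y _).trans (Finset.sum_le_sum fun j _ =>
      mul_le_mul_of_nonneg_left (pow_le_pow_left₀ (norm_nonneg _) (norm_smallStep_le hd y j) 2)
        (hP.trans_nonneg y j)))
    (fun y => (hP.sum_norm_sub_mean_pow_four_le y _).trans (mul_le_mul_of_nonneg_left
      (Finset.sum_le_sum fun j _ => mul_le_mul_of_nonneg_left (norm_smallStep_pow_four_le hd y j)
        (hP.trans_nonneg y j)) (by norm_num))) T
  set Φ : List Ω → ℝ := fun l => ‖(skipSum ξ v l).1‖ ^ 4 -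
    8 * (skipSum ξ v l).2 * ‖(skipSum ξ v l).1‖ ^ 2 - 48 * stepSum (fun y _ => g y) l with hΦ
  have hpt : ∀ l : List Ω,
      (if 2 ≤ ‖stepSum (fun y z => h z - ∑ k, P y k • h k) l‖ then (1 : ℝ) else 0) ≤
      (65 * truncSq (stepSum (fun y _ => v y) l) + stepSum (fun y z => truncSq (d y z ^ 2)) l) +
      (2 * Φ l + 96 * stepSum (fun y _ => g y) l) := by
    intro l
    have hU0 := skipSum_snd_nonneg ξ hv0 l
    have hU1 := skipSum_snd_le_one ξ v l
    have hUV := skipSum_snd_le ξ hv0 l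
    have hJ0 : 0 ≤ stepSum (fun y z => truncSq (d y z ^ 2)) l :=
      stepSum_nonneg (fun _ _ => truncSq_nonneg _) _
    have hUsq : (skipSum ξ v l).2 ^ 2 ≤ truncSq (stepSum (fun y _ => v y) l) :=
      le_min (pow_le_one₀ hU0 hU1) (pow_le_pow_left₀ hU0 hUV 2)
    have hN : ‖(skipSum ξ v l).1‖ ^ 4 ≤ 64 * truncSq (stepSum (fun y _ => v y) l) +
        (2 * Φ l + 96 * stepSum (fun y _ => g y) l) := by
      simp only [hΦ]
      nlinarith [sq_nonneg (‖(skipSum ξ v l).1‖ ^ 2 - 8 * (skipSum ξ v l).2)]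
    have hN0 : 0 ≤ ‖(skipSum ξ v l).1‖ ^ 4 := by positivity
    have hV0 := truncSq_nonneg (stepSum (fun y _ => v y) l)
    split_ifs with hM
    · by_cases hJ : stepSum (fun y z => truncSq (d y z ^ 2)) l < 1
      · by_cases hV : stepSum (fun y _ => v y) l ≤ 1
        · obtain ⟨-, h2⟩ := hP.skipSum_centredStep hd l hV hJ
          have h3 : 1 ≤ ‖(skipSum ξ v l).1‖ := by
            have := norm_le_norm_add_norm_sub' (stepSum (fun y z => h z - ∑ k, P y k • h k) l)
              (skipSum ξ v l).1
            linarith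
          have : 1 ≤ ‖(skipSum ξ v l).1‖ ^ 4 := one_le_pow₀ h3
          linarith
        · rw [truncSq_of_one_le (not_le.1 hV).le] at hN ⊢
          linarith
      · linarith
    · linarith
  refine (hP.pathExp_mono T (G' := fun l => (65 * truncSq (stepSum (fun y _ => v y) l) +
    stepSum (fun y z => truncSq (d y z ^ 2)) l) + (2 * Φ l + 96 * stepSum (fun y _ => g y) l))
    fun z l => hpt (z :: l)).trans ?_
  rw [pathExp_add, pathExp_add, pathExp_add, pathExp_const_mul, pathExp_const_mul,
    pathExp_const_mul, hP.pathExp_stepSum, hP.pathExp_stepSum]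
  have hG : ∑ i, ∑ j, μ i * P i j * g i = ∑ i, ∑ j, μ i * P i j * truncSq (d i j ^ 2) := by
    refine Finset.sum_congr rfl fun i _ => ?_
    rw [← Finset.sum_mul, ← Finset.mul_sum, hP.sum_trans, mul_one, hg, Finset.mul_sum]
    exact Finset.sum_congr rfl fun _ _ => (mul_assoc _ _ _).symm
  rw [hG]
  linarith

end TailBound

section MultiScale

lemma sum_truncSq_le {x : ℝ} (hx : 0 ≤ x) (n : ℕ) {a : ℝ} (ha : 0 < a) :
    ∑ k ∈ Finset.range n, a * 4 ^ k * truncSq (x / (a * 4 ^ k)) ≤ 3 * x := by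
  have key : ∀ (n : ℕ) (a : ℝ), 0 < a →
      (x ≤ a → ∑ k ∈ Finset.range n, a * 4 ^ k * truncSq (x / (a * 4 ^ k)) ≤ 4 / 3 * (x ^ 2 / a)) ∧
      (a ≤ x → ∑ k ∈ Finset.range n, a * 4 ^ k * truncSq (x / (a * 4 ^ k)) ≤ 3 * x - a / 3) := by
    intro n
    induction n with
    | zero =>
      intro a ha
      simp only [Finset.range_zero, Finset.sum_empty]
      exact ⟨fun _ => by positivity, fun h => by linarith⟩
    | succ n ih =>
      intro a ha
      have hs : ∑ k ∈ Finset.range (n + 1), a * 4 ^ k * truncSq (x / (a * 4 ^ k)) =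
          ∑ k ∈ Finset.range n, 4 * a * 4 ^ k * truncSq (x / (4 * a * 4 ^ k)) +
            a * truncSq (x / a) := by
        rw [Finset.sum_range_succ']
        simp only [pow_succ, pow_zero, mul_one]
        congr 1
        exact Finset.sum_congr rfl fun k _ => by
          rw [show a * (4 ^ k * 4) = 4 * a * 4 ^ k by ring]
      obtain ⟨h1, h2⟩ := ih (4 * a) (by positivity)
      have hsq : a * truncSq (x / a) ≤ x ^ 2 / a :=
        (mul_le_mul_of_nonneg_left (min_le_right _ _) ha.le).trans_eq (by field_simp)
      have hone : a * truncSq (x / a) ≤ a :=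
        (mul_le_mul_of_nonneg_left (min_le_left _ _) ha.le).trans_eq (mul_one a)
      have hdiv : x ^ 2 / (4 * a) = x ^ 2 / a / 4 := by rw [mul_comm, div_div]
      rw [hs]
      refine ⟨fun hxa => ?_, fun hax => ?_⟩
      · have := h1 (by linarith)
        rw [hdiv] at this
        linarith
      · rcases le_total x (4 * a) with h | h
        · have h3 := h1 h
          have h4 : x ^ 2 / (4 * a) ≤ 3 / 4 * (3 * x - 4 / 3 * a) := by
            rw [div_le_iff₀ (by positivity)]
            nlinarith [mul_nonneg (sub_nonneg.2 hax) (sub_nonneg.2 h)]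
          linarith
        · have := h2 h
          linarith
  rcases le_total x a with h | h
  · refine ((key n a ha).1 h).trans ?_
    have : x ^ 2 / a ≤ x := by
      rw [div_le_iff₀ ha]
      nlinarith
    linarith
  · linarith [(key n a ha).2 h]

lemma le_sum_indicator {y a : ℝ} (ha : 0 < a) (n : ℕ) (hy : y < a * 4 ^ n) :
    y ≤ a + 4 * ∑ k ∈ Finset.range n, a * 4 ^ k * if a * 4 ^ k ≤ y then 1 else 0 := by
  induction n with
  | zero => simpa using hy.le
  | succ n ih =>
    have h0 : 0 ≤ ∑ k ∈ Finset.range n, a * 4 ^ k * if a * 4 ^ k ≤ y then (1 : ℝ) else 0 :=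
      Finset.sum_nonneg fun k _ => mul_nonneg (by positivity) (by split_ifs <;> norm_num)
    rw [Finset.sum_range_succ]
    split_ifs with h
    · rw [pow_succ] at hy
      linarith
    · linarith [ih (not_le.1 h)]

lemma IsReversibleChain.pow_nonneg {Ω : Type*} [Fintype Ω] [DecidableEq Ω]
    {μ : Ω → ℝ} {P : Matrix Ω Ω ℝ} (hP : IsReversibleChain μ P) (T : ℕ) :
    ∀ i j, 0 ≤ (P ^ T) i j := by
  induction T with
  | zero =>
    intro i j
    rw [pow_zero, Matrix.one_apply]
    split_ifs <;> norm_num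
  | succ T ih =>
    intro i j
    rw [pow_succ, Matrix.mul_apply]
    exact Finset.sum_nonneg fun k _ => mul_nonneg (ih i k) (hP.trans_nonneg k j)

variable {E Ω : Type*} [NormedAddCommGroup E] [InnerProductSpace ℝ E]
  [Fintype Ω] [Inhabited Ω] {μ : Ω → ℝ} {P : Matrix Ω Ω ℝ} {d : Ω → Ω → ℝ}
  {h : Ω → E}

lemma two_smul_sub_eq (l : List Ω) (z : Ω) :
    (2 : ℝ) • (h (z :: l).headI - h (z :: l).reverse.headI) =
      stepSum (fun y z => h z - ∑ k, P y k • h k) (z :: l) -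
      stepSum (fun y z => h z - ∑ k, P y k • h k) (z :: l).reverse +
      (h (z :: l).headI - ∑ k, P (z :: l).headI k • h k) -
      (h (z :: l).reverse.headI - ∑ k, P (z :: l).reverse.headI k • h k) := by
  rw [stepSum_reverse]
  induction l generalizing z with
  | nil => simp [stepSum]
  | cons y l ih =>
    have := ih y
    simp only [reverse_headI_cons_cons, List.headI_cons, stepSum_cons_cons] at this ⊢
    linear_combination (norm := module) this

variable [DecidableEq Ω]

lemma IsReversibleChain.tail_le (hP : IsReversibleChain μ P) (hd : ∀ i j, ‖h i - h j‖ ≤ d j i)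
    {C : ℝ} (hC : ∀ i j, C ≤ d i j → 4 ≤ ‖h j - h i‖) (T : ℕ) :
    ∑ i, ∑ j, μ i * (P ^ T) i j * (if C ≤ d i j then 1 else 0) ≤
      130 * pathExp μ P T (fun l => truncSq (stepSum (fun y _ => stepVar P d y) l)) +
      194 * (T * ∑ i, ∑ j, μ i * P i j * truncSq (d i j ^ 2)) +
      2 * ∑ i, μ i * truncSq (stepVar P d i) := by
  set c : Ω → Ω → E := fun y z => h z - ∑ k, P y k • h k with hc
  set r : Ω → ℝ := fun y => if 2 ≤ ‖h y - ∑ k, P y k • h k‖ then 1 else 0 with hr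
  have hr0 : ∀ y, 0 ≤ r y := fun y => by simp only [hr]; split_ifs <;> norm_num
  have hrle : ∀ y, r y ≤ truncSq (stepVar P d y) := by
    intro y
    simp only [hr]
    split_ifs with h2
    · have h3 : h y - ∑ k, P y k • h k = ∑ k, P y k • (h y - h k) := by
        simp only [smul_sub, Finset.sum_sub_distrib, ← Finset.sum_smul, hP.sum_trans, one_smul]
      have h4 : ‖h y - ∑ k, P y k • h k‖ ^ 2 ≤ stepVar P d y := by
        rw [h3]
        refine (hP.norm_sum_smul_sq_le 2 y _).trans (Finset.sum_le_sum fun k _ => ?_)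
        refine mul_le_mul_of_nonneg_left (pow_le_pow_left₀ (norm_nonneg _) ?_ 2)
          (hP.trans_nonneg y k)
        rw [norm_sub_rev]
        exact hd k y
      rw [truncSq_of_one_le (by nlinarith)]
    · exact truncSq_nonneg _
  set A : List Ω → ℝ := fun l => if 2 ≤ ‖stepSum c l‖ then 1 else 0 with hA
  have hA0 : ∀ l, 0 ≤ A l := fun l => by simp only [hA]; split_ifs <;> norm_num
  have hpt : ∀ z l, (fun a b => if C ≤ d a b then (1 : ℝ) else 0) (z :: l).reverse.headI (z :: l).headI ≤
      (A (z :: l) + A (z :: l).reverse) + (r (z :: l).headI + r (z :: l).reverse.headI) := by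
    intro z l
    simp only
    split_ifs with hCd
    · by_contra! hlt
      have h1 := hA0 (z :: l)
      have h2 := hA0 (z :: l).reverse
      have h3 := hr0 (z :: l).headI
      have h4 := hr0 (z :: l).reverse.headI
      have h1' : ‖stepSum c (z :: l)‖ < 2 := by
        by_contra! hh
        linarith [show A (z :: l) = 1 from if_pos hh]
      have h2' : ‖stepSum c (z :: l).reverse‖ < 2 := by
        by_contra! hh
        linarith [show A (z :: l).reverse = 1 from if_pos hh]
      have h3' : ‖h (z :: l).headI - ∑ k, P (z :: l).headI k • h k‖ < 2 := by
        by_contra! hh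
        linarith [show r (z :: l).headI = 1 from if_pos hh]
      have h4' : ‖h (z :: l).reverse.headI - ∑ k, P (z :: l).reverse.headI k • h k‖ < 2 := by
        by_contra! hh
        linarith [show r (z :: l).reverse.headI = 1 from if_pos hh]
      have h5 := congrArg norm (two_smul_sub_eq (P := P) (h := h) l z)
      rw [norm_smul, Real.norm_of_nonneg zero_le_two] at h5
      have h6 := norm_sub_le_of_le (norm_add_le_of_le (norm_sub_le_of_le h1'.le h2'.le) h3'.le) h4'.le
      have h7 := norm_sub_le (stepSum c (z :: l)) (stepSum c (z :: l).reverse)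
      have h8 := norm_add_le (stepSum c (z :: l) - stepSum c (z :: l).reverse)
        (h (z :: l).headI - ∑ k, P (z :: l).headI k • h k)
      have h9 := norm_sub_le (stepSum c (z :: l) - stepSum c (z :: l).reverse +
        (h (z :: l).headI - ∑ k, P (z :: l).headI k • h k))
        (h (z :: l).reverse.headI - ∑ k, P (z :: l).reverse.headI k • h k)
      linarith [hC _ _ hCd]
    · linarith [hA0 (z :: l), hA0 (z :: l).reverse, hr0 (z :: l).headI, hr0 (z :: l).reverse.headI]
  rw [← hP.pathExp_endpoints T fun a b => if C ≤ d a b then (1 : ℝ) else 0]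
  refine (hP.pathExp_mono T (G' := fun l => (A l + A l.reverse) + (r l.headI + r l.reverse.headI))
    hpt).trans ?_
  rw [pathExp_add, pathExp_add, pathExp_add, hP.pathExp_reverse T A,
    hP.pathExp_reverse T fun l => r l.headI, hP.pathExp_headI]
  have h1 := hP.pathExp_norm_stepSum_le hd T
  have h2 : ∑ i, μ i * r i ≤ ∑ i, μ i * truncSq (stepVar P d i) :=
    Finset.sum_le_sum fun i _ => mul_le_mul_of_nonneg_left (hrle i) (hP.nonneg i)
  linarith

lemma IsReversibleChain.tail_le_scaled (hP : IsReversibleChain μ P)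
    (hd : ∀ i j, ‖h i - h j‖ ≤ d j i) {C s : ℝ} (hs : 0 < s)
    (hC : ∀ i j, C * s ≤ d i j → 4 * s ≤ ‖h j - h i‖) (T : ℕ) :
    ∑ i, ∑ j, μ i * (P ^ T) i j * (if C * s ≤ d i j then 1 else 0) ≤
      130 * pathExp μ P T (fun l => truncSq (stepSum (fun y _ => stepVar P d y) l / s ^ 2)) +
      194 * (T * ∑ i, ∑ j, μ i * P i j * truncSq (d i j ^ 2 / s ^ 2)) +
      2 * ∑ i, μ i * truncSq (stepVar P d i / s ^ 2) := by
  have hnorm : ∀ i j, ‖s⁻¹ • h i - s⁻¹ • h j‖ = ‖h i - h j‖ / s := fun i j => by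
    rw [← smul_sub, norm_smul, Real.norm_of_nonneg (inv_nonneg.2 hs.le), div_eq_inv_mul]
  have key := hP.tail_le (h := fun i => s⁻¹ • h i) (d := fun i j => d i j / s) (C := C)
    (fun i j => by rw [hnorm]; exact div_le_div_of_nonneg_right (hd i j) hs.le)
    (fun i j hij => by
      rw [le_div_iff₀ hs] at hij
      rw [hnorm, le_div_iff₀ hs]
      exact hC i j hij) T
  have hv : ∀ y, stepVar P (fun i j => d i j / s) y = stepVar P d y / s ^ 2 := fun y => by
    simp only [stepVar, div_pow, Finset.sum_div, mul_div_assoc]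
  have hV : ∀ l, stepSum (fun y _ => stepVar P (fun i j => d i j / s) y) l =
      stepSum (fun y _ => stepVar P d y) l / s ^ 2 := fun l => by
    induction l with
    | nil => simp [stepSum]
    | cons z l ih =>
      cases l with
      | nil => simp [stepSum]
      | cons y l => rw [stepSum_cons_cons, stepSum_cons_cons, ih, hv, add_div]
  simp only [hV] at key
  simp only [hv, div_pow, le_div_iff₀ hs] at key
  exact key

lemma IsReversibleChain.sum_sq_le_of_tail (hP : IsReversibleChain μ P) {C : ℝ} (hC : 0 < C)
    (hd : ∀ i j, 0 ≤ d i j) {T : ℕ} (hT : 1 ≤ T)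
    (htail : ∀ s : ℝ, 0 < s → ∑ i, ∑ j, μ i * (P ^ T) i j * (if C * s ≤ d i j then 1 else 0) ≤
      130 * pathExp μ P T (fun l => truncSq (stepSum (fun y _ => stepVar P d y) l / s ^ 2)) +
      194 * (T * ∑ i, ∑ j, μ i * P i j * truncSq (d i j ^ 2 / s ^ 2)) +
      2 * ∑ i, μ i * truncSq (stepVar P d i / s ^ 2)) :
    ∑ i, ∑ j, μ i * (P ^ T) i j * d i j ^ 2 ≤
      (63 * C) ^ 2 * T * ∑ i, ∑ j, μ i * P i j * d i j ^ 2 := by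
  set S := ∑ i, ∑ j, μ i * P i j * d i j ^ 2 with hS
  have hT' : (1 : ℝ) ≤ T := by exact_mod_cast hT
  have hS0 : 0 ≤ S := Finset.sum_nonneg fun i _ => Finset.sum_nonneg fun j _ =>
    mul_nonneg (mul_nonneg (hP.nonneg i) (hP.trans_nonneg i j)) (sq_nonneg _)
  have hSv : ∑ i, μ i * stepVar P d i = S := by
    simp only [hS, stepVar, Finset.mul_sum, mul_assoc]
  have hw : ∑ i, ∑ j, μ i * (P ^ T) i j = 1 := by
    have := hP.pathExp_endpoints T fun _ _ => 1
    simp only [mul_one] at this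
    rw [← this, hP.pathExp_headI T fun _ => 1]
    simpa using hP.sum_eq_one
  have hw0 : ∀ i j, 0 ≤ μ i * (P ^ T) i j := fun i j =>
    mul_nonneg (hP.nonneg i) (hP.pow_nonneg T i j)
  refine le_of_forall_pos_le_add fun ε hε => ?_
  set a := ε / C ^ 2 with ha'
  have ha : 0 < a := by positivity
  have hε' : C ^ 2 * a = ε := by rw [ha']; field_simp
  obtain ⟨n, hn⟩ : ∃ n : ℕ, ∀ i j, d i j ^ 2 / C ^ 2 < a * 4 ^ n := by
    have : ∀ p : Ω × Ω, ∃ n : ℕ, d p.1 p.2 ^ 2 / C ^ 2 / a < 4 ^ n := fun p =>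
      pow_unbounded_of_one_lt _ (by norm_num)
    choose N hN using this
    refine ⟨Finset.univ.sup N, fun i j => ?_⟩
    rw [← div_lt_iff₀' ha]
    exact (hN (i, j)).trans_le (pow_le_pow_right₀ (by norm_num)
      (Finset.le_sup (f := N) (Finset.mem_univ (i, j))))
  have hscale : ∀ k : ℕ, 0 < a * 4 ^ k := fun k => by positivity
  have htail' : ∀ k : ℕ,
      ∑ i, ∑ j, μ i * (P ^ T) i j * (if a * 4 ^ k ≤ d i j ^ 2 / C ^ 2 then 1 else 0) ≤
      130 * pathExp μ P T (fun l => truncSq (stepSum (fun y _ => stepVar P d y) l / (a * 4 ^ k))) +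
      194 * (T * ∑ i, ∑ j, μ i * P i j * truncSq (d i j ^ 2 / (a * 4 ^ k))) +
      2 * ∑ i, μ i * truncSq (stepVar P d i / (a * 4 ^ k)) := fun k => by
    have h1 := htail (√(a * 4 ^ k)) (Real.sqrt_pos.2 (hscale k))
    rw [Real.sq_sqrt (hscale k).le] at h1
    have h2 : ∀ i j, (C * √(a * 4 ^ k) ≤ d i j) = (a * 4 ^ k ≤ d i j ^ 2 / C ^ 2) := fun i j => by
      rw [eq_iff_iff, ← div_pow, ← Real.sqrt_le_left (div_nonneg (hd i j) hC.le), le_div_iff₀' hC]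
    simp only [h2] at h1
    exact h1
  have hsum := Finset.sum_le_sum fun k (_ : k ∈ Finset.range n) =>
    mul_le_mul_of_nonneg_left (htail' k) (hscale k).le
  have hlow : ∑ i, ∑ j, μ i * (P ^ T) i j * d i j ^ 2 ≤ C ^ 2 * (a + 4 * ∑ k ∈ Finset.range n,
      a * 4 ^ k * ∑ i, ∑ j, μ i * (P ^ T) i j *
        (if a * 4 ^ k ≤ d i j ^ 2 / C ^ 2 then 1 else 0)) := by
    have h1 : ∀ i j, μ i * (P ^ T) i j * d i j ^ 2 ≤ C ^ 2 * (μ i * (P ^ T) i j * a +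
        4 * ∑ k ∈ Finset.range n, a * 4 ^ k * (μ i * (P ^ T) i j *
          (if a * 4 ^ k ≤ d i j ^ 2 / C ^ 2 then 1 else 0))) := fun i j => by
      have h2 := mul_le_mul_of_nonneg_left (le_sum_indicator ha n (hn i j))
        (mul_nonneg (sq_nonneg C) (hw0 i j))
      have h3 : C ^ 2 * (μ i * (P ^ T) i j) * (d i j ^ 2 / C ^ 2) =
          μ i * (P ^ T) i j * d i j ^ 2 := by field_simp
      rw [h3] at h2
      refine h2.trans_eq ?_
      simp only [mul_left_comm (a * 4 ^ _), ← Finset.mul_sum]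
      ring
    have hswap : ∑ k ∈ Finset.range n, a * 4 ^ k * ∑ i, ∑ j, μ i * (P ^ T) i j *
        (if a * 4 ^ k ≤ d i j ^ 2 / C ^ 2 then 1 else 0) =
        ∑ i, ∑ j, ∑ k ∈ Finset.range n, a * 4 ^ k * (μ i * (P ^ T) i j *
          (if a * 4 ^ k ≤ d i j ^ 2 / C ^ 2 then 1 else 0)) := by
      simp only [Finset.mul_sum]
      rw [Finset.sum_comm]
      exact Finset.sum_congr rfl fun i _ => Finset.sum_comm
    refine (Finset.sum_le_sum fun i _ => Finset.sum_le_sum fun j _ => h1 i j).trans_eq ?_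
    have hw' : ∑ i, μ i * ∑ j, (P ^ T) i j = 1 := by simpa only [Finset.mul_sum] using hw
    rw [hswap]
    simp only [← Finset.mul_sum, Finset.sum_add_distrib, ← Finset.sum_mul, hw', one_mul]
  have hV : ∑ k ∈ Finset.range n, a * 4 ^ k *
      pathExp μ P T (fun l => truncSq (stepSum (fun y _ => stepVar P d y) l / (a * 4 ^ k))) ≤
      3 * (T * S) := by
    simp only [← pathExp_const_mul, ← pathExp_sum]
    refine (hP.pathExp_mono T (G' := fun l => 3 * stepSum (fun y _ => stepVar P d y) l)
      fun z l => sum_truncSq_le (stepSum_nonneg (fun y _ => hP.stepVar_nonneg d y) _) n ha).trans ?_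
    rw [pathExp_const_mul, hP.pathExp_stepSum, ← hSv]
    simp only [← Finset.sum_mul, ← Finset.mul_sum, hP.sum_trans, mul_one, le_refl]
  have hJ : ∑ k ∈ Finset.range n, a * 4 ^ k *
      ∑ i, ∑ j, μ i * P i j * truncSq (d i j ^ 2 / (a * 4 ^ k)) ≤ 3 * S := by
    simp only [Finset.mul_sum]
    rw [Finset.sum_comm]
    rw [hS, Finset.mul_sum]
    refine Finset.sum_le_sum fun i _ => ?_
    rw [Finset.sum_comm, Finset.mul_sum]
    refine Finset.sum_le_sum fun j _ => ?_
    simp only [mul_left_comm (a * 4 ^ _), ← Finset.mul_sum]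
    rw [mul_left_comm]
    exact mul_le_mul_of_nonneg_left (sum_truncSq_le (sq_nonneg _) n ha)
      (mul_nonneg (hP.nonneg i) (hP.trans_nonneg i j))
  have hR : ∑ k ∈ Finset.range n, a * 4 ^ k *
      ∑ i, μ i * truncSq (stepVar P d i / (a * 4 ^ k)) ≤ 3 * S := by
    simp only [Finset.mul_sum]
    rw [Finset.sum_comm, ← hSv, Finset.mul_sum]
    refine Finset.sum_le_sum fun i _ => ?_
    simp only [mul_left_comm (a * 4 ^ _), ← Finset.mul_sum]
    rw [mul_left_comm]
    exact mul_le_mul_of_nonneg_left (sum_truncSq_le (hP.stepVar_nonneg d i) n ha) (hP.nonneg i)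
  simp only [mul_add, Finset.sum_add_distrib, mul_left_comm (a * 4 ^ _) (130 : ℝ),
    mul_left_comm (a * 4 ^ _) (194 : ℝ), mul_left_comm (a * 4 ^ _) (2 : ℝ),
    mul_left_comm (a * 4 ^ _) (T : ℝ), ← Finset.mul_sum] at hsum
  have hTJ := mul_le_mul_of_nonneg_left hJ (zero_le_one.trans hT')
  have hST : S ≤ T * S := le_mul_of_one_le_left hS0 hT'
  refine hlow.trans ?_
  have hfin : ∑ k ∈ Finset.range n, a * 4 ^ k * ∑ i, ∑ j, μ i * (P ^ T) i j *
      (if a * 4 ^ k ≤ d i j ^ 2 / C ^ 2 then 1 else 0) ≤ 978 * (T * S) := by linarith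
  have hTS : 0 ≤ T * S := by positivity
  nlinarith [mul_le_mul_of_nonneg_left hfin (sq_nonneg C), mul_nonneg (sq_nonneg C) hTS]

end MultiScale

section NagataMarkov

lemma exists_euclidean_of_nagataDimD {Y : Type*} [PseudoMetricSpace Y] {n : ℕ} {γ : ℝ}
    (hN : NagataDimD (dist : Y → Y → ℝ) n γ) {Ω : Type*} [Finite Ω] (f : Ω → Y) {r : ℝ}
    (hr : 0 < r) :
    ∃ (F : Finset (Set Y)) (h : Ω → EuclideanSpace ℝ F),
      (∀ i j, ‖h i - h j‖ ≤ dist (f j) (f i)) ∧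
      ∀ i j, (max γ 0 + 1) * r ≤ dist (f i) (f j) → r / (3 * √(2 * (n + 1))) ≤ ‖h j - h i‖ := by
  obtain ⟨B, hcov, hdiam, hmult⟩ := hN r hr
  have hr3 : 0 < r / 3 := by positivity
  have hball : ∀ y : Y, {b | b ∈ B ∧ (b ∩ ball y (r / 3)).Nonempty}.encard ≤ (n : ℕ∞) + 1 :=
    fun y => hmult _ <| lt_of_le_of_lt
      (ediamD_le fun x hx z hz => by
        rw [mem_ball] at hx hz
        have := dist_triangle_right x z y
        show dist x z ≤ 2 * (r / 3)
        linarith)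
      ((ENNReal.ofReal_lt_ofReal_iff hr).2 (by linarith))
  have hfin : (⋃ i, {b | b ∈ B ∧ (b ∩ ball (f i) (r / 3)).Nonempty}).Finite :=
    Set.finite_iUnion fun i => Set.finite_of_encard_le_coe (k := n + 1) (by exact_mod_cast hball (f i))
  set N : ℝ := √(2 * (n + 1)) with hNdef
  have hN0 : 0 < N := Real.sqrt_pos.2 (by positivity)
  have hNsq : N ^ 2 = 2 * (n + 1) := Real.sq_sqrt (by positivity)
  set ψ : Set Y → Y → ℝ := fun b y => max 0 (r / 3 - infDist y b) with hψ
  have hψL : ∀ b y z, |ψ b y - ψ b z| ≤ dist y z := fun b y z => by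
    have h1 := infDist_le_infDist_add_dist (s := b) (x := y) (y := z)
    have h2 := infDist_le_infDist_add_dist (s := b) (x := z) (y := y)
    rw [dist_comm z y] at h2
    refine (abs_max_sub_max_le_max _ _ _ _).trans ?_
    rw [sub_self, abs_zero]
    exact max_le dist_nonneg (abs_le.2 ⟨by linarith, by linarith⟩)
  have hψ0 : ∀ b ∈ hfin.toFinset, ∀ y, ¬ (b ∩ ball y (r / 3)).Nonempty → ψ b y = 0 := by
    intro b hb y hby
    simp only [Set.Finite.mem_toFinset, Set.mem_iUnion] at hb
    obtain ⟨i, -, hne⟩ := hb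
    refine max_eq_left (sub_nonpos.2 ((le_infDist (hne.mono inter_subset_left)).2 fun z hz => ?_))
    by_contra! hlt
    exact hby ⟨z, hz, by rwa [mem_ball, dist_comm]⟩
  refine ⟨hfin.toFinset, fun i => WithLp.toLp 2 fun b => ψ b (f i) / N, fun i j => ?_,
    fun i j hij => ?_⟩
  · refine (sq_le_sq₀ (norm_nonneg _) dist_nonneg).1 ?_
    rw [EuclideanSpace.real_norm_sq_eq]
    set S : Ω → Finset hfin.toFinset := fun i =>
      Finset.univ.filter fun b => ((b : Set Y) ∩ ball (f i) (r / 3)).Nonempty with hS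
    have hcard : ∀ i, (S i).card ≤ n + 1 := fun i => by
      have h1 : ((S i).map (Function.Embedding.subtype _) : Set (Set Y)) ⊆
          {b | b ∈ B ∧ (b ∩ ball (f i) (r / 3)).Nonempty} := by
        intro b hb
        simp only [hS, Finset.coe_map, Set.mem_image, Finset.mem_coe, Finset.mem_filter] at hb
        obtain ⟨b, ⟨-, hb⟩, rfl⟩ := hb
        obtain ⟨k, hk⟩ := Set.mem_iUnion.1 (hfin.mem_toFinset.1 b.2)
        exact ⟨hk.1, hb⟩
      have h2 := (Set.encard_le_encard h1).trans (hball (f i))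
      rw [Set.encard_coe_eq_coe_finsetCard, Finset.card_map] at h2
      exact_mod_cast h2
    have hcardU : ((S i ∪ S j).card : ℝ) ≤ N ^ 2 := by
      rw [hNsq]
      have := (Finset.card_union_le (S i) (S j)).trans (add_le_add (hcard i) (hcard j))
      have h2 : ((S i ∪ S j).card : ℝ) ≤ ((n + 1 + (n + 1) : ℕ) : ℝ) := by exact_mod_cast this
      push_cast at h2
      linarith
    simp only [PiLp.sub_apply]
    rw [← Finset.sum_subset (Finset.subset_univ (S i ∪ S j)) fun b _ hb => ?_]
    · calc ∑ b ∈ S i ∪ S j, (ψ b (f i) / N - ψ b (f j) / N) ^ 2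
          ≤ ∑ b ∈ S i ∪ S j, dist (f j) (f i) ^ 2 / N ^ 2 := by
            refine Finset.sum_le_sum fun b _ => ?_
            rw [← sub_div, div_pow, ← sq_abs (ψ b (f i) - ψ b (f j))]
            have := hψL b (f i) (f j)
            rw [dist_comm] at this
            gcongr
        _ = (S i ∪ S j).card * (dist (f j) (f i) ^ 2 / N ^ 2) := by
            rw [Finset.sum_const, nsmul_eq_mul]
        _ ≤ N ^ 2 * (dist (f j) (f i) ^ 2 / N ^ 2) := by gcongr
        _ = dist (f j) (f i) ^ 2 := by field_simp
    · simp only [hS, Finset.mem_union, Finset.mem_filter, Finset.mem_univ, true_and, not_or] at hb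
      rw [hψ0 b b.2 _ hb.1, hψ0 b b.2 _ hb.2]
      simp
  · obtain ⟨b, hbB, hib⟩ := hcov (f i)
    have hbF : b ∈ hfin.toFinset := hfin.mem_toFinset.2 <|
      Set.mem_iUnion.2 ⟨i, hbB, f i, hib, mem_ball_self hr3⟩
    have h1 : ψ b (f i) = r / 3 := by
      simp only [hψ, infDist_zero_of_mem hib, sub_zero, max_eq_right hr3.le]
    have h2 : ψ b (f j) = 0 := by
      refine hψ0 b hbF _ ?_
      rintro ⟨z, hz, hzj⟩
      rw [mem_ball] at hzj
      have h3 := (ENNReal.ofReal_le_ofReal_iff' ).1 ((le_ediamD hib hz).trans (hdiam b hbB))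
      have h4 := dist_triangle (f i) z (f j)
      have h5 : γ * r ≤ max γ 0 * r := mul_le_mul_of_nonneg_right (le_max_left _ _) hr.le
      have h6 : 0 ≤ max γ 0 * r := mul_nonneg (le_max_right _ _) hr.le
      rcases h3 with h3 | h3 <;> linarith
    have h3 := PiLp.norm_apply_le ((WithLp.toLp 2 fun b : hfin.toFinset => ψ b (f j) / N) -
      (WithLp.toLp 2 fun b : hfin.toFinset => ψ b (f i) / N) : EuclideanSpace ℝ hfin.toFinset)
      ⟨b, hbF⟩
    refine le_trans (le_of_eq ?_) h3
    simp only [PiLp.sub_apply]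
    rw [h1, h2, zero_div, zero_sub, norm_neg, Real.norm_of_nonneg (by positivity), div_div]

theorem exists_hasMarkovType2_of_nagataDimD {Y : Type*} [PseudoMetricSpace Y] {n : ℕ} {γ : ℝ}
    (hN : NagataDimD (dist : Y → Y → ℝ) n γ) : ∃ M, HasMarkovType2 (dist : Y → Y → ℝ) M := by
  set C : ℝ := (max γ 0 + 1) * (4 * (3 * √(2 * (n + 1)))) with hCdef
  have hroot : 0 < √(2 * ((n : ℝ) + 1)) := Real.sqrt_pos.2 (by positivity)
  have hC : 0 < C := mul_pos (by linarith [le_max_right γ 0]) (by positivity)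
  refine ⟨63 * C, fun N μ P h1 h2 h3 h4 h5 f t => ?_⟩
  have hP : IsReversibleChain μ P := ⟨h1, h2, h3, h4, h5⟩
  obtain _ | N := N
  · simp at h2
  rcases Nat.eq_zero_or_pos t with rfl | ht
  · simp [Matrix.one_apply]
  refine hP.sum_sq_le_of_tail hC (fun _ _ => dist_nonneg) ht fun s hs => ?_
  obtain ⟨F, h, hL, hU⟩ := exists_euclidean_of_nagataDimD hN f
    (r := 4 * s * (3 * √(2 * (n + 1)))) (by positivity)
  refine hP.tail_le_scaled (h := h) hL hs (fun i j hij => ?_) t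
  have := hU i j (le_trans (le_of_eq (by rw [hCdef]; ring)) hij)
  rwa [mul_div_cancel_right₀ _ (by positivity)] at this

end NagataMarkov

/-- For a 1-separated metric space `X`, with `La(X)` equipped with the
lamplighter metric `d_La = TSP + ρ`, the following are equivalent:
(i) `X` is TSP-efficient; (ii) `La(X)` admits a weak biLipschitz embedding into an
ℓ∞-product of finitely many ℝ-trees; (iii) `La(X)` has finite Nagata dimension;
(iv) `La(X)` has Markov type 2; (v) there is no `D` such that every Hamming cube `H_M`
embeds into `La(X)` with biLipschitz distortion at most `D`. -/
theorem statement0 (X : Type u) [MetricSpace X]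
    (hsep : ∀ x y : X, x ≠ y → 1 ≤ dist x y) :
    List.TFAE
      [ (∃ K : ℝ, TSPEfficient (dist : X → X → ℝ) K),
        (∃ (n : ℕ) (T : Fin n → Type u) (I : ∀ i, MetricSpace (T i)),
          (∀ i, @IsRTree (T i) (I i)) ∧
          ∃ C : ℝ, WeakBiLip (dLa (dist : X → X → ℝ)) (piSupDist I) C),
        (∃ (n : ℕ) (γ : ℝ), NagataDimD (dLa (dist : X → X → ℝ)) n γ),
        (∃ M : ℝ, HasMarkovType2 (dLa (dist : X → X → ℝ)) M),
        (¬ ∃ D : ℝ, ∀ M : ℕ, ∃ f : (Fin M → Bool) → Lamp X,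
            BiLipWith hamDist (dLa (dist : X → X → ℝ)) D f) ] := by
  tfae_have 1 → 2 := fun ⟨_, hE⟩ => weakBiLip_of_TSPEfficient hsep hE
  tfae_have 1 → 3 := fun ⟨_, hE⟩ => nagataDimD_of_TSPEfficient hsep hE
  tfae_have 2 → 5 := fun ⟨_, _, _, hT, _, hφ⟩ => not_cube_biLip_of_weakBiLip hT hφ
  tfae_have 3 → 4 := fun ⟨_, _, hN⟩ =>
    letI := lampPseudoMetric X
    exists_hasMarkovType2_of_nagataDimD hN
  tfae_have 4 → 5 := fun ⟨_, h⟩ => not_cube_biLip_of_hasMarkovType2 h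
  tfae_have 5 → 1 := by
    contrapose!
    exact fun hE => ⟨32, exists_cube_biLip hsep (by push Not; exact hE)⟩
  tfae_finish

end Lamplighter
end
end

section
/- Let n ∈ ℕ, γ, C < ∞, and let X, Y be metric spaces. Suppose Y has Nagata dimension ≤ n with constant ≤ γ and that there exists a weak C-biLipschitz embedding {φ^t : X → Y}_{t>0}. Then X has Nagata dimension ≤ n with constant ≤ Cγ. -/
open Metric Set
open scoped Classical ENNReal NNReal

noncomputable section

namespace Lamplighter

variable {X Y Z : Type*}

theorem ofReal_le_ediamD {d : X → X → ℝ} {A : Set X} {x y : X} (hx : x ∈ A) (hy : y ∈ A) :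
    ENNReal.ofReal (d x y) ≤ ediamD d A :=
  le_iSup₂_of_le x hx (le_iSup₂_of_le y hy le_rfl)

theorem ediamD_le_iff {d : X → X → ℝ} {A : Set X} {r : ℝ≥0∞} :
    ediamD d A ≤ r ↔ ∀ x ∈ A, ∀ y ∈ A, ENNReal.ofReal (d x y) ≤ r := by
  simp only [ediamD, iSup_le_iff]

theorem ediamD_image_lt {dX : X → X → ℝ} {dY : Y → Y → ℝ} {f : X → Y} {σ s : ℝ} (hσ : 0 < σ)
    (hf : ∀ x y, dY (f x) (f y) ≤ σ * dX x y) {A : Set X}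
    (hA : ediamD dX A < ENNReal.ofReal s) :
    ediamD dY (f '' A) < ENNReal.ofReal (σ * s) := by
  rw [ENNReal.ofReal_mul hσ.le]
  refine lt_of_le_of_lt ?_ (ENNReal.mul_lt_mul_right
    (ENNReal.ofReal_pos.2 hσ).ne' ENNReal.ofReal_ne_top hA)
  rw [ediamD_le_iff]
  rintro _ ⟨x, hx, rfl⟩ _ ⟨y, hy, rfl⟩
  calc ENNReal.ofReal (dY (f x) (f y)) ≤ ENNReal.ofReal (σ * dX x y) :=
        ENNReal.ofReal_le_ofReal (hf x y)
    _ = ENNReal.ofReal σ * ENNReal.ofReal (dX x y) := ENNReal.ofReal_mul hσ.le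
    _ ≤ _ := by gcongr; exact ofReal_le_ediamD hx hy

/-- Colorings of a space whose color classes have diameter at most `D + ε`, for every `ε > 0`,
and for which sets of small diameter have at most `n + 1` colors, yield a covering by sets of
diameter at most `D`, by passing to an ultralimit. -/
theorem exists_cover_of_approx {d : X → X → ℝ} {n : ℕ} {D : ℝ} {S : ℝ≥0∞}
    (h : ∀ ε : ℝ, 0 < ε → ∃ g : X → Z, (∀ x y, g x = g y → d x y ≤ D + ε) ∧
      ∀ A : Set X, ediamD d A < S → (g '' A).encard ≤ (n : ℕ∞) + 1) :
    ∃ B : Set (Set X), (∀ x, ∃ b ∈ B, x ∈ b) ∧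
      (∀ b ∈ B, ediamD d b ≤ ENNReal.ofReal D) ∧
      ∀ A : Set X, ediamD d A < S →
        {b | b ∈ B ∧ (b ∩ A).Nonempty}.encard ≤ (n : ℕ∞) + 1 := by
  choose g hg hgA using fun k : ℕ => h (1 / ((k : ℝ) + 1)) Nat.one_div_pos_of_nat
  let U : Ultrafilter ℕ := Filter.hyperfilter ℕ
  let c : X → Set X := fun x => {y | ∀ᶠ k in U, g k x = g k y}
  have hc : ∀ {x y z}, y ∈ c x → z ∈ c x → ∀ᶠ k in U, g k y = g k z := by
    intro x y z hy hz
    filter_upwards [hy, hz] with k h1 h2 using h1.symm.trans h2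
  refine ⟨range c, fun x => ⟨c x, ⟨x, rfl⟩, Filter.Eventually.of_forall fun _ => rfl⟩, ?_, ?_⟩
  · rintro _ ⟨x, rfl⟩
    rw [ediamD_le_iff]
    intro y hy z hz
    refine ENNReal.ofReal_le_ofReal ?_
    have hlim : Filter.Tendsto (fun k : ℕ => D + 1 / ((k : ℝ) + 1)) U (nhds (D + 0)) :=
      (tendsto_const_nhds.add tendsto_one_div_add_atTop_nhds_zero_nat).mono_left
        Nat.hyperfilter_le_atTop
    rw [add_zero] at hlim
    refine ge_of_tendsto hlim ?_
    filter_upwards [hc hy hz] with k hk using hg k y z hk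
  · intro A hA
    by_contra! hlt
    have hle : ((n + 2 : ℕ) : ℕ∞) ≤ {b | b ∈ range c ∧ (b ∩ A).Nonempty}.encard := by
      have := Order.add_one_le_of_lt hlt
      push_cast
      rwa [add_assoc, one_add_one_eq_two] at this
    obtain ⟨T, hTsub, hT⟩ := Set.exists_subset_encard_eq hle
    have hTfin : T.Finite := Set.finite_of_encard_eq_coe hT
    obtain ⟨b₀, hb₀⟩ : T.Nonempty :=
      Set.encard_ne_zero.1 (by rw [hT]; exact_mod_cast Nat.succ_ne_zero (n + 1))
    have : Nonempty X := ⟨(hTsub hb₀).2.some⟩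
    choose! p hp using fun b (hb : b ∈ T) => (hTsub hb).2
    have hne : ∀ b ∈ T, ∀ b' ∈ T, b ≠ b' → ∀ᶠ k in U, g k (p b) ≠ g k (p b') := by
      intro b hb b' hb' hbb'
      refine Ultrafilter.eventually_not.2 fun hev => hbb' ?_
      obtain ⟨x, rfl⟩ := (hTsub hb).1
      obtain ⟨y, rfl⟩ := (hTsub hb').1
      have h1 : ∀ᶠ k in U, g k x = g k (p (c x)) := (hp _ hb).1
      have h2 : ∀ᶠ k in U, g k y = g k (p (c y)) := (hp _ hb').1
      have h3 : ∀ᶠ k in U, g k x = g k y := by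
        filter_upwards [h1, h2, hev] with k e1 e2 e3 using (e1.trans e3).trans e2.symm
      ext z
      constructor <;> intro hz
      · exact hc (x := x) h3 hz
      · have hz' : ∀ᶠ k in U, g k y = g k z := hz
        filter_upwards [h3, hz'] with k e1 e2 using e1.trans e2
    have hall : ∀ᶠ k in U, ∀ b ∈ T, ∀ b' ∈ T, b ≠ b' → g k (p b) ≠ g k (p b') := by
      simp only [Filter.eventually_all_finite hTfin, Filter.eventually_imp_distrib_left]
      exact hne
    obtain ⟨k, hk⟩ := hall.exists
    have hinj : InjOn (fun b => g k (p b)) T := fun b hb b' hb' e => by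
      by_contra hbb'
      exact hk b hb b' hb' hbb' e
    have hcard : T.encard ≤ (g k '' A).encard := by
      rw [← hinj.encard_image]
      refine Set.encard_le_encard ?_
      rintro _ ⟨b, hb, rfl⟩
      exact ⟨p b, (hp b hb).2, rfl⟩
    have hbad := hcard.trans (hgA k A hA)
    rw [hT] at hbad
    have : n + 2 ≤ n + 1 := by exact_mod_cast hbad
    omega

/-- If `Y` has Nagata dimension `≤ n` with constant `≤ γ` and there is a
weak `C`-biLipschitz embedding of `X` into `Y`, then `X` has Nagata dimension `≤ n` with
constant `≤ C * γ`. -/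
theorem statement2 (n : ℕ) (γ C : ℝ) (X : Type u) (Y : Type v)
    [MetricSpace X] [MetricSpace Y]
    (hY : NagataDimD (dist : Y → Y → ℝ) n γ)
    (hemb : WeakBiLip (dist : X → X → ℝ) (dist : Y → Y → ℝ) C) :
    NagataDimD (dist : X → X → ℝ) n (C * γ) := by
  obtain ⟨φ, hφ⟩ := hemb
  intro s hs
  rcases isEmpty_or_nonempty X with hX | ⟨⟨x₀⟩⟩
  · exact ⟨∅, fun x => isEmptyElim x, by simp, by simp⟩
  have hC : 0 < C := by
    by_contra! hC
    obtain ⟨σ, hσ, -, hlow⟩ := hφ 1 one_pos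
    have := hlow x₀ x₀ (by simpa using hC)
    rw [dist_self] at this
    linarith
  have hbound : ENNReal.ofReal (C * γ * s) = ENNReal.ofReal (C * (max γ 0 * s)) := by
    rcases le_total 0 γ with hγ | hγ
    · rw [max_eq_left hγ, mul_assoc]
    · rw [max_eq_right hγ, zero_mul, mul_zero, ENNReal.ofReal_zero, ENNReal.ofReal_eq_zero]
      exact mul_nonpos_of_nonpos_of_nonneg (mul_nonpos_of_nonneg_of_nonpos hC.le hγ) hs.le
  rw [hbound]
  refine exists_cover_of_approx (Z := Set Y) fun ε hε => ?_
  have hm : 0 ≤ max γ 0 * s := mul_nonneg (le_max_right _ _) hs.le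
  have ht : 0 < max γ 0 * s + ε / C := by positivity
  obtain ⟨σ, hσ, hlip, hlow⟩ := hφ _ ht
  obtain ⟨B, hcov, hdiam, hmult⟩ := hY (σ * s) (mul_pos hσ hs)
  choose b hbB hb using hcov
  refine ⟨fun x => b (φ (max γ 0 * s + ε / C) x), fun x y hxy => ?_, fun A hA => ?_⟩
  · beta_reduce at hxy
    by_contra! hlt
    have h1 := hlow x y (by rw [mul_add, mul_div_cancel₀ _ hC.ne']; exact hlt.le)
    have h2 := (ofReal_le_ediamD (d := dist) (hb (φ (max γ 0 * s + ε / C) x))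
      (hxy ▸ hb (φ (max γ 0 * s + ε / C) y))).trans (hdiam _ (hbB _))
    have h3 : γ * (σ * s) ≤ max γ 0 * (σ * s) :=
      mul_le_mul_of_nonneg_right (le_max_left _ _) (by positivity)
    have h4 := (ENNReal.ofReal_le_ofReal_iff (by positivity)).1
      (h2.trans (ENNReal.ofReal_le_ofReal h3))
    have h5 : 0 < ε / C * σ := by positivity
    linarith [add_mul (max γ 0 * s) (ε / C) σ, mul_right_comm (max γ 0) s σ,
      mul_assoc (max γ 0) σ s]
  · refine (Set.encard_le_encard ?_).trans (hmult _ (ediamD_image_lt hσ hlip hA))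
    rintro _ ⟨x, hx, rfl⟩
    exact ⟨hbB _, _, hb _, x, hx, rfl⟩

end Lamplighter
end
end
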